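/- Let p and q be primes with p ≡ 5 (mod 8) and q ≡ 3 (mod 8), d = pq, and assume the Legendre symbol (p/q) = -1. Then for every n ≥ 1, the 2-class group of L_{n,d} is isomorphic to ℤ/2^{n+1}ℤ. -/

import Mathlib

open IntermediateField NumberField

/-- The quadratic field `ℚ(√m)` realized inside `ℂ` (for `m` of either sign). -/
noncomputable def quadField (m : ℤ) : IntermediateField ℚ ℂ :=
  IntermediateField.adjoin ℚ {z : ℂ | z ^ 2 = (m : ℂ)}

/-- The 2-class group of a number field `K ⊆ ℂ`: the 2-primary component
(= 2-Sylow subgroup) of the ideal class group of its ring of integers. -/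
noncomputable def twoClassGroup (K : IntermediateField ℚ ℂ) :
    Subgroup (ClassGroup (𝓞 K)) :=
  CommGroup.primaryComponent _ 2

/-- `h₂(m)`: the 2-class number of the quadratic field `ℚ(√m)`. -/
noncomputable def h2 (m : ℤ) : ℕ := Nat.card (twoClassGroup (quadField m))

/-- `L_{n,d} = ℚ(ζ_{2^{n+2}}, √d)`, the `n`-th layer of the cyclotomic
`ℤ₂`-extension of `ℚ(√d, √-1)`. -/
noncomputable def Lfield (n : ℕ) (d : ℤ) : IntermediateField ℚ ℂ :=
  IntermediateField.adjoin ℚ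
    ({z : ℂ | z ^ 2 ^ (n + 2) = 1} ∪ {z : ℂ | z ^ 2 = (d : ℂ)})

/-- `ℚ(ζ_{2^{n+2}} + ζ_{2^{n+2}}⁻¹, √d) = ℚ(2cos(2π/2^{n+2}), √d)`.
For `d > 0` this is the maximal real subfield `L_{n,d}⁺` of `L_{n,d}`;
for `d < 0` it is the `n`-th layer `K_{n,|d|}` of the cyclotomic
`ℤ₂`-extension of the imaginary quadratic field `ℚ(√d)`. -/
noncomputable def LplusField (n : ℕ) (d : ℤ) : IntermediateField ℚ ℂ :=
  IntermediateField.adjoin ℚ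
    ({((2 * Real.cos (2 * Real.pi / 2 ^ (n + 2)) : ℝ) : ℂ)} ∪ {z : ℂ | z ^ 2 = (d : ℂ)})

open NumberField
open scoped Pointwise

section QuadA
variable {K L : Type*} [Field K] [NumberField K] [Field L] [NumberField L] [Algebra K L]
  [Algebra.IsQuadraticExtension K L]

theorem qa_card : Nat.card (Gal(L/K)) = 2 := by
  rw [IsGalois.card_aut_eq_finrank, Algebra.IsQuadraticExtension.finrank_eq_two]

theorem qa_cases {σ : Gal(L/K)} (hσ : σ ≠ 1) (g : Gal(L/K)) : g = 1 ∨ g = σ := by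
  classical
  by_contra! h
  have : ({1, g, σ} : Finset (Gal(L/K))).card ≤ Fintype.card (Gal(L/K)) := Finset.card_le_univ _
  rw [← Nat.card_eq_fintype_card, qa_card] at this
  rw [Finset.card_insert_of_notMem, Finset.card_insert_of_notMem] at this
  · simp at this
  · simpa using h.2
  · simp [Ne.symm h.1, Ne.symm hσ]

theorem qa_sq {σ : Gal(L/K)} (hσ : σ ≠ 1) : σ * σ = 1 := by
  rcases qa_cases hσ (σ * σ) with h | h
  · exact h
  · exact absurd (mul_eq_left.mp h) hσ

theorem qa_invol {σ : Gal(L/K)} (hσ : σ ≠ 1) (x : L) : σ (σ x) = x := by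
  have := congrArg (fun g : Gal(L/K) => g x) (qa_sq hσ)
  simpa using this

theorem qa_invol_ideal {σ : Gal(L/K)} (hσ : σ ≠ 1) (I : Ideal (𝓞 L)) : σ • σ • I = I := by
  rw [smul_smul, qa_sq hσ, one_smul]

theorem qa_norm {σ : Gal(L/K)} (hσ : σ ≠ 1) (x : L) :
    algebraMap K L (Algebra.norm K x) = x * σ x := by
  classical
  rw [Algebra.norm_eq_prod_automorphisms]
  have : (Finset.univ : Finset (Gal(L/K))) = {1, σ} := by
    ext g; simp [qa_cases hσ g]
  rw [this, Finset.prod_pair (Ne.symm hσ)]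
  simp

theorem qa_fixed {σ : Gal(L/K)} (hσ : σ ≠ 1) {x : L} (hx : σ x = x) :
    ∃ y : K, algebraMap K L y = x := by
  rw [← Set.mem_range, IsGalois.mem_range_algebraMap_iff_fixed]
  intro g
  rcases qa_cases hσ g with rfl | rfl
  · simp
  · exact hx

/-- extension of ideals -/
noncomputable abbrev extI (L : Type*) {K : Type*} [Field K] [Field L] [Algebra K L] (I : Ideal (𝓞 K)) :
    Ideal (𝓞 L) :=
  I.map (algebraMap (𝓞 K) (𝓞 L))

/-- ramified primes -/
structure RamP (σ : Gal(L/K)) (P : Ideal (𝓞 L)) : Prop where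
  prime : P.IsPrime
  ne_bot : P ≠ ⊥
  fixed : σ • P = P
  sq : extI L (P.under (𝓞 K)) = P ^ 2
  inertia : ∀ x : 𝓞 L, σ • x - x ∈ P

theorem qa_smul_ext (σ : Gal(L/K)) (I : Ideal (𝓞 K)) : σ • extI L I = extI L I := by
  rw [Ideal.pointwise_smul_def, extI, Ideal.map_map]
  congr 1
  ext x
  simp 

theorem qa_trichotomy {σ : Gal(L/K)} (hσ : σ ≠ 1) (P : Ideal (𝓞 L)) [P.IsPrime] (hP : P ≠ ⊥) :
    (σ • P ≠ P ∧ extI L (P.under (𝓞 K)) = P * σ • P) ∨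
    (σ • P = P ∧ extI L (P.under (𝓞 K)) = P) ∨ RamP σ P := by
  classical
  set p := P.under (𝓞 K) with hp
  have hpm : p.IsMaximal := by
    have : P.IsMaximal := Ideal.IsPrime.isMaximal inferInstance hP
    exact Ideal.isMaximal_comap_of_isIntegral_of_isMaximal P
  have hp0 : p ≠ ⊥ := mt Ideal.eq_bot_of_comap_eq_bot hP
  have hlo : P.LiesOver p := ⟨rfl⟩
  have hset : p.primesOver (𝓞 L) = {P, σ • P} := by
    ext Q
    constructor
    · rintro ⟨h1, h2⟩
      obtain ⟨g, hg⟩ := Ideal.exists_smul_eq_of_isGaloisGroup p P Q (Gal(L/K))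
      rcases qa_cases hσ g with rfl | rfl
      · left; simpa using hg.symm
      · right; exact hg.symm
    · rintro (rfl | rfl)
      · exact ⟨inferInstance, inferInstance⟩
      · exact ⟨inferInstance, inferInstance⟩
  have hprod := Ideal.map_algebraMap_eq_finsetProd_pow (R := 𝓞 L) (p := p) hp0
  have hcard := Ideal.ncard_primesOver_mul_ramificationIdxIn_mul_inertiaDegIn p (𝓞 L) (Gal(L/K))
  rw [qa_card] at hcard
  have hram : ∀ Q ∈ p.primesOver (𝓞 L), Q.ramificationIdx (𝓞 K) = p.ramificationIdxIn (𝓞 L) := by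
    rintro Q ⟨h1, h2⟩
    exact (Ideal.ramificationIdxIn_eq_ramificationIdx p Q (Gal(L/K))).symm
  have hprod2 : extI L p = ∏ Q ∈ (p.primesOver (𝓞 L)).toFinset, Q ^ (p.ramificationIdxIn (𝓞 L)) := by
    rw [extI, hprod]
    refine Finset.prod_congr rfl fun Q hQ => ?_
    rw [hram Q (by simpa using hQ)]
  by_cases h : σ • P = P
  · right
    have hset' : p.primesOver (𝓞 L) = {P} := by rw [hset, h]; simp
    have hfs : (p.primesOver (𝓞 L)).toFinset = {P} := by ext; simp [hset']
    rw [hfs, Finset.prod_singleton] at hprod2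
    rw [hset', Set.ncard_singleton, one_mul] at hcard
    have hle : p.ramificationIdxIn (𝓞 L) ∣ 2 := Dvd.intro _ hcard
    rcases (Nat.dvd_prime Nat.prime_two).mp hle with h1 | h1
    · left; exact ⟨h, by rw [hprod2, h1, pow_one]⟩
    · right
      refine ⟨inferInstance, hP, h, by rw [← hp, hprod2, h1], fun x => ?_⟩
      have hi := Ideal.card_inertia_eq_ramificationIdxIn (R := 𝓞 K) (S := 𝓞 L) (G := Gal(L/K)) p P
      rw [h1] at hi
      have : P.inertia (Gal(L/K)) = ⊤ := by
        apply Subgroup.eq_top_of_card_eq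
        rw [qa_card]; exact hi
      have hm : σ ∈ P.inertia (Gal(L/K)) := this ▸ Subgroup.mem_top σ
      exact hm x
  · left
    refine ⟨h, ?_⟩
    have hfs : (p.primesOver (𝓞 L)).toFinset = {P, σ • P} := by ext; simp [hset]
    rw [hfs, Finset.prod_pair (Ne.symm h)] at hprod2
    rw [hset, Set.ncard_pair (Ne.symm h)] at hcard
    have h1 : p.ramificationIdxIn (𝓞 L) = 1 := by
      have : p.ramificationIdxIn (𝓞 L) * p.inertiaDegIn (𝓞 L) = 1 := by omega
      exact Nat.eq_one_of_mul_eq_one_right this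
    rw [hprod2, h1, pow_one, pow_one]
end QuadA

open NumberField
set_option linter.unusedSectionVars false
open scoped Pointwise

section Cl
variable {R : Type*} [CommRing R] [IsDedekindDomain R]

open Classical in
/-- class of an integral ideal -/
noncomputable def cl (I : Ideal R) : ClassGroup R :=
  if h : I ≠ ⊥ then ClassGroup.mk0 ⟨I, mem_nonZeroDivisors_of_ne_zero h⟩ else 1

theorem cl_def {I : Ideal R} (h : I ≠ ⊥) :
    cl I = ClassGroup.mk0 ⟨I, mem_nonZeroDivisors_of_ne_zero h⟩ := by
  rw [cl, dif_pos h]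

theorem cl_mul {I J : Ideal R} (hI : I ≠ ⊥) (hJ : J ≠ ⊥) : cl (I * J) = cl I * cl J := by
  rw [cl_def hI, cl_def hJ, cl_def (mul_ne_zero hI hJ), ← map_mul]
  rfl

theorem cl_top : cl (⊤ : Ideal R) = 1 := by
  rw [cl_def (by exact top_ne_bot), ClassGroup.mk0_eq_one_iff]
  exact top_isPrincipal

theorem cl_pow {I : Ideal R} (hI : I ≠ ⊥) (n : ℕ) : cl (I ^ n) = cl I ^ n := by
  induction n with
  | zero => rw [pow_zero, pow_zero, Ideal.one_eq_top]; exact cl_top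
  | succ n ih => rw [pow_succ, pow_succ, cl_mul (pow_ne_zero n hI) hI, ih]

theorem cl_surj (c : ClassGroup R) : ∃ I : Ideal R, I ≠ ⊥ ∧ cl I = c := by
  obtain ⟨I, rfl⟩ := ClassGroup.mk0_surjective c
  have : (I : Ideal R) ≠ ⊥ := nonZeroDivisors.ne_zero I.2
  exact ⟨I, this, cl_def this⟩

theorem cl_eq_one_iff {I : Ideal R} (hI : I ≠ ⊥) : cl I = 1 ↔ ∃ x, I = Ideal.span {x} := by
  rw [cl_def hI, ClassGroup.mk0_eq_one_iff]
  exact ⟨fun ⟨x, hx⟩ => ⟨x, hx⟩, fun ⟨x, hx⟩ => ⟨x, hx⟩⟩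

theorem cl_span (x : R) : cl (Ideal.span {x}) = 1 := by
  by_cases h : Ideal.span {x} = ⊥
  · rw [cl, dif_neg (by simpa using h)]
  · exact (cl_eq_one_iff h).mpr ⟨x, rfl⟩

theorem cl_eq_iff {I J : Ideal R} (hI : I ≠ ⊥) (hJ : J ≠ ⊥) : cl I = cl J ↔
    ∃ x y : R, x ≠ 0 ∧ y ≠ 0 ∧ Ideal.span {x} * I = Ideal.span {y} * J := by
  rw [cl_def hI, cl_def hJ, ClassGroup.mk0_eq_mk0_iff]
  constructor
  · rintro ⟨x, y, hx, hy, h⟩; exact ⟨x, y, hx, hy, h⟩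
  · rintro ⟨x, y, hx, hy, h⟩; exact ⟨x, y, hx, hy, h⟩

theorem span_ne_bot {x : R} (hx : x ≠ 0) : (Ideal.span {x} : Ideal R) ≠ ⊥ := by
  simpa using hx

theorem cl_prod {ι : Type*} (s : Finset ι) (f : ι → Ideal R) (h : ∀ i ∈ s, f i ≠ ⊥) :
    cl (∏ i ∈ s, f i) = ∏ i ∈ s, cl (f i) ∧ (∏ i ∈ s, f i) ≠ ⊥ := by
  classical
  induction s using Finset.induction_on with
  | empty => exact ⟨by simpa using cl_top, by simp⟩
  | insert a s ha ih =>
    obtain ⟨h1, h2⟩ := ih (fun i hi => h i (Finset.mem_insert_of_mem hi))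
    have := h a (Finset.mem_insert_self a s)
    rw [Finset.prod_insert ha, Finset.prod_insert ha]
    exact ⟨by rw [cl_mul this h2, h1], mul_ne_zero this h2⟩
end Cl

section QuadA2
variable {K L : Type*} [Field K] [NumberField K] [Field L] [NumberField L] [Algebra K L]
  [Algebra.IsQuadraticExtension K L]

theorem extI_ne_bot {I : Ideal (𝓞 K)} (h : I ≠ ⊥) : extI L I ≠ ⊥ := by
  rw [extI, Ne, Ideal.map_eq_bot_iff_of_injective]
  · exact h
  · exact FaithfulSMul.algebraMap_injective (𝓞 K) (𝓞 L)

theorem extI_mul (I J : Ideal (𝓞 K)) : extI L (I * J) = extI L I * extI L J := Ideal.map_mul _ _ _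
theorem extI_pow (I : Ideal (𝓞 K)) (n : ℕ) : extI L (I ^ n) = extI L I ^ n := Ideal.map_pow _ _ _
theorem extI_span (x : 𝓞 K) : extI L (Ideal.span {x}) = Ideal.span {algebraMap (𝓞 K) (𝓞 L) x} := by
  rw [extI, Ideal.map_span, Set.image_singleton]

theorem smul_ne_bot {G R : Type*} [Group G] [CommRing R] [MulSemiringAction G R] (g : G) {I : Ideal R} (h : I ≠ ⊥) : g • I ≠ ⊥ := by
  intro h'
  apply h
  have := congrArg (fun J => g⁻¹ • J) h'
  simpa using this

theorem smul_span {G R : Type*} [Group G] [CommRing R] [MulSemiringAction G R] (g : G) (x : R) :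
    g • (Ideal.span {x} : Ideal R) = Ideal.span {g • x} := by
  rw [Ideal.pointwise_smul_def, Ideal.map_span, Set.image_singleton]
  simp

theorem qa_mul_conj {σ : Gal(L/K)} (hσ : σ ≠ 1) (I : Ideal (𝓞 L)) (hI : I ≠ ⊥) :
    ∃ a : Ideal (𝓞 K), a ≠ ⊥ ∧ I * σ • I = extI L a := by
  induction I using UniqueFactorizationMonoid.induction_on_prime with
  | h₁ => exact absurd rfl hI
  | h₂ x hx =>
    rw [Ideal.isUnit_iff] at hx
    subst hx
    refine ⟨⊤, top_ne_bot, ?_⟩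
    rw [extI, Ideal.map_top, Ideal.pointwise_smul_def, Ideal.map_top, Ideal.mul_top]
  | h₃ I P hI0 hP ih =>
    obtain ⟨a, ha0, ha⟩ := ih hI0
    have hPp : P.IsPrime := Ideal.isPrime_of_prime hP
    have hu0 : P.under (𝓞 K) ≠ ⊥ := mt Ideal.eq_bot_of_comap_eq_bot hP.ne_zero
    obtain ⟨b, hb0, hb⟩ : ∃ b : Ideal (𝓞 K), b ≠ ⊥ ∧ P * σ • P = extI L b := by
      rcases qa_trichotomy hσ P hP.ne_zero with h | h | h
      · exact ⟨_, hu0, h.2.symm⟩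
      · exact ⟨P.under (𝓞 K) ^ 2, pow_ne_zero 2 hu0, by rw [extI_pow, h.2, h.1, sq]⟩
      · exact ⟨P.under (𝓞 K), hu0, by rw [h.sq, h.fixed, sq]⟩
    refine ⟨b * a, mul_ne_zero hb0 ha0, ?_⟩
    rw [extI_mul, ← ha, ← hb, smul_mul']
    ring

theorem qa_fixed_ideal {σ : Gal(L/K)} (hσ : σ ≠ 1) (I : Ideal (𝓞 L)) (hI : I ≠ ⊥) (hf : σ • I = I) :
    ∃ (a : Ideal (𝓞 K)) (T : Finset (Ideal (𝓞 L))), a ≠ ⊥ ∧ (∀ P ∈ T, RamP σ P) ∧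
      I = extI L a * ∏ P ∈ T, P := by
  classical
  induction hm : Ideal.absNorm I using Nat.strong_induction_on generalizing I with
  | _ m ih =>
  by_cases htop : I = ⊤
  · refine ⟨⊤, ∅, top_ne_bot, by simp, ?_⟩
    rw [extI, Ideal.map_top, htop]; simp
  obtain ⟨P, hPm, hPI⟩ := Ideal.exists_le_maximal I htop
  have hPp : P.IsPrime := hPm.isPrime
  have hP0 : P ≠ ⊥ := fun h => hI (le_bot_iff.mp (h ▸ hPI))
  have hPd : P ∣ I := Ideal.dvd_iff_le.mpr hPI
  have hu0 : P.under (𝓞 K) ≠ ⊥ := mt Ideal.eq_bot_of_comap_eq_bot hP0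
  -- general reduction
  have key : ∀ Q : Ideal (𝓞 L), Q ∣ I → Q ≤ P → σ • Q = Q →
      ∃ (J : Ideal (𝓞 L)) (a : Ideal (𝓞 K)) (T : Finset (Ideal (𝓞 L))), a ≠ ⊥ ∧
        (∀ P ∈ T, RamP σ P) ∧ J = extI L a * ∏ P ∈ T, P ∧ I = Q * J := by
    rintro Q ⟨J, rfl⟩ hQP hQ
    have hQ0 : Q ≠ ⊥ := fun h => hI (by rw [h]; simp)
    have hJ0 : J ≠ ⊥ := fun h => hI (by rw [h]; simp)
    have hJf : σ • J = J := by
      rw [smul_mul', hQ] at hf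
      exact mul_left_cancel₀ hQ0 hf
    have hlt : Ideal.absNorm J < m := by
      rw [← hm, map_mul]
      have h1 : Ideal.absNorm J ≠ 0 := by rwa [Ne, Ideal.absNorm_eq_zero_iff]
      have h2 : Ideal.absNorm Q ≠ 0 := by rwa [Ne, Ideal.absNorm_eq_zero_iff]
      have h3 : Ideal.absNorm Q ≠ 1 := by
        rw [Ne, Ideal.absNorm_eq_one_iff]
        rintro rfl
        exact hPm.ne_top (top_le_iff.mp hQP)
      have : 2 ≤ Ideal.absNorm Q := by omega
      nlinarith [Nat.pos_of_ne_zero h1]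
    obtain ⟨a, T, ha, hT, hJ⟩ := ih _ hlt J hJ0 hJf rfl
    exact ⟨J, a, T, ha, hT, hJ, rfl⟩
  rcases qa_trichotomy hσ P hP0 with h | h | h
  · have hd : P * σ • P ∣ I := by
      have hcop : IsCoprime P (σ • P) := by
        have : (σ • P).IsMaximal := Ideal.IsPrime.isMaximal inferInstance (smul_ne_bot σ hP0)
        exact Ideal.isCoprime_iff_sup_eq.mpr (Ideal.IsMaximal.coprime_of_ne hPm this (Ne.symm h.1))
      refine hcop.mul_dvd hPd ?_
      obtain ⟨J, hJ⟩ := hPd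
      refine ⟨σ • J, ?_⟩
      rw [← smul_mul', ← hJ, hf]
    obtain ⟨J, a, T, ha, hT, hJ, hI'⟩ := key _ hd Ideal.mul_le_left (by
      rw [smul_mul', qa_invol_ideal hσ, mul_comm])
    exact ⟨P.under (𝓞 K) * a, T, mul_ne_zero hu0 ha, hT, by rw [hI', hJ, extI_mul, h.2]; ring⟩
  · obtain ⟨J, a, T, ha, hT, hJ, hI'⟩ := key P hPd le_rfl h.1
    exact ⟨P.under (𝓞 K) * a, T, mul_ne_zero hu0 ha, hT, by rw [hI', hJ, extI_mul, h.2]; ring⟩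
  · obtain ⟨J, a, T, ha, hT, hJ, hI'⟩ := key P hPd le_rfl h.fixed
    by_cases hPT : P ∈ T
    · refine ⟨P.under (𝓞 K) * a, T.erase P, mul_ne_zero hu0 ha,
        fun Q hQ => hT Q (Finset.mem_of_mem_erase hQ), ?_⟩
      rw [hI', hJ, extI_mul, h.sq, ← Finset.mul_prod_erase T (fun P => P) hPT]
      ring
    · refine ⟨a, insert P T, ha, ?_, ?_⟩
      · intro Q hQ
        rcases Finset.mem_insert.mp hQ with rfl | hQ
        · exact h
        · exact hT Q hQ
      · rw [hI', hJ, Finset.prod_insert hPT]; ring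

theorem qa_exists_ne {σ : Gal(L/K)} (hσ : σ ≠ 1) : ∃ θ : L, θ ≠ 0 ∧ σ θ = - θ := by
  obtain ⟨x, hx⟩ : ∃ x, σ x ≠ x := by
    by_contra! h
    exact hσ (AlgEquiv.ext h)
  refine ⟨x - σ x, sub_ne_zero.mpr (Ne.symm hx), ?_⟩
  rw [map_sub, qa_invol hσ]; ring

theorem coe_smul_int (σ : Gal(L/K)) (x : 𝓞 L) : algebraMap (𝓞 L) L (σ • x) = σ (algebraMap (𝓞 L) L x) := rfl

theorem qa_h90 {σ : Gal(L/K)} (hσ : σ ≠ 1) {x : L} (hx : x * σ x = 1) :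
    ∃ y : 𝓞 L, y ≠ 0 ∧ x * σ (algebraMap (𝓞 L) L y) = algebraMap (𝓞 L) L y := by
  obtain ⟨z, hz0, hz⟩ : ∃ z : L, z ≠ 0 ∧ x * σ z = z := by
    by_cases h : x = -1
    · obtain ⟨θ, h0, h1⟩ := qa_exists_ne hσ
      exact ⟨θ, h0, by rw [h1, h]; ring⟩
    · refine ⟨1 + x, fun h' => h (by linear_combination h'), ?_⟩
      rw [map_add, map_one, mul_add, hx]; ring
  obtain ⟨a, b, hb, rfl⟩ := IsFractionRing.div_surjective (A := 𝓞 L) z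
  have hb0 : (algebraMap (𝓞 L) L b) ≠ 0 := by simpa using nonZeroDivisors.ne_zero hb
  have ha0 : (algebraMap (𝓞 L) L a) ≠ 0 := fun h => hz0 (by rw [h, zero_div])
  have hsb0 : σ (algebraMap (𝓞 L) L b) ≠ 0 := by simpa using hb0
  refine ⟨a * σ • b, ?_, ?_⟩
  · intro h
    have := congrArg (algebraMap (𝓞 L) L) h
    rw [map_mul, map_zero, coe_smul_int] at this
    exact (mul_ne_zero ha0 hsb0) this
  · rw [map_div₀] at hz
    field_simp at hz
    rw [map_mul, coe_smul_int, map_mul, qa_invol hσ]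
    linear_combination hz

theorem qa_KL {σ : Gal(L/K)} (hσ : σ ≠ 1) {I : Ideal (𝓞 L)} (hI : I ≠ ⊥) {a b : 𝓞 L} (ha : a ≠ 0)
    (hb : b ≠ 0) (h : Ideal.span {b} * σ • I = Ideal.span {a} * I) (w : (𝓞 L)ˣ)
    (hw : a * σ • a = b * σ • b * (w * σ • (w : 𝓞 L))) :
    ∃ J : Ideal (𝓞 L), J ≠ ⊥ ∧ σ • J = J ∧ cl J = cl I := by
  have ha' : (algebraMap (𝓞 L) L a) ≠ 0 := by simpa using ha
  have hb' : (algebraMap (𝓞 L) L b) ≠ 0 := by simpa using hb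
  have hw' : (algebraMap (𝓞 L) L w) ≠ 0 := by simp
  have hsb : σ (algebraMap (𝓞 L) L b) ≠ 0 := by simpa using hb'
  have hsw : σ (algebraMap (𝓞 L) L w) ≠ 0 := by simp
  obtain ⟨y, hy0, hy⟩ := qa_h90 hσ (x := (algebraMap (𝓞 L) L a) / (algebraMap (𝓞 L) L b * algebraMap (𝓞 L) L w)) (by
    have := congrArg (algebraMap (𝓞 L) L) hw
    simp only [map_mul, coe_smul_int] at this
    rw [map_div₀, map_mul]
    field_simp
    rw [this]; ring)
  have hy' : a * σ • y = b * w * y := by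
    apply RingOfIntegers.coe_injective
    rw [map_mul, map_mul, map_mul, coe_smul_int]
    field_simp at hy
    rw [hy]
  have hsp : Ideal.span {b * (w : 𝓞 L)} = Ideal.span {b} :=
    Ideal.span_singleton_mul_right_unit w.isUnit b
  refine ⟨Ideal.span {y} * I, mul_ne_zero (span_ne_bot hy0) hI, ?_, ?_⟩
  · apply mul_left_cancel₀ (span_ne_bot hb)
    calc Ideal.span {b} * σ • (Ideal.span {y} * I) = (Ideal.span {b} * σ • I) * Ideal.span {σ • y} := by
          rw [smul_mul', smul_span]; ring
      _ = Ideal.span {a * σ • y} * I := by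
          rw [h, ← Ideal.span_singleton_mul_span_singleton]; ring
      _ = _ := by
          rw [hy', ← Ideal.span_singleton_mul_span_singleton, hsp]; ring
  · rw [cl_mul (span_ne_bot hy0) hI, cl_span, one_mul]

end QuadA2

open NumberField
set_option linter.unusedSectionVars false

section IndexSq

theorem dblIdx_finite (T : Type*) [AddCommGroup T] [Finite T] :
    (nsmulAddMonoidHom 2 : T →+ T).range.index = Nat.card (nsmulAddMonoidHom 2 : T →+ T).ker := by
  have h1 := (nsmulAddMonoidHom 2 : T →+ T).ker.card_mul_index
  rw [AddSubgroup.index_ker] at h1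
  have h2 := (nsmulAddMonoidHom 2 : T →+ T).range.card_mul_index
  have h3 : 0 < Nat.card (nsmulAddMonoidHom 2 : T →+ T).range := Nat.card_pos
  apply Nat.eq_of_mul_eq_mul_left h3
  rw [h2, ← h1, mul_comm]

theorem dblIdx_free (n : ℕ) :
    (nsmulAddMonoidHom 2 : (Fin n → ℤ) →+ (Fin n → ℤ)).range.index = 2 ^ n := by
  let f : (Fin n → ℤ) →+ (Fin n → ZMod 2) :=
    (Int.castAddHom (ZMod 2)).compLeft (Fin n)
  have hf : Function.Surjective f := fun y => by
    refine ⟨fun i => (y i).val, ?_⟩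
    ext i
    simp [f]
  have hk : (nsmulAddMonoidHom 2 : (Fin n → ℤ) →+ (Fin n → ℤ)).range = f.ker := by
    ext x
    constructor
    · rintro ⟨y, rfl⟩
      rw [AddMonoidHom.mem_ker]
      ext i
      have : (2 : ZMod 2) = 0 := rfl
      simp [f, this]
    · intro h
      rw [AddMonoidHom.mem_ker] at h
      have h' : ∀ i, (2 : ℤ) ∣ x i := fun i => by
        have := congrFun h i
        exact (ZMod.intCast_zmod_eq_zero_iff_dvd (x i) 2).mp (by simpa [f] using this)
      choose y hy using h'
      exact ⟨y, by ext i; simp [hy i]⟩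
  rw [hk, AddSubgroup.index_ker, AddMonoidHom.range_eq_top_of_surjective f hf, AddSubgroup.card_top]
  simp

theorem dblIdx (A : Type*) [AddCommGroup A] [Module.Finite ℤ A] :
    (nsmulAddMonoidHom 2 : A →+ A).range.index =
      2 ^ Module.finrank ℤ A * Nat.card (nsmulAddMonoidHom 2 : A →+ A).ker := by
  have hfg : AddGroup.FG A := Module.Finite.iff_addGroup_fg.mp inferInstance
  obtain ⟨n, ι, _, p, hp, e, ⟨f⟩⟩ := AddCommGroup.equiv_free_prod_directSum_zmod A
  have hpos : ∀ i, NeZero (p i ^ e i) := fun i => ⟨pow_ne_zero _ (hp i).ne_zero⟩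
  set T := DirectSum ι fun i => ZMod (p i ^ e i) with hT
  classical
  have hTf : Finite T := Finite.of_equiv _ (DirectSum.addEquivProd (fun i => ZMod (p i ^ e i))).symm.toEquiv
  let f' : A ≃+ (Fin n → ℤ) × T :=
    f.trans (AddEquiv.prodCongr (Finsupp.linearEquivFunOnFinite ℤ ℤ (Fin n)).toAddEquiv (AddEquiv.refl T))
  have hidx : (nsmulAddMonoidHom 2 : A →+ A).range =
      ((nsmulAddMonoidHom 2 : (Fin n → ℤ) →+ (Fin n → ℤ)).range.prod
        (nsmulAddMonoidHom 2 : T →+ T).range).comap f'.toAddMonoidHom := by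
    ext x
    simp only [AddMonoidHom.mem_range, AddSubgroup.mem_comap, AddSubgroup.mem_prod,
      nsmulAddMonoidHom_apply]
    constructor
    · rintro ⟨y, rfl⟩
      exact ⟨⟨(f' y).1, by simp⟩, ⟨(f' y).2, by simp⟩⟩
    · rintro ⟨⟨a, ha⟩, ⟨b, hb⟩⟩
      refine ⟨f'.symm (a, b), ?_⟩
      apply f'.injective
      rw [map_nsmul, AddEquiv.apply_symm_apply]
      exact Prod.ext ha hb
  have hker : Nat.card (nsmulAddMonoidHom 2 : A →+ A).ker = Nat.card (nsmulAddMonoidHom 2 : T →+ T).ker := by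
    symm
    refine Nat.card_congr (Equiv.ofBijective (fun t => ⟨f'.symm (0, t.1), ?_⟩) ⟨?_, ?_⟩)
    · have := t.2
      rw [AddMonoidHom.mem_ker, nsmulAddMonoidHom_apply] at this ⊢
      rw [← map_nsmul]
      simp [this]
    · intro t t' h
      have h1 := f'.symm.injective (congrArg Subtype.val h)
      exact Subtype.ext (congrArg Prod.snd h1)
    · rintro ⟨x, hx⟩
      rw [AddMonoidHom.mem_ker, nsmulAddMonoidHom_apply] at hx
      have h0 : 2 • f' x = 0 := by rw [← map_nsmul, hx, map_zero]
      have h1 : (f' x).1 = 0 := by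
        have := congrArg Prod.fst h0
        ext i
        simpa using congrFun this i
      have h2 : 2 • (f' x).2 = 0 := congrArg Prod.snd h0
      refine ⟨⟨(f' x).2, h2⟩, ?_⟩
      apply Subtype.ext
      change f'.symm (0, (f' x).2) = x
      rw [← h1]
      simp
  have hrank : Module.finrank ℤ A = n := by
    have e1 : Module.finrank ℤ A = Module.finrank ℤ ((Fin n → ℤ) × T) :=
      LinearEquiv.finrank_eq f'.toIntLinearEquiv
    have h0 : Module.finrank ℤ T = 0 := by
      rw [Module.finrank_eq_zero_iff_isTorsion]
      intro t
      refine ⟨⟨(Nat.card T : ℤ), ?_⟩, ?_⟩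
      · apply mem_nonZeroDivisors_of_ne_zero
        exact_mod_cast Nat.card_pos.ne'
      · change (Nat.card T : ℤ) • t = 0
        rw [natCast_zsmul]
        exact card_nsmul_eq_zero'
    have h3 := Submodule.finrank_quotient_add_finrank (LinearMap.ker (LinearMap.fst ℤ (Fin n → ℤ) T))
    rw [(LinearMap.quotKerEquivOfSurjective _ LinearMap.fst_surjective).finrank_eq] at h3
    have h4 : Module.finrank ℤ (LinearMap.ker (LinearMap.fst ℤ (Fin n → ℤ) T)) = 0 := by
      rw [LinearMap.ker_fst, ← (LinearEquiv.ofInjective _ LinearMap.inr_injective).finrank_eq, h0]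
    rw [e1, ← h3, h4]
    simp
  rw [hidx, AddSubgroup.index_comap_of_surjective _ f'.surjective, AddSubgroup.index_prod, dblIdx_free,
    dblIdx_finite, hrank, hker]

theorem sqIdx (G : Type*) [CommGroup G] [Module.Finite ℤ (Additive G)] :
    (powMonoidHom 2 : G →* G).range.index =
      2 ^ Module.finrank ℤ (Additive G) * Nat.card (powMonoidHom 2 : G →* G).ker := by
  exact dblIdx (Additive G)

end IndexSq

section Herbrand
variable {E F : Type*} [CommGroup E] [CommGroup F] [Module.Finite ℤ (Additive E)]
  [Module.Finite ℤ (Additive F)]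

theorem herbrand_group (i : F →* E) (hi : Function.Injective i) (N : E →* F) (s : E →* E)
    (hN : ∀ u, i (N u) = u * s u) (hs : ∀ e, s (i e) = i e) (hss : ∀ u, s (s u) = u)
    (hfix : ∀ u, s u = u → ∃ e, i e = u)
    (hrk : Module.finrank ℤ (Additive E) = 2 * Module.finrank ℤ (Additive F) + 1)
    (hF2 : Nat.card (powMonoidHom 2 : F →* F).ker = 2)
    (hE2 : 2 ≤ Nat.card (powMonoidHom 2 : N.ker →* N.ker).ker)
    (D : Subgroup E) (hD : ∀ x, x ∈ D ↔ ∃ u, x = u / s u) :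
    2 * N.range.index ≤ D.relIndex N.ker := by
  have hNi : ∀ e, N (i e) = e ^ 2 := fun e => hi (by rw [hN, hs, map_pow, sq])
  let δ : E →* E := (MonoidHom.id E) / s
  have hδ : ∀ u, δ u = u / s u := fun u => rfl
  have hDr : D = δ.range := by
    ext x; rw [hD]; exact ⟨fun ⟨u, hu⟩ => ⟨u, hu.symm⟩, fun ⟨u, hu⟩ => ⟨u, hu.symm⟩⟩
  have hker : ∀ u, u ∈ N.ker ↔ u * s u = 1 := fun u => by
    rw [MonoidHom.mem_ker, ← hN, ← map_one i, hi.eq_iff]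
  have hDle : D ≤ N.ker := by
    intro x hx
    obtain ⟨u, rfl⟩ := (hD x).mp hx
    rw [hker, map_div, hss]
    simp
  -- squares of the kernel
  let Q : Subgroup E := N.ker.map (powMonoidHom 2)
  have hQD : Q ≤ D := by
    rintro _ ⟨v, hv, rfl⟩
    refine (hD _).mpr ⟨v, ?_⟩
    have h := (hker v).mp hv
    rw [eq_div_iff_mul_eq', powMonoidHom_apply, sq, mul_assoc, h, mul_one]
  let R : Subgroup F := (powMonoidHom 2 : F →* F).range
  have hRN : R ≤ N.range := by
    rintro _ ⟨e, rfl⟩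
    exact ⟨i e, hNi e⟩
  have hcomap : Q.comap δ = R.comap N := by
    ext u
    rw [Subgroup.mem_comap, Subgroup.mem_comap]
    constructor
    · rintro ⟨v, hv, hv2⟩
      have h := (hker v).mp hv
      have hv2' : v ^ 2 = u / s u := hv2
      have hfx : s (u / v) = u / v := by
        have hsv : s v = v⁻¹ := eq_inv_of_mul_eq_one_right h
        have hsu : s u = u / v ^ 2 := by rw [hv2']; simp
        rw [map_div, hsv, hsu, sq]
        simp [div_eq_mul_inv, mul_assoc]
      obtain ⟨e, he⟩ := hfix _ hfx
      refine ⟨e, ?_⟩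
      have : u = i e * v := by rw [he]; simp
      rw [this, map_mul, hNi, MonoidHom.mem_ker.mp hv, mul_one]
      rfl
    · rintro ⟨e, he⟩
      have he' : e ^ 2 = N u := he
      have hm : u / i e ∈ N.ker := by
        rw [MonoidHom.mem_ker, map_div, hNi, he', div_self']
      refine ⟨u / i e, hm, ?_⟩
      rw [powMonoidHom_apply, hδ]
      have h := (hker _).mp hm
      have h2 : s (u / i e) = (u / i e)⁻¹ := eq_inv_of_mul_eq_one_right h
      rw [map_div, hs] at h2
      have : s u = i e * (u / i e)⁻¹ := by rw [← h2]; simp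
      rw [this, sq]
      simp [div_eq_mul_inv, mul_assoc, mul_comm, mul_left_comm]
  have hm : Q.relIndex D = R.relIndex N.range := by
    rw [hDr, ← Subgroup.index_comap, ← Subgroup.index_comap, hcomap]
  have hR : R.index = 2 ^ Module.finrank ℤ (Additive F) * 2 := by
    have := sqIdx F
    rw [hF2] at this
    exact this
  have hfinK : Module.Finite ℤ (Additive N.ker) := by
    have : Module.Finite ℤ (LinearMap.ker (MonoidHom.toAdditive N).toIntLinearMap) := inferInstance
    exact this
  have hrkK : Module.finrank ℤ (Additive F) + 1 ≤ Module.finrank ℤ (Additive N.ker) := by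
    set l := (MonoidHom.toAdditive N).toIntLinearMap
    have h3 := Submodule.finrank_quotient_add_finrank (LinearMap.ker l)
    rw [l.quotKerEquivRange.finrank_eq] at h3
    have h4 : Module.finrank ℤ (LinearMap.range l) ≤ Module.finrank ℤ (Additive F) :=
      Submodule.finrank_le _
    have h5 : Module.finrank ℤ (LinearMap.ker l) = Module.finrank ℤ (Additive N.ker) := rfl
    omega
  have hQ : 2 ^ (Module.finrank ℤ (Additive F) + 1) * 2 ≤ Q.relIndex N.ker := by
    have h1 : Q.relIndex N.ker = (powMonoidHom 2 : N.ker →* N.ker).range.index := by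
      rw [Subgroup.relIndex]
      congr 1
      ext x
      rw [Subgroup.mem_subgroupOf]
      constructor
      · rintro ⟨v, hv, h⟩
        exact ⟨⟨v, hv⟩, Subtype.ext h⟩
      · rintro ⟨v, h⟩
        exact ⟨v.1, v.2, congrArg Subtype.val h⟩
    rw [h1, sqIdx]
    exact Nat.mul_le_mul (Nat.pow_le_pow_right (by norm_num) hrkK) hE2
  have e1 : Q.relIndex D * D.relIndex N.ker = Q.relIndex N.ker := Subgroup.relIndex_mul_relIndex _ _ _ hQD hDle
  have e2 : R.relIndex N.range * N.range.index = R.index := Subgroup.relIndex_mul_index hRN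
  have hpos : 0 < R.relIndex N.range := by
    rcases Nat.eq_zero_or_pos (R.relIndex N.range) with h | h
    · rw [h, zero_mul, hR] at e2
      have := pow_pos (show 0 < 2 by norm_num) (Module.finrank ℤ (Additive F))
      omega
    · exact h
  rw [hm] at e1
  apply Nat.le_of_mul_le_mul_left _ hpos
  rw [e1]
  refine le_trans ?_ hQ
  rw [Nat.mul_left_comm, e2, hR, pow_succ]
  omega
end Herbrand

open NumberField
open scoped Pointwise
set_option linter.unusedSectionVars false

section Chev
variable {K L : Type*} [Field K] [NumberField K] [Field L] [NumberField L] [Algebra K L]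
  [Algebra.IsQuadraticExtension K L]

theorem qa_fixed_int {σ : Gal(L/K)} (hσ : σ ≠ 1) {x : 𝓞 L} (hx : σ • x = x) :
    ∃ y : 𝓞 K, algebraMap (𝓞 K) (𝓞 L) y = x := by
  obtain ⟨y, hy⟩ := qa_fixed hσ (x := algebraMap (𝓞 L) L x) (by rw [← coe_smul_int, hx])
  have hintg : IsIntegral ℤ y := by
    rw [← isIntegral_algebraMap_iff (FaithfulSMul.algebraMap_injective K L), hy]
    exact x.2
  refine ⟨⟨y, hintg⟩, ?_⟩
  apply RingOfIntegers.coe_injective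
  rw [← hy]
  rfl

theorem qa_norm_int {σ : Gal(L/K)} (hσ : σ ≠ 1) (x : 𝓞 L) :
    algebraMap (𝓞 K) (𝓞 L) (RingOfIntegers.norm K x) = x * σ • x := by
  apply RingOfIntegers.coe_injective
  rw [map_mul, coe_smul_int, ← qa_norm hσ]
  exact RingOfIntegers.coe_algebraMap_norm K x

/-- the action on units -/
noncomputable def sU (σ : Gal(L/K)) : (𝓞 L)ˣ →* (𝓞 L)ˣ :=
  Units.map (MulSemiringAction.toRingHom (Gal(L/K)) (𝓞 L) σ).toMonoidHom

theorem coe_sU (σ : Gal(L/K)) (u : (𝓞 L)ˣ) : ((sU σ u : (𝓞 L)ˣ) : 𝓞 L) = σ • (u : 𝓞 L) := rfl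

variable (K L) in
/-- inclusion of units -/
noncomputable def iU : (𝓞 K)ˣ →* (𝓞 L)ˣ := Units.map (algebraMap (𝓞 K) (𝓞 L)).toMonoidHom

variable (K L) in
/-- norm of units -/
noncomputable def nU : (𝓞 L)ˣ →* (𝓞 K)ˣ := Units.map (RingOfIntegers.norm K)

theorem coe_iU (u : (𝓞 K)ˣ) : ((iU K L u : (𝓞 L)ˣ) : 𝓞 L) = algebraMap (𝓞 K) (𝓞 L) u := rfl

theorem coe_nU (u : (𝓞 L)ˣ) : ((nU K L u : (𝓞 K)ˣ) : 𝓞 K) = RingOfIntegers.norm K (u : 𝓞 L) := rfl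

theorem iU_inj : Function.Injective (iU K L) := fun a b h => by
  have := congrArg (Units.val) h
  rw [coe_iU, coe_iU] at this
  exact Units.ext (FaithfulSMul.algebraMap_injective (𝓞 K) (𝓞 L) this)

theorem iU_nU {σ : Gal(L/K)} (hσ : σ ≠ 1) (u : (𝓞 L)ˣ) : iU K L (nU K L u) = u * sU σ u :=
  Units.ext (by rw [coe_iU, coe_nU, qa_norm_int hσ]; rfl)

theorem sU_iU (σ : Gal(L/K)) (e : (𝓞 K)ˣ) : sU σ (iU K L e) = iU K L e :=
  Units.ext (by rw [coe_sU, coe_iU]; simp)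

theorem sU_sU {σ : Gal(L/K)} (hσ : σ ≠ 1) (u : (𝓞 L)ˣ) : sU σ (sU σ u) = u :=
  Units.ext (by rw [coe_sU, coe_sU, smul_smul, qa_sq hσ, one_smul])

theorem sU_fixed {σ : Gal(L/K)} (hσ : σ ≠ 1) (u : (𝓞 L)ˣ) (h : sU σ u = u) : ∃ e, iU K L e = u := by
  obtain ⟨y, hy⟩ := qa_fixed_int hσ (x := (u : 𝓞 L)) (by rw [← coe_sU, h])
  obtain ⟨z, hz⟩ := qa_fixed_int hσ (x := ((u⁻¹ : (𝓞 L)ˣ) : 𝓞 L)) (by rw [← coe_sU, map_inv, h])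
  have h1 : y * z = 1 := by
    apply FaithfulSMul.algebraMap_injective (𝓞 K) (𝓞 L)
    rw [map_mul, hy, hz, map_one, Units.mul_inv]
  exact ⟨⟨y, z, h1, by rw [mul_comm]; exact h1⟩, Units.ext hy⟩

theorem card_sq_ker (F : Type*) [Field F] [NumberField F] (H : Subgroup (𝓞 F)ˣ) (hH : -1 ∈ H) :
    Nat.card (powMonoidHom 2 : H →* H).ker = 2 := by
  have h1 : ((⟨-1, hH⟩ : H)) ≠ 1 := by
    intro h
    have := congrArg (fun x : H => ((x : (𝓞 F)ˣ) : 𝓞 F)) h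
    have h2 : (-1 : 𝓞 F) = 1 := by simpa using this
    norm_num [neg_eq_iff_add_eq_zero] at h2
  have : ((powMonoidHom 2 : H →* H).ker : Set H) = {1, ⟨-1, hH⟩} := by
    ext x
    simp only [SetLike.mem_coe, MonoidHom.mem_ker, powMonoidHom_apply, Set.mem_insert_iff,
      Set.mem_singleton_iff]
    constructor
    · intro h
      have h3 : ((x : (𝓞 F)ˣ) : 𝓞 F) ^ 2 = 1 := by
        have := congrArg (fun x : H => ((x : (𝓞 F)ˣ) : 𝓞 F)) h
        simpa using this
      rcases eq_or_eq_neg_of_sq_eq_sq ((x : (𝓞 F)ˣ) : 𝓞 F) 1 (by rw [h3, one_pow]) with h | h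
      · left; exact Subtype.ext (Units.ext h)
      · right; exact Subtype.ext (Units.ext h)
    · rintro (rfl | rfl)
      · simp
      · exact Subtype.ext (by simp)
  have h4 : Nat.card (powMonoidHom 2 : H →* H).ker = Set.ncard ((powMonoidHom 2 : H →* H).ker : Set H) := rfl
  rw [h4, this, Set.ncard_pair (Ne.symm h1)]

theorem card_sq_ker' (F : Type*) [Field F] [NumberField F] :
    Nat.card (powMonoidHom 2 : (𝓞 F)ˣ →* (𝓞 F)ˣ).ker = 2 := by
  refine Eq.trans ?_ (card_sq_ker F ⊤ (Subgroup.mem_top _))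
  refine Nat.card_congr (Equiv.ofBijective (fun x => ⟨⟨x.1, Subgroup.mem_top _⟩, ?_⟩) ⟨?_, ?_⟩)
  · have := x.2
    rw [MonoidHom.mem_ker] at this ⊢
    exact Subtype.ext this
  · intro a b h
    exact Subtype.ext (congrArg (fun y => (y.1.1)) h)
  · rintro ⟨x, hx⟩
    exact ⟨⟨x.1, congrArg Subtype.val hx⟩, rfl⟩

/-- the subgroup of `u / σ u` -/
noncomputable def dU (σ : Gal(L/K)) : Subgroup (𝓞 L)ˣ := (MonoidHom.id _ / sU σ).range

theorem qa_herbrand {σ : Gal(L/K)} (hσ : σ ≠ 1) (hrk : Units.rank L = 2 * Units.rank K + 1) :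
    2 * (nU K L).range.index ≤ (dU σ).relIndex (nU K L).ker := by
  refine herbrand_group (iU K L) iU_inj (nU K L) (sU σ) (iU_nU hσ) (sU_iU σ) (sU_sU hσ) (sU_fixed hσ)
    ?_ (card_sq_ker' K) ?_ _ ?_
  · rw [Units.finrank_eq, Units.finrank_eq, hrk]
  · refine le_of_eq (card_sq_ker L _ ?_).symm
    rw [MonoidHom.mem_ker]
    apply iU_inj (K := K) (L := L)
    rw [iU_nU hσ, map_one]
    have : sU σ (-1) = -1 := Units.ext (by rw [coe_sU]; simp)
    rw [this]; simp
  · intro x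
    exact ⟨fun ⟨u, hu⟩ => ⟨u, hu.symm⟩, fun ⟨u, hu⟩ => ⟨u, hu.symm⟩⟩

theorem cl_ext_pow {h : ℕ} (hh : Nat.card (ClassGroup (𝓞 K)) = h) {a : Ideal (𝓞 K)} (ha : a ≠ ⊥) :
    ∃ x : 𝓞 K, x ≠ 0 ∧ a ^ h = Ideal.span {x} := by
  have h1 : cl (a ^ h) = 1 := by
    rw [cl_pow ha, ← hh]
    exact pow_card_eq_one'
  obtain ⟨x, hx⟩ := (cl_eq_one_iff (pow_ne_zero h ha)).mp h1
  refine ⟨x, ?_, hx⟩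
  rintro rfl
  apply pow_ne_zero h ha
  rw [hx]; simp

theorem cl_ext_pow' {h : ℕ} (hh : Nat.card (ClassGroup (𝓞 K)) = h) {a : Ideal (𝓞 K)} (ha : a ≠ ⊥) :
    cl (extI L a) ^ h = 1 := by
  obtain ⟨x, -, hx⟩ := cl_ext_pow hh ha
  rw [← cl_pow (extI_ne_bot ha), ← extI_pow, hx, extI_span, cl_span]

theorem cl_conj_of_sq {σ : Gal(L/K)} (hσ : σ ≠ 1) (hodd : Odd (Nat.card (ClassGroup (𝓞 K))))
    {I : Ideal (𝓞 L)} (hI : I ≠ ⊥) (h2 : cl I ^ 2 = 1) : cl (σ • I) = cl I := by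
  obtain ⟨a, ha, h⟩ := qa_mul_conj hσ I hI
  have h1 : cl (σ • I) ^ 2 = 1 := by
    rw [← cl_pow (smul_ne_bot σ hI)]
    rw [← cl_pow hI, cl_eq_one_iff (pow_ne_zero 2 hI)] at h2
    obtain ⟨x, hx⟩ := h2
    rw [← smul_pow', hx, smul_span, cl_span]
  have h3 : (cl I * cl (σ • I)) ^ Nat.card (ClassGroup (𝓞 K)) = 1 := by
    rw [← cl_mul hI (smul_ne_bot σ hI), h]
    exact cl_ext_pow' rfl ha
  obtain ⟨m, hm⟩ := hodd
  rw [hm, pow_succ, pow_mul, mul_pow (cl I), h1, h2, one_mul, one_pow, one_mul] at h3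
  rw [sq] at h2
  exact mul_left_cancel (h3.trans h2.symm)

end Chev

open NumberField
open scoped Pointwise
set_option linter.unusedSectionVars false

section Chev2
variable {K L : Type*} [Field K] [NumberField K] [Field L] [NumberField L] [Algebra K L]
  [Algebra.IsQuadraticExtension K L]

theorem smul_int_ne (σ : Gal(L/K)) {x : 𝓞 L} (hx : x ≠ 0) : σ • x ≠ 0 := by
  intro h
  apply hx
  have := congrArg (fun y => σ⁻¹ • y) h
  simpa using this

open Classical in
/-- `g` as a homomorphism from sign vectors -/
noncomputable def gHom {C ι : Type*} [CommGroup C] [Fintype ι] (c : ι → C) (hc : ∀ i, c i ^ 2 = 1) :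
    (ι → ℤˣ) →* C where
  toFun f := ∏ i, if f i = 1 then 1 else c i
  map_one' := by simp
  map_mul' f f' := by
    rw [← Finset.prod_mul_distrib]
    refine Finset.prod_congr rfl fun i _ => ?_
    have := hc i
    rw [sq] at this
    rcases Int.units_eq_one_or (f i) with h | h <;> rcases Int.units_eq_one_or (f' i) with h' | h' <;>
      simp [h, h', this]

/-- the relation between classes of order 2 and norm units -/
def RelCE (σ : Gal(L/K)) (c : ClassGroup (𝓞 L)) (e : (𝓞 K)ˣ) : Prop :=
  ∃ (I : Ideal (𝓞 L)) (a b : 𝓞 L), I ≠ ⊥ ∧ a ≠ 0 ∧ b ≠ 0 ∧ cl I = c ∧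
    Ideal.span {b} * σ • I = Ideal.span {a} * I ∧ a * σ • a = b * σ • b * iU K L e

theorem RelCE.mul {σ : Gal(L/K)} {c c' : ClassGroup (𝓞 L)} {e e' : (𝓞 K)ˣ} (h : RelCE σ c e)
    (h' : RelCE σ c' e') : RelCE σ (c * c') (e * e') := by
  obtain ⟨I, a, b, hI, ha, hb, rfl, h1, h2⟩ := h
  obtain ⟨I', a', b', hI', ha', hb', rfl, h1', h2'⟩ := h'
  refine ⟨I * I', a * a', b * b', mul_ne_zero hI hI', mul_ne_zero ha ha', mul_ne_zero hb hb',
    cl_mul hI hI', ?_, ?_⟩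
  · rw [← Ideal.span_singleton_mul_span_singleton, ← Ideal.span_singleton_mul_span_singleton, smul_mul']
    calc _ = (Ideal.span {b} * σ • I) * (Ideal.span {b'} * σ • I') := by ring
      _ = _ := by rw [h1, h1']; ring
  · rw [smul_mul', smul_mul', map_mul, Units.val_mul]
    calc _ = (a * σ • a) * (a' * σ • a') := by ring
      _ = _ := by rw [h2, h2']; ring

theorem RelCE.exists {σ : Gal(L/K)} (hσ : σ ≠ 1) (hodd : Odd (Nat.card (ClassGroup (𝓞 K))))
    (c : ClassGroup (𝓞 L)) (hc : c ^ 2 = 1) : ∃ e, RelCE σ c e := by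
  obtain ⟨I, hI, rfl⟩ := cl_surj c
  have hsI := smul_ne_bot σ hI
  obtain ⟨b, a, hb, ha, h⟩ := (cl_eq_iff hsI hI).mp (cl_conj_of_sq hσ hodd hI hc)
  have h' : Ideal.span {σ • b} * I = Ideal.span {σ • a} * σ • I := by
    have := congrArg (fun J => σ • J) h
    simp only [smul_mul', smul_span, qa_invol_ideal hσ] at this
    exact this
  have h3 : Ideal.span {a * σ • a} = Ideal.span {b * σ • b} := by
    apply mul_right_cancel₀ (mul_ne_zero hI hsI)
    rw [← Ideal.span_singleton_mul_span_singleton, ← Ideal.span_singleton_mul_span_singleton]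
    calc _ = (Ideal.span {a} * I) * (Ideal.span {σ • a} * σ • I) := by ring
      _ = (Ideal.span {b} * σ • I) * (Ideal.span {σ • b} * I) := by rw [h, h']
      _ = _ := by ring
  obtain ⟨u, hu⟩ := (Ideal.span_singleton_eq_span_singleton.mp h3).symm
  have hbs : b * σ • b ≠ 0 := mul_ne_zero hb (smul_int_ne σ hb)
  obtain ⟨e, he⟩ := sU_fixed hσ u (by
    apply Units.ext
    apply mul_left_cancel₀ hbs
    have := congrArg (fun x => σ • x) hu
    simp only [smul_mul', smul_smul, qa_sq hσ, one_smul] at this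
    rw [hu, coe_sU, mul_comm a, mul_comm b, this])
  exact ⟨e, I, a, b, hI, ha, hb, rfl, h, by rw [he, hu]⟩

theorem RelCE.norm {σ : Gal(L/K)} (hσ : σ ≠ 1) {c : ClassGroup (𝓞 L)} {e : (𝓞 K)ˣ}
    (h : RelCE σ c e) : ∃ x : L, Algebra.norm K x = algebraMap (𝓞 K) K e := by
  obtain ⟨I, a, b, hI, ha, hb, rfl, h1, h2⟩ := h
  have hb' : algebraMap (𝓞 L) L b ≠ 0 := by simpa using hb
  have hsb : σ (algebraMap (𝓞 L) L b) ≠ 0 := by simpa using hb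
  refine ⟨algebraMap (𝓞 L) L a / algebraMap (𝓞 L) L b, ?_⟩
  apply FaithfulSMul.algebraMap_injective K L
  rw [qa_norm hσ, map_div₀]
  have := congrArg (algebraMap (𝓞 L) L) h2
  rw [map_mul, map_mul, map_mul, coe_smul_int, coe_smul_int, coe_iU] at this
  field_simp
  rw [this]
  rfl

theorem RelCE.fixed {σ : Gal(L/K)} (hσ : σ ≠ 1) {c : ClassGroup (𝓞 L)} {e : (𝓞 K)ˣ}
    (h : RelCE σ c e) (he : e ∈ (nU K L).range) :
    ∃ J : Ideal (𝓞 L), J ≠ ⊥ ∧ σ • J = J ∧ cl J = c := by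
  obtain ⟨I, a, b, hI, ha, hb, rfl, h1, h2⟩ := h
  obtain ⟨w, rfl⟩ := he
  exact qa_KL hσ hI ha hb h1 w (by rw [h2, iU_nU hσ]; rfl)

theorem chevalley {σ : Gal(L/K)} (hσ : σ ≠ 1) (hodd : Odd (Nat.card (ClassGroup (𝓞 K))))
    (hrk : Units.rank L = 2 * Units.rank K + 1)
    (S : Finset (Ideal (𝓞 L))) (hS : ∀ P, RamP σ P → P ∈ S)
    (H : Subgroup (𝓞 K)ˣ) (hH : ∀ e : (𝓞 K)ˣ, (∃ x : L, Algebra.norm K x = algebraMap (𝓞 K) K e) → e ∈ H) :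
    Nat.card (powMonoidHom 2 : ClassGroup (𝓞 L) →* ClassGroup (𝓞 L)).ker * 2 * H.index ≤ 2 ^ S.card := by
  classical
  -- reduce to S consisting of ramified primes
  set S' := S.filter (fun P => RamP σ P) with hS'
  have hSS : ∀ P, RamP σ P ↔ P ∈ S' := fun P => by
    rw [hS', Finset.mem_filter]
    exact ⟨fun h => ⟨hS P h, h⟩, fun h => h.2⟩
  refine le_trans ?_ (Nat.pow_le_pow_right (by norm_num) (Finset.card_filter_le S (fun P => RamP σ P)))
  rw [← hS']
  set h := Nat.card (ClassGroup (𝓞 K)) with hh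
  have hram : ∀ P : S', RamP σ P.1 := fun P => (hSS P.1).mpr P.2
  let cP : S' → ClassGroup (𝓞 L) := fun P => cl P.1 ^ h
  have hcP : ∀ P, cP P ^ 2 = 1 := fun P => by
    have h1 := hram P
    have hu0 : P.1.under (𝓞 K) ≠ ⊥ := mt Ideal.eq_bot_of_comap_eq_bot h1.ne_bot
    change (cl P.1 ^ h) ^ 2 = 1
    rw [← pow_mul, mul_comm, pow_mul, ← cl_pow h1.ne_bot, ← h1.sq]
    exact cl_ext_pow' hh.symm hu0
  let g := gHom cP hcP
  let fT : Finset (Ideal (𝓞 L)) → (S' → ℤˣ) := fun T P => if P.1 ∈ T then -1 else 1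
  have hg : ∀ T : Finset (Ideal (𝓞 L)), (∀ P ∈ T, RamP σ P) → g (fT T) = cl (∏ P ∈ T, P) ^ h := by
    intro T hT
    rw [(cl_prod T (fun P => P) (fun P hP => (hT P hP).ne_bot)).1, ← Finset.prod_pow]
    change (∏ P : S', if fT T P = 1 then 1 else cP P) = _
    have h1 : ∀ P : S', (if fT T P = 1 then 1 else cP P) = if P.1 ∈ T then cl P.1 ^ h else 1 := by
      intro P
      by_cases hP : P.1 ∈ T
      · simp [fT, hP, cP]
      · simp [fT, hP]
    rw [Finset.prod_congr rfl (fun P _ => h1 P)]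
    rw [Finset.prod_coe_sort S' (fun P => if P ∈ T then cl P ^ h else 1), Finset.prod_ite_mem]
    congr 1
    rw [Finset.inter_eq_right]
    exact fun P hP => (hSS P).mp (hT P hP)
  have hfT : ∀ T T' : Finset (Ideal (𝓞 L)), (∀ P ∈ T, RamP σ P) → (∀ P ∈ T', RamP σ P) →
      fT T = fT T' → T = T' := by
    intro T T' hT hT' h1
    have h2 : ∀ P, RamP σ P → (P ∈ T ↔ P ∈ T') := by
      intro P hP
      have := congrFun h1 ⟨P, (hSS P).mp hP⟩
      by_cases ha : P ∈ T <;> by_cases hb : P ∈ T' <;> simp [fT, ha, hb] at this ⊢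
    ext P
    exact ⟨fun hP => (h2 P (hT P hP)).mp hP, fun hP => (h2 P (hT' P hP)).mpr hP⟩
  set X := (powMonoidHom 2 : ClassGroup (𝓞 L) →* ClassGroup (𝓞 L)).ker with hX
  have hpowh : ∀ c ∈ X, c ^ h = c := by
    intro c hc
    obtain ⟨m, hm⟩ := hodd
    have hc2 : c ^ 2 = 1 := hc
    rw [hm, pow_succ, pow_mul, hc2, one_pow, one_mul]
  have hX1 : g.range ≤ X := by
    rintro _ ⟨f, rfl⟩
    change g f ^ 2 = 1
    rw [← map_pow]
    have : f ^ 2 = 1 := by ext P; simp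
    rw [this, map_one]
  have hfixX : ∀ c ∈ X, (∃ J : Ideal (𝓞 L), J ≠ ⊥ ∧ σ • J = J ∧ cl J = c) → c ∈ g.range := by
    rintro c hc ⟨J, hJ, hJf, rfl⟩
    obtain ⟨a, T, ha, hT, hJ'⟩ := qa_fixed_ideal hσ J hJ hJf
    refine ⟨fT T, ?_⟩
    have h0 := (cl_prod T (fun P => P) (fun P hP => (hT P hP).ne_bot)).2
    rw [hg T hT, ← hpowh _ hc, hJ', cl_mul (extI_ne_bot ha) h0, mul_pow, cl_ext_pow' hh.symm ha, one_mul]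
  -- step 1
  have s1 : g.range.relIndex X ≤ (nU K L).range.relIndex H := by
    have hex : ∀ c : X, ∃ e, RelCE σ c.1 e := fun c => RelCE.exists hσ hodd c.1 c.2
    choose e he using hex
    have heH : ∀ c, e c ∈ H := fun c => hH _ ((he c).norm hσ)
    have hfin : Finite (H ⧸ (nU K L).range.subgroupOf H) := by
      have h1 : Finite ((𝓞 K)ˣ ⧸ (nU K L).range) := by
        have hle : (powMonoidHom 2 : (𝓞 K)ˣ →* (𝓞 K)ˣ).range ≤ (nU K L).range := by
          rintro _ ⟨x, rfl⟩
          refine ⟨iU K L x, ?_⟩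
          apply iU_inj (K := K) (L := L)
          rw [iU_nU hσ, sU_iU, powMonoidHom_apply, map_pow, sq]
        have h2 : (powMonoidHom 2 : (𝓞 K)ˣ →* (𝓞 K)ˣ).range.index ≠ 0 := by
          rw [sqIdx, card_sq_ker']; positivity
        have h3 : (nU K L).range.index ≠ 0 := fun h => h2 (Nat.eq_zero_of_zero_dvd (h ▸ Subgroup.index_dvd_of_le hle))
        have : (nU K L).range.FiniteIndex := ⟨h3⟩
        exact Subgroup.finite_quotient_of_finiteIndex
      have : (nU K L).range.FiniteIndex := Subgroup.finiteIndex_of_finite_quotient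
      infer_instance
    refine Nat.card_le_card_of_injective (fun (x : X ⧸ g.range.subgroupOf X) =>
      ((⟨e x.out, heH x.out⟩ : H) : H ⧸ (nU K L).range.subgroupOf H)) ?_
    intro x y hxy
    have h1 := QuotientGroup.eq.mp hxy
    rw [Subgroup.mem_subgroupOf] at h1
    have h1' : (e x.out)⁻¹ * e y.out ∈ (nU K L).range := h1
    have h2 : e x.out * e y.out ∈ (nU K L).range := by
      have h3 : e x.out ^ 2 ∈ (nU K L).range := by
        refine ⟨iU K L (e x.out), ?_⟩
        apply iU_inj (K := K) (L := L)
        rw [iU_nU hσ, sU_iU, map_pow, sq]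
      have := mul_mem h3 h1'
      rwa [sq, mul_assoc, mul_inv_cancel_left] at this
    have h4 : (x.out : ClassGroup (𝓞 L)) * y.out ∈ g.range :=
      hfixX _ (mul_mem x.out.2 y.out.2) (((he x.out).mul (he y.out)).fixed hσ h2)
    rw [← x.out_eq, ← y.out_eq]
    apply QuotientGroup.eq.mpr
    rw [Subgroup.mem_subgroupOf]
    have h5 : (x.out : ClassGroup (𝓞 L)) ^ 2 = 1 := x.out.2
    have h6 : (x.out : ClassGroup (𝓞 L))⁻¹ = x.out := by
      rw [inv_eq_iff_mul_eq_one, ← sq, h5]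
    change (x.out : ClassGroup (𝓞 L))⁻¹ * y.out ∈ g.range
    rw [h6]; exact h4
  -- step 2
  have s2 : (dU σ).relIndex (nU K L).ker ≤ Nat.card g.ker := by
    have hex : ∀ u : (nU K L).ker, ∃ (y : 𝓞 L) (a : Ideal (𝓞 K)) (T : Finset (Ideal (𝓞 L))), y ≠ 0 ∧
        (u : (𝓞 L)ˣ) * σ • y = y ∧ a ≠ ⊥ ∧ (∀ P ∈ T, RamP σ P) ∧
        Ideal.span {y} = extI L a * ∏ P ∈ T, P := by
      intro u
      have h1 : algebraMap (𝓞 L) L (u.1 : 𝓞 L) * σ (algebraMap (𝓞 L) L (u.1 : 𝓞 L)) = 1 := by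
        have := iU_nU hσ u.1
        rw [MonoidHom.mem_ker.mp u.2, map_one] at this
        have := congrArg (fun v : (𝓞 L)ˣ => algebraMap (𝓞 L) L v) this
        simpa [coe_sU, coe_smul_int] using this.symm
      obtain ⟨y, hy0, hy⟩ := qa_h90 hσ h1
      have hy' : (u : (𝓞 L)ˣ) * σ • y = y := by
        apply RingOfIntegers.coe_injective
        rw [map_mul, coe_smul_int]
        exact hy
      have hfx : σ • Ideal.span {y} = Ideal.span {y} := by
        rw [smul_span]
        conv_rhs => rw [← hy']
        rw [mul_comm]
        exact (Ideal.span_singleton_mul_right_unit u.1.isUnit _).symm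
      obtain ⟨a, T, ha, hT, h2⟩ := qa_fixed_ideal hσ _ (span_ne_bot hy0) hfx
      exact ⟨y, a, T, hy0, hy', ha, hT, h2⟩
    choose y a T hy0 hy ha hT hI using hex
    have hkg : ∀ u, fT (T u) ∈ g.ker := by
      intro u
      rw [MonoidHom.mem_ker, hg _ (hT u)]
      have h0 := (cl_prod (T u) (fun P => P) (fun P hP => (hT u P hP).ne_bot)).2
      have h1 := cl_span (y u)
      rw [hI u, cl_mul (extI_ne_bot (ha u)) h0] at h1
      have h2 := congrArg (fun c => c ^ h) h1
      simpa [mul_pow, cl_ext_pow' hh.symm (ha u)] using h2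
    refine Nat.card_le_card_of_injective (fun (x : (nU K L).ker ⧸ (dU σ).subgroupOf (nU K L).ker) =>
      (⟨fT (T x.out), hkg x.out⟩ : g.ker)) ?_
    intro x x' hxx
    have hTT : T x.out = T x'.out := hfT _ _ (hT _) (hT _) (congrArg Subtype.val hxx)
    set u := x.out with hu
    set u' := x'.out with hu'
    rw [← x.out_eq, ← x'.out_eq]
    apply QuotientGroup.eq.mpr
    rw [Subgroup.mem_subgroupOf]
    obtain ⟨α, hα0, hα⟩ := cl_ext_pow hh.symm (ha u)
    obtain ⟨α', hα0', hα'⟩ := cl_ext_pow hh.symm (ha u')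
    have e1 : Ideal.span {y u ^ h * algebraMap (𝓞 K) (𝓞 L) α'} =
        Ideal.span {y u' ^ h * algebraMap (𝓞 K) (𝓞 L) α} := by
      rw [← Ideal.span_singleton_mul_span_singleton, ← Ideal.span_singleton_mul_span_singleton,
        ← Ideal.span_singleton_pow, ← Ideal.span_singleton_pow, ← extI_span, ← extI_span, ← hα, ← hα',
        hI, hI, hTT, extI_pow, extI_pow]
      ring
    obtain ⟨w, hw⟩ := Ideal.span_singleton_eq_span_singleton.mp e1
    -- y u ^h * α' * w = y u' ^ h * α
    have hsw := congrArg (fun z => σ • z) hw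
    simp only [smul_mul', smul_pow', smul_algebraMap] at hsw
    have e2 : (u.1 : (𝓞 L)ˣ) ^ h * w = u'.1 ^ h * sU σ w := by
      have hsy : σ • y u ≠ 0 := smul_int_ne σ (hy0 u)
      have hsy' : σ • y u' ≠ 0 := smul_int_ne σ (hy0 u')
      have hα0L : algebraMap (𝓞 K) (𝓞 L) α ≠ 0 := by simpa using hα0
      have hα0L' : algebraMap (𝓞 K) (𝓞 L) α' ≠ 0 := by simpa using hα0'
      apply Units.ext
      rw [Units.val_mul, Units.val_mul, Units.val_pow_eq_pow_val, Units.val_pow_eq_pow_val, coe_sU]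
      have hyu : y u ^ h = (u.1 : (𝓞 L)ˣ) ^ h * (σ • y u) ^ h := by
        rw [← mul_pow, hy u]
      have hyu' : y u' ^ h = (u'.1 : (𝓞 L)ˣ) ^ h * (σ • y u') ^ h := by
        rw [← mul_pow, hy u']
      rw [hyu, hyu'] at hw
      apply mul_left_cancel₀ (mul_ne_zero (pow_ne_zero h hsy) hα0L')
      linear_combination hw - (u'.1 : 𝓞 L) ^ h * hsw
    have e3 : ((u.1 : (𝓞 L)ˣ)⁻¹ * u'.1) ^ h ∈ dU σ := by
      refine ⟨w, ?_⟩
      change w / sU σ w = _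
      rw [div_eq_iff_eq_mul, mul_pow, inv_pow, mul_assoc, ← e2, inv_mul_cancel_left]
    have e4 : ((u.1 : (𝓞 L)ˣ)⁻¹ * u'.1) ^ 2 ∈ dU σ := by
      have h1 : (u.1 : (𝓞 L)ˣ)⁻¹ * u'.1 ∈ (nU K L).ker := mul_mem (inv_mem u.2) u'.2
      set v := (u.1 : (𝓞 L)ˣ)⁻¹ * u'.1
      refine ⟨v, ?_⟩
      change v / sU σ v = _
      have h2 := iU_nU hσ v
      rw [MonoidHom.mem_ker.mp h1, map_one] at h2
      rw [div_eq_iff_eq_mul, sq, mul_assoc, ← h2, mul_one]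
    obtain ⟨m, hm⟩ := hodd
    rw [hm, pow_succ, pow_mul] at e3
    have := mul_mem (inv_mem (pow_mem e4 m)) e3
    rwa [inv_mul_cancel_left] at this
  have hb := qa_herbrand hσ hrk
  have hNH : (nU K L).range ≤ H := by
    rintro _ ⟨w, rfl⟩
    apply hH
    refine ⟨algebraMap (𝓞 L) L w, rfl⟩
  have c1 : Nat.card g.range * g.range.relIndex X = Nat.card X := by
    rw [mul_comm]
    have := Subgroup.relIndex_mul_relIndex ⊥ g.range X bot_le hX1
    rw [Subgroup.relIndex_bot_left, Subgroup.relIndex_bot_left] at this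
    rw [mul_comm]; exact this
  have c2 : (nU K L).range.relIndex H * H.index = (nU K L).range.index := Subgroup.relIndex_mul_index hNH
  have c3 : Nat.card g.ker * Nat.card g.range = 2 ^ S'.card := by
    rw [← Subgroup.index_ker, Subgroup.card_mul_index]
    simp
  calc Nat.card X * 2 * H.index = Nat.card g.range * (2 * (g.range.relIndex X * H.index)) := by
        rw [← c1]; ring
    _ ≤ Nat.card g.range * (2 * ((nU K L).range.relIndex H * H.index)) := by gcongr
    _ ≤ Nat.card g.range * Nat.card g.ker := by
        rw [c2]; gcongr; exact hb.trans s2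
    _ = _ := by rw [← c3, mul_comm]
end Chev2

open NumberField
open scoped Pointwise ComplexOrder
set_option linter.unusedSectionVars false

/-- totally positive -/
def TP {L : Type*} [Field L] (u : L) : Prop := ∀ g : L →+* ℂ, 0 < g u

/-- totally real -/
def RealF (L : Type*) [Field L] : Prop := ∀ (g : L →+* ℂ) (x : L), (g x).im = 0

/-- totally positive units are squares -/
def TPS (K : Type*) [Field K] : Prop :=
  ∀ u : (𝓞 K)ˣ, TP (algebraMap (𝓞 K) K u) → ∃ v : (𝓞 K)ˣ, u = v ^ 2

theorem TP.mul {L : Type*} [Field L] {u v : L} (hu : TP u) (hv : TP v) : TP (u * v) := fun g => by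
  rw [map_mul]; exact mul_pos (hu g) (hv g)

theorem TP.pow {L : Type*} [Field L] {u : L} (hu : TP u) (n : ℕ) : TP (u ^ n) := fun g => by
  rw [map_pow]; exact pow_pos (hu g) n

theorem TP.sq_of_real {L : Type*} [Field L] (hR : RealF L) {z : L} (hz : z ≠ 0) : TP (z ^ 2) := fun g => by
  have h1 : g z ≠ 0 := by simpa using hz
  have h2 : g z = ((g z).re : ℂ) := Complex.ext rfl (by simpa using hR g z)
  rw [map_pow, h2]
  have h3 : (g z).re ≠ 0 := fun h => h1 (by rw [h2, h]; simp)
  have : (0 : ℝ) < (g z).re ^ 2 := by positivity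
  exact_mod_cast this

theorem TP.ne_zero {L : Type*} [Field L] [NumberField L] {u : L} (hu : TP u) : u ≠ 0 := by
  rintro rfl
  obtain ⟨g⟩ : Nonempty (L →+* ℂ) := inferInstance
  have := hu g
  simp at this

theorem TP.inv {L : Type*} [Field L] [NumberField L] {u : L} (hu : TP u) : TP (u⁻¹) := fun g => by
  rw [map_inv₀]; exact inv_pos.mpr (hu g)

section LemU
variable {K L : Type*} [Field K] [NumberField K] [Field L] [NumberField L] [Algebra K L]
  [Algebra.IsQuadraticExtension K L]

theorem TP.lift {x : K} (h : TP x) : TP (algebraMap K L x) := fun g => h (g.comp (algebraMap K L))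

theorem TP.descend {x : K} (h : TP (algebraMap K L x)) : TP x := fun g => by
  letI := g.toAlgebra
  let g' : L →ₐ[K] ℂ := IsAlgClosed.lift
  have := h g'.toRingHom
  have e : g'.toRingHom (algebraMap K L x) = g x := g'.commutes x
  rwa [e] at this

theorem lemU {σ : Gal(L/K)} (hσ : σ ≠ 1) (hodd : Odd (Nat.card (ClassGroup (𝓞 K)))) (hR : RealF L)
    (hK : TPS K) (B : Submonoid (𝓞 K)) (hB : ∀ b ∈ B, TP (algebraMap (𝓞 K) K b))
    (hram : ∀ P, RamP σ P → ∃ π ∈ B, P.under (𝓞 K) = Ideal.span {π})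
    (u : (𝓞 L)ˣ) (hu : TP (algebraMap (𝓞 L) L u)) :
    ∃ b ∈ B, ∃ w : L, algebraMap (𝓞 L) L u = algebraMap K L (algebraMap (𝓞 K) K b) * w ^ 2 := by
  classical
  -- norm is a square
  have hNtp : TP (algebraMap (𝓞 K) K (nU K L u)) := by
    apply TP.descend (L := L)
    have : algebraMap K L (algebraMap (𝓞 K) K (nU K L u)) =
        algebraMap (𝓞 L) L u * σ (algebraMap (𝓞 L) L u) := by
      rw [← qa_norm hσ]; rfl
    rw [this]
    exact hu.mul (fun g => hu (g.comp (σ : L →+* L)))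
  obtain ⟨v, hv⟩ := hK _ hNtp
  have hxx : u * sU σ u = iU K L v ^ 2 := by rw [← iU_nU hσ, hv, map_pow]
  have hx1 : algebraMap (𝓞 L) L (u * (iU K L v)⁻¹ : (𝓞 L)ˣ) *
      σ (algebraMap (𝓞 L) L (u * (iU K L v)⁻¹ : (𝓞 L)ˣ)) = 1 := by
    rw [← coe_smul_int, ← coe_sU, ← map_mul, ← Units.val_mul, map_mul, map_inv, sU_iU]
    have : u * (iU K L v)⁻¹ * (sU σ u * (iU K L v)⁻¹) = 1 := by
      calc _ = (u * sU σ u) * (iU K L v ^ 2)⁻¹ := by rw [sq, mul_inv]; exact mul_mul_mul_comm _ _ _ _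
        _ = 1 := by rw [hxx, mul_inv_cancel]
    rw [this]; simp
  obtain ⟨z, hz0, hz⟩ := qa_h90 hσ hx1
  have hz' : (u : 𝓞 L) * σ • z = iU K L v * z := by
    have h1 : ((u * (iU K L v)⁻¹ : (𝓞 L)ˣ) : 𝓞 L) * σ • z = z := by
      apply RingOfIntegers.coe_injective
      rw [map_mul, coe_smul_int]; exact hz
    calc (u : 𝓞 L) * σ • z = iU K L v * (((u * (iU K L v)⁻¹ : (𝓞 L)ˣ) : 𝓞 L) * σ • z) := by
          rw [← mul_assoc, ← Units.val_mul, mul_comm (iU K L v), inv_mul_cancel_right]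
      _ = _ := by rw [h1]
  have hfx : σ • Ideal.span {z} = Ideal.span {z} := by
    rw [smul_span, ← Ideal.span_singleton_mul_right_unit u.isUnit (σ • z), mul_comm, hz', mul_comm]
    exact Ideal.span_singleton_mul_right_unit (iU K L v).isUnit _
  obtain ⟨a, T, ha, hT, hI⟩ := qa_fixed_ideal hσ _ (span_ne_bot hz0) hfx
  set h := Nat.card (ClassGroup (𝓞 K)) with hh
  obtain ⟨α, hα0, hα⟩ := cl_ext_pow hh.symm ha
  have hex : ∀ P, ∃ π ∈ B, P ∈ T → P.under (𝓞 K) = Ideal.span {π} := by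
    intro P
    by_cases hP : P ∈ T
    · obtain ⟨π, h1, h2⟩ := hram P (hT P hP); exact ⟨π, h1, fun _ => h2⟩
    · exact ⟨1, B.one_mem, fun h => absurd h hP⟩
  choose π hπB hπ using hex
  set b := ∏ P ∈ T, π P ^ h with hb
  have hbB : b ∈ B := B.prod_mem fun P _ => B.pow_mem (hπB P) h
  have hbtp := hB b hbB
  set A := algebraMap (𝓞 K) (𝓞 L)
  -- ideal identity
  have hid : Ideal.span {(z * σ • z) ^ h} = Ideal.span {A α ^ 2 * A b} := by
    have hprod : Ideal.span {A b} = (∏ P ∈ T, P) ^ (2 * h) := by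
      rw [hb, map_prod, ← Ideal.prod_span_singleton, ← Finset.prod_pow]
      refine Finset.prod_congr rfl fun P hP => ?_
      rw [map_pow, ← Ideal.span_singleton_pow, ← extI_span, ← hπ P hP, (hT P hP).sq, pow_mul]
    rw [← Ideal.span_singleton_pow, ← Ideal.span_singleton_mul_span_singleton, ← smul_span, hfx, hI,
      ← Ideal.span_singleton_mul_span_singleton, ← Ideal.span_singleton_pow, ← extI_span, ← hα, extI_pow, hprod]
    ring
  obtain ⟨e, he⟩ := (Ideal.span_singleton_eq_span_singleton.mp hid).symm
  have hA0 : A α ≠ 0 := by simpa [A] using hα0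
  have hb0 : b ≠ 0 := fun h0 => hbtp.ne_zero (by rw [h0, map_zero])
  have hAb0 : A b ≠ 0 := by simpa [A] using hb0
  obtain ⟨ε, hε⟩ := sU_fixed hσ e (by
    apply Units.ext
    apply mul_left_cancel₀ (mul_ne_zero (pow_ne_zero 2 hA0) hAb0)
    have h1 := congrArg (fun y => σ • y) he
    simp only [smul_mul', smul_pow', smul_smul, qa_sq hσ, one_smul] at h1
    have h2 : ∀ y, σ • A y = A y := fun y => smul_algebraMap σ y
    rw [h2, h2, mul_comm (σ • z), ← he] at h1
    rw [coe_sU]; exact h1)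
  -- key identity in 𝓞 L : u^h * α^2 * b * ε = v^h * z^(2 h)
  have key : (u : 𝓞 L) ^ h * (A α ^ 2 * A b * e) = (iU K L v : 𝓞 L) ^ h * (z ^ h) ^ 2 := by
    rw [he]
    calc _ = (((u : 𝓞 L) * σ • z) * z) ^ h := by ring
      _ = _ := by rw [hz']; ring
  set ι := algebraMap (𝓞 L) L
  have hιz : ι z ≠ 0 := by simpa [ι] using hz0
  have hια : ι (A α) ≠ 0 := by simpa [ι] using hA0
  have hιb : ι (A b) ≠ 0 := by simpa [ι] using hAb0
  have key2 : ι u ^ h * (ι (A α) ^ 2 * ι (A b) * ι (iU K L ε)) = ι (iU K L v) ^ h * (ι z ^ h) ^ 2 := by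
    have := congrArg ι key
    rw [← hε] at this
    simpa only [map_mul, map_pow] using this
  have hιε : ι (iU K L ε) ≠ 0 := by simp [ι]
  have hιv : ι (iU K L v) ≠ 0 := by simp [ι]
  have htpv : TP (algebraMap (𝓞 K) K (v ^ h * ε⁻¹ : (𝓞 K)ˣ)) := by
    apply TP.descend (L := L)
    have e1 : algebraMap K L (algebraMap (𝓞 K) K (v ^ h * ε⁻¹ : (𝓞 K)ˣ)) =
        ι u ^ h * (ι (A α) ^ 2) * ι (A b) * ((ι z ^ h) ^ 2)⁻¹ := by
      have e2 : algebraMap K L (algebraMap (𝓞 K) K (v ^ h * ε⁻¹ : (𝓞 K)ˣ)) = ι (iU K L (v ^ h * ε⁻¹)) := rfl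
      have e3 : ι (iU K L (v ^ h * ε⁻¹)) * ι (iU K L ε) = ι (iU K L v) ^ h := by
        rw [← map_mul, ← Units.val_mul, ← map_mul, inv_mul_cancel_right, map_pow, ← map_pow]; simp
      rw [e2]
      have h3 : (ι z ^ h) ^ 2 ≠ 0 := pow_ne_zero _ (pow_ne_zero _ hιz)
      apply mul_right_cancel₀ (mul_ne_zero hιε h3)
      rw [← mul_assoc, e3, ← key2]
      field_simp
    rw [e1]
    exact (((hu.pow h).mul (TP.sq_of_real hR hια)).mul hbtp.lift).mul
      (TP.sq_of_real hR (pow_ne_zero _ hιz)).inv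
  obtain ⟨w, hw⟩ := hK _ htpv
  obtain ⟨m, hm⟩ := hodd
  refine ⟨b, hbB, ι (iU K L w) * ι z ^ h / (ι (A α) * ι (A b) * ι u ^ m), ?_⟩
  have hιu : ι u ≠ 0 := by simp [ι]
  have e4 : ι (iU K L v) ^ h = ι (iU K L w) ^ 2 * ι (iU K L ε) := by
    rw [← map_pow, ← map_pow, ← map_mul, ← Units.val_pow_eq_pow_val, ← Units.val_pow_eq_pow_val,
      ← Units.val_mul, ← map_pow, ← map_pow, ← map_mul, ← hw, inv_mul_cancel_right]
  have e5 : algebraMap K L (algebraMap (𝓞 K) K b) = ι (A b) := rfl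
  rw [e5]
  rw [e4] at key2
  have key3 : ι u ^ h * (ι (A α) ^ 2 * ι (A b)) = ι (iU K L w) ^ 2 * (ι z ^ h) ^ 2 := by
    apply mul_right_cancel₀ hιε
    linear_combination key2
  rw [div_pow, mul_pow, ← key3, hm]
  field_simp
  ring
end LemU

theorem group_lemma {G : Type*} [CommGroup G] [Finite G] (n : ℕ)
    (h2 : Nat.card (powMonoidHom 2 : G →* G).ker ≤ 2) (x : G)
    (hx : ∀ y : G, x ≠ y ^ 2) (h : ℕ) (hodd : Odd h) (hup : x ^ (2 ^ (n + 1) * h) = 1)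
    (hlow : ∀ m : ℕ, Odd m → x ^ (2 ^ n * m) ≠ 1) :
    Nonempty ((CommGroup.primaryComponent G 2) ≃* Multiplicative (ZMod (2 ^ (n + 1)))) := by
  classical
  set z := x ^ h with hz
  have hzz : z ^ (2 ^ (n + 1)) = 1 := by rw [hz, ← pow_mul, mul_comm, hup]
  have hz1 : z ^ (2 ^ n) ≠ 1 := by rw [hz, ← pow_mul, mul_comm]; exact hlow h hodd
  have hord : orderOf z = 2 ^ (n + 1) := orderOf_eq_prime_pow hz1 hzz
  have hzns : ∀ y : G, z ≠ y ^ 2 := by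
    intro y hy
    obtain ⟨k, rfl⟩ := hodd
    apply hx (y * (x ^ k)⁻¹)
    rw [mul_pow, ← hy, hz, pow_succ, inv_pow, ← pow_mul, mul_comm 2 k]
    simp
  have hw : ∀ w : G, w ^ 2 = 1 → w ∈ Subgroup.zpowers z := by
    intro w hw
    by_cases h1 : w = 1
    · rw [h1]; exact one_mem _
    have : w = z ^ (2 ^ n) := by
      by_contra hne
      have : ({1, w, z ^ (2 ^ n)} : Set G) ⊆ ((powMonoidHom 2 : G →* G).ker : Set G) := by
        rintro a (rfl | rfl | rfl)
        · exact one_mem _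
        · simpa [MonoidHom.mem_ker] using hw
        · simp only [SetLike.mem_coe, MonoidHom.mem_ker, powMonoidHom_apply]
          rw [← pow_mul, ← pow_succ, hzz]
      have hc := Set.ncard_le_ncard this (Set.toFinite _)
      rw [Set.ncard_eq_three.2 ⟨1, w, _, Ne.symm h1, Ne.symm hz1, hne, rfl⟩] at hc
      have : (((powMonoidHom 2 : G →* G).ker : Set G)).ncard ≤ 2 := h2
      omega
    rw [this]
    exact Subgroup.npow_mem_zpowers z _
  have hstep : ∀ y : G, y ^ 2 ∈ Subgroup.zpowers z → y ∈ Subgroup.zpowers z := by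
    intro y hy
    obtain ⟨j, hj⟩ := Subgroup.mem_zpowers_iff.1 hy
    rcases Int.even_or_odd' j with ⟨k, rfl | rfl⟩
    · have : (y * (z ^ k)⁻¹) ^ 2 = 1 := by
        rw [mul_pow, ← hj, mul_comm 2 k, zpow_mul, inv_pow]
        simp
      have h3 := Subgroup.mul_mem _ (hw _ this) (Subgroup.zpow_mem_zpowers z k)
      simpa using h3
    · exfalso
      apply hzns (y * (z ^ k)⁻¹)
      rw [mul_pow, ← hj, zpow_add, mul_comm 2 k, zpow_mul, inv_pow]
      simp
  have hall : ∀ k : ℕ, ∀ y : G, y ^ (2 ^ k) = 1 → y ∈ Subgroup.zpowers z := by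
    intro k
    induction k with
    | zero => intro y hy; simp at hy; rw [hy]; exact one_mem _
    | succ k ih =>
      intro y hy
      apply hstep
      apply ih
      rw [← pow_mul, ← pow_succ', hy]
  have heq : CommGroup.primaryComponent G 2 = Subgroup.zpowers z := by
    ext y
    constructor
    · rintro ⟨k, hk⟩
      exact hall k y hk
    · intro hy
      have hd : orderOf y ∣ 2 ^ (n + 1) := by
        rw [← hord]; exact orderOf_dvd_of_mem_zpowers hy
      obtain ⟨k, _, hk⟩ := (Nat.dvd_prime_pow Nat.prime_two).1 hd
      exact ⟨k, by rw [← hk, pow_orderOf_eq_one]⟩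
  rw [heq]
  have hcyc : IsCyclic (Subgroup.zpowers z) := inferInstance
  refine ⟨mulEquivOfCyclicCardEq ?_⟩
  rw [Nat.card_zpowers, hord]
  simp

/-- The arithmetic data extracted from the hypotheses. -/
structure PQ (p q : ℕ) : Prop where
  hp : p.Prime
  hq : q.Prime
  hp8 : p % 8 = 5
  hq8 : q % 8 = 3
  hleg : jacobiSym (p : ℤ) q = -1

/-- if `l ∣ x² - e z²` with `e` a nonresidue then `l` divides both -/
def NR (l : ℕ) (e : ℤ) : Prop := ∀ x z : ℤ, (l : ℤ) ∣ x ^ 2 - e * z ^ 2 → (l : ℤ) ∣ x ∧ (l : ℤ) ∣ z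

theorem NR_of_leg {l : ℕ} (hl : l.Prime) {e : ℤ} (h : jacobiSym e l = -1) : NR l e := by
  have := Fact.mk hl
  rw [← jacobiSym.legendreSym.to_jacobiSym] at h
  have h' := (legendreSym.eq_neg_one_iff l).1 h
  intro x z hxz
  have h1 : ((x : ZMod l)) ^ 2 = e * z ^ 2 := by
    have := (ZMod.intCast_zmod_eq_zero_iff_dvd _ l).2 hxz
    push_cast at this
    linear_combination this
  have hz : (z : ZMod l) = 0 := by
    by_contra hz
    apply h'
    refine ⟨x / z, ?_⟩
    field_simp
    exact h1.symm
  have hx : (x : ZMod l) = 0 := by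
    rw [hz] at h1
    simpa using h1
  exact ⟨(ZMod.intCast_zmod_eq_zero_iff_dvd _ l).1 hx, (ZMod.intCast_zmod_eq_zero_iff_dvd _ l).1 hz⟩

namespace PQ
variable {p q : ℕ}

theorem p_two (h : PQ p q) : jacobiSym 2 p = -1 := by
  have := Fact.mk h.hp
  rw [← jacobiSym.legendreSym.to_jacobiSym, legendreSym.at_two (by have := h.hp8; rintro rfl; omega),
    ZMod.χ₈_nat_mod_eight, h.hp8]
  rfl
theorem q_two (h : PQ p q) : jacobiSym 2 q = -1 := by
  have := Fact.mk h.hq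
  rw [← jacobiSym.legendreSym.to_jacobiSym, legendreSym.at_two (by have := h.hq8; rintro rfl; omega),
    ZMod.χ₈_nat_mod_eight, h.hq8]
  rfl
theorem p_neg (h : PQ p q) : jacobiSym (-1) p = 1 := by
  have := Fact.mk h.hp
  rw [← jacobiSym.legendreSym.to_jacobiSym, legendreSym.at_neg_one (by have := h.hp8; rintro rfl; omega),
    ZMod.χ₄_nat_mod_four, show p % 4 = 1 by have := h.hp8; omega]
  rfl
theorem q_neg (h : PQ p q) : jacobiSym (-1) q = -1 := by
  have := Fact.mk h.hq
  rw [← jacobiSym.legendreSym.to_jacobiSym, legendreSym.at_neg_one (by have := h.hq8; rintro rfl; omega),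
    ZMod.χ₄_nat_mod_four, show q % 4 = 3 by have := h.hq8; omega]
  rfl
theorem p_q (h : PQ p q) : jacobiSym (q : ℤ) p = -1 := by
  rw [← h.hleg]
  apply jacobiSym.quadratic_reciprocity_one_mod_four' 
  · exact Nat.odd_iff.2 (by have := h.hq8; omega)
  · have := h.hp8; omega
theorem ne (h : PQ p q) : p ≠ q := by have := h.hp8; have := h.hq8; omega
theorem p_not_dvd (h : PQ p q) : ¬ (p : ℤ) ∣ q := by
  intro hd
  exact h.ne ((Nat.prime_dvd_prime_iff_eq h.hp h.hq).1 (by exact_mod_cast hd))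
theorem q_not_dvd (h : PQ p q) : ¬ (q : ℤ) ∣ p := by
  intro hd
  exact h.ne ((Nat.prime_dvd_prime_iff_eq h.hq h.hp).1 (by exact_mod_cast hd)).symm
theorem NRp2 (h : PQ p q) : NR p 2 := NR_of_leg h.hp h.p_two
theorem NRpm2 (h : PQ p q) : NR p (-2) := NR_of_leg h.hp (by
  rw [show (-2 : ℤ) = -1 * 2 by norm_num, jacobiSym.mul_left, h.p_two, h.p_neg]; rfl)
theorem NRpq (h : PQ p q) : NR p q := NR_of_leg h.hp h.p_q
theorem NRqp (h : PQ p q) : NR q p := NR_of_leg h.hq h.hleg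
theorem NRq2 (h : PQ p q) : NR q 2 := NR_of_leg h.hq h.q_two
theorem NRqm1 (h : PQ p q) : NR q (-1) := NR_of_leg h.hq h.q_neg
end PQ

theorem nf_int {l : ℕ} (hl : l.Prime) {d e : ℤ} (hd : ¬ (l : ℤ) ∣ d) (hN : NR l e) :
    ∀ k : ℕ, ∀ x y z : ℤ, z.natAbs = k → x ^ 2 - (l * d) * y ^ 2 = e * z ^ 2 → z = 0 := by
  have hl' : Prime (l : ℤ) := Nat.prime_iff_prime_int.1 hl
  intro k
  induction k using Nat.strong_induction_on with
  | _ k ih =>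
    intro x y z hz hxy
    by_contra hz0
    obtain ⟨⟨x', rfl⟩, ⟨z', rfl⟩⟩ := hN x z ⟨d * y ^ 2, by linear_combination hxy⟩
    have hy : (l : ℤ) ∣ y := by
      have : (l : ℤ) ∣ d * y ^ 2 := ⟨x' ^ 2 - e * z' ^ 2, by
        apply mul_left_cancel₀ hl'.ne_zero
        linear_combination -hxy⟩
      exact hl'.dvd_of_dvd_pow ((hl'.dvd_or_dvd this).resolve_left hd)
    obtain ⟨y', rfl⟩ := hy
    have h0 : z' ≠ 0 := by rintro rfl; simp at hz0
    apply h0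
    refine ih z'.natAbs ?_ x' y' z' rfl ?_
    · rw [← hz, Int.natAbs_mul, Int.natAbs_natCast]
      have := hl.two_le
      have : 0 < z'.natAbs := Int.natAbs_pos.2 h0
      nlinarith
    · apply mul_left_cancel₀ (pow_ne_zero 2 hl'.ne_zero)
      linear_combination hxy

theorem common_den (s : Finset ℚ) : ∃ c : ℤ, c ≠ 0 ∧ ∀ x ∈ s, ∃ y : ℤ, x * c = y := by
  refine ⟨∏ x ∈ s, (x.den : ℤ), Finset.prod_ne_zero_iff.2 fun x _ => by simp, fun x hx => ?_⟩
  rw [← Finset.mul_prod_erase _ _ hx]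
  refine ⟨x.num * ∏ x ∈ s.erase x, (x.den : ℤ), ?_⟩
  push_cast
  rw [← mul_assoc, Rat.mul_den_eq_num]

theorem nf_rat {l : ℕ} (hl : l.Prime) {d e : ℤ} (hd : ¬ (l : ℤ) ∣ d) (hN : NR l e)
    (x y : ℚ) : x ^ 2 - (l * d) * y ^ 2 ≠ e := by
  intro hxy
  obtain ⟨c, hc, hcs⟩ := common_den {x, y}
  obtain ⟨X, hX⟩ := hcs x (by simp)
  obtain ⟨Y, hY⟩ := hcs y (by simp)
  apply hc
  refine nf_int hl hd hN _ X Y c rfl ?_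
  have : ((X : ℚ)) ^ 2 - (l * d) * Y ^ 2 = e * c ^ 2 := by
    rw [← hX, ← hY, ← hxy]; ring
  exact_mod_cast this

namespace PQ
variable {p q : ℕ}

theorem nf_two (h : PQ p q) (x y : ℚ) : x ^ 2 - (p * q) * y ^ 2 ≠ 2 := by
  have := nf_rat h.hp h.p_not_dvd h.NRp2 x y
  exact_mod_cast this
theorem nf_neg_two (h : PQ p q) (x y : ℚ) : x ^ 2 - (p * q) * y ^ 2 ≠ -2 := by
  have := nf_rat h.hp h.p_not_dvd h.NRpm2 x y
  exact_mod_cast this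
theorem nf_p (h : PQ p q) (x y : ℚ) : x ^ 2 + (p * q) * y ^ 2 ≠ p := by
  have := nf_rat h.hq (d := -p) (by rw [dvd_neg]; exact h.q_not_dvd) h.NRqp x y
  intro h2
  apply this
  push_cast
  linear_combination h2
theorem nf_q (h : PQ p q) (x y : ℚ) : x ^ 2 + (p * q) * y ^ 2 ≠ q := by
  have := nf_rat h.hp (d := -q) (by rw [dvd_neg]; exact h.p_not_dvd) h.NRpq x y
  intro h2
  apply this
  push_cast
  linear_combination h2

theorem nf_i_int (h : PQ p q) : ∀ k : ℕ, ∀ a b x y c : ℤ, c.natAbs = k →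
    a ^ 2 - b ^ 2 = (p * q) * (x ^ 2 - y ^ 2) → 2 * a * b - 2 * (p * q) * (x * y) = c ^ 2 → c = 0 := by
  have hl' : Prime (p : ℤ) := Nat.prime_iff_prime_int.1 h.hp
  have h2 : ¬ (p : ℤ) ∣ 2 := by
    intro hd
    have := Nat.le_of_dvd (by norm_num) (show p ∣ 2 by exact_mod_cast hd)
    have := h.hp8; omega
  intro k
  induction k using Nat.strong_induction_on with
  | _ k ih =>
    intro a b x y c hk h1 h3
    by_contra hc0
    have hab : (p : ℤ) ∣ (a - b) * (a + b) := ⟨q * (x ^ 2 - y ^ 2), by linear_combination h1⟩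
    have key : (p : ℤ) ∣ c ∧ (p : ℤ) ∣ b ∧ (p : ℤ) ∣ a := by
      rcases hl'.dvd_or_dvd hab with hab | hab
      · obtain ⟨t, ht⟩ := hab
        obtain ⟨u, v⟩ := h.NRp2 c b ⟨2 * b * t - 2 * q * (x * y), by linear_combination -h3 + 2 * b * ht⟩
        exact ⟨u, v, by have := dvd_add (Dvd.intro t ht.symm) v; simpa using this⟩
      · obtain ⟨t, ht⟩ := hab
        obtain ⟨u, v⟩ := h.NRpm2 c b ⟨2 * b * t - 2 * q * (x * y), by linear_combination -h3 + 2 * b * ht⟩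
        exact ⟨u, v, by have := dvd_sub (Dvd.intro t ht.symm) v; simpa using this⟩
    obtain ⟨⟨c, rfl⟩, ⟨b, rfl⟩, ⟨a, rfl⟩⟩ := key
    have e1 : (p : ℤ) ∣ q * (x ^ 2 - y ^ 2) := ⟨a ^ 2 - b ^ 2, by
      apply mul_left_cancel₀ hl'.ne_zero; linear_combination -h1⟩
    have e1 := (hl'.dvd_or_dvd e1).resolve_left h.p_not_dvd
    have e2 : (p : ℤ) ∣ (2 * q) * (x * y) := ⟨2 * a * b - c ^ 2, by
      apply mul_left_cancel₀ hl'.ne_zero; linear_combination -h3⟩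
    have e2 := (hl'.dvd_or_dvd e2).resolve_left (fun hh => (hl'.dvd_or_dvd hh).elim h2 h.p_not_dvd)
    have hxy : (p : ℤ) ∣ x ∧ (p : ℤ) ∣ y := by
      rcases hl'.dvd_or_dvd e2 with hh | hh
      · refine ⟨hh, hl'.dvd_of_dvd_pow (n := 2) ?_⟩
        have := dvd_sub (dvd_pow hh (n := 2) (by norm_num)) e1
        simpa using this
      · refine ⟨hl'.dvd_of_dvd_pow (n := 2) ?_, hh⟩
        have := dvd_add (dvd_pow hh (n := 2) (by norm_num)) e1
        simpa using this
    obtain ⟨⟨x, rfl⟩, ⟨y, rfl⟩⟩ := hxy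
    have h0 : c ≠ 0 := by rintro rfl; simp at hc0
    apply h0
    refine ih c.natAbs ?_ a b x y c rfl ?_ ?_
    · rw [← hk, Int.natAbs_mul, Int.natAbs_natCast]
      have := h.hp.two_le
      have : 0 < c.natAbs := Int.natAbs_pos.2 h0
      nlinarith
    · apply mul_left_cancel₀ (pow_ne_zero 2 hl'.ne_zero)
      linear_combination h1
    · apply mul_left_cancel₀ (pow_ne_zero 2 hl'.ne_zero)
      linear_combination h3

theorem nf_i (h : PQ p q) (a b x y : ℚ) (h1 : a ^ 2 - b ^ 2 = (p * q) * (x ^ 2 - y ^ 2))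
    (h2 : 2 * a * b - 2 * (p * q) * (x * y) = 1) : False := by
  obtain ⟨c, hc, hcs⟩ := common_den {a, b, x, y}
  obtain ⟨A, hA⟩ := hcs a (by simp)
  obtain ⟨B, hB⟩ := hcs b (by simp)
  obtain ⟨X, hX⟩ := hcs x (by simp)
  obtain ⟨Y, hY⟩ := hcs y (by simp)
  apply hc
  refine h.nf_i_int _ A B X Y c rfl ?_ ?_
  · have : ((A : ℚ)) ^ 2 - B ^ 2 = (p * q) * (X ^ 2 - Y ^ 2) := by
      rw [← hX, ← hY, ← hA, ← hB]; linear_combination c ^ 2 * h1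
    exact_mod_cast this
  · have : 2 * (A : ℚ) * B - 2 * (p * q) * (X * Y) = c ^ 2 := by
      rw [← hX, ← hY, ← hA, ← hB]; linear_combination c ^ 2 * h2
    exact_mod_cast this

theorem nf_c_int (h : PQ p q) : ∀ k : ℕ, ∀ a b x y c : ℤ, c.natAbs = k →
    a ^ 2 - 2 * b ^ 2 - (p * q) * (x ^ 2 - 2 * y ^ 2) = -c ^ 2 →
    a * b = (p * q) * (x * y) → c = 0 := by
  have hl' : Prime (q : ℤ) := Nat.prime_iff_prime_int.1 h.hq
  have h2 : ¬ (q : ℤ) ∣ 2 := by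
    intro hd
    have := Nat.le_of_dvd (by norm_num) (show q ∣ 2 by exact_mod_cast hd)
    have := h.hq8
    have : q = 0 ∨ q = 1 ∨ q = 2 := by omega
    omega
  intro k
  induction k using Nat.strong_induction_on with
  | _ k ih =>
    intro a b x y c hk h1 h3
    by_contra hc0
    have hab : (q : ℤ) ∣ a * b := ⟨p * (x * y), by linear_combination h3⟩
    have key : (q : ℤ) ∣ c ∧ (q : ℤ) ∣ b ∧ (q : ℤ) ∣ a := by
      rcases hl'.dvd_or_dvd hab with hab | hab
      · obtain ⟨t, ht⟩ := hab
        obtain ⟨u, v⟩ := h.NRq2 c b ⟨p * (x ^ 2 - 2 * y ^ 2) - a * t, by linear_combination h1 - a * ht⟩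
        exact ⟨u, v, ht ▸ dvd_mul_right _ _⟩
      · obtain ⟨t, ht⟩ := hab
        obtain ⟨u, v⟩ := h.NRqm1 c a ⟨p * (x ^ 2 - 2 * y ^ 2) + 2 * b * t, by
          linear_combination h1 + 2 * b * ht⟩
        exact ⟨u, ht ▸ dvd_mul_right _ _, v⟩
    obtain ⟨⟨c, rfl⟩, ⟨b, rfl⟩, ⟨a, rfl⟩⟩ := key
    have e1 : (q : ℤ) ∣ p * (x ^ 2 - 2 * y ^ 2) := ⟨a ^ 2 - 2 * b ^ 2 + c ^ 2, by
      apply mul_left_cancel₀ hl'.ne_zero; linear_combination -h1⟩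
    have e1 := (hl'.dvd_or_dvd e1).resolve_left h.q_not_dvd
    have hxy := h.NRq2 x y e1
    obtain ⟨⟨x, rfl⟩, ⟨y, rfl⟩⟩ := hxy
    have h0 : c ≠ 0 := by rintro rfl; simp at hc0
    apply h0
    refine ih c.natAbs ?_ a b x y c rfl ?_ ?_
    · rw [← hk, Int.natAbs_mul, Int.natAbs_natCast]
      have := h.hq.two_le
      have : 0 < c.natAbs := Int.natAbs_pos.2 h0
      nlinarith
    · apply mul_left_cancel₀ (pow_ne_zero 2 hl'.ne_zero)
      linear_combination h1
    · apply mul_left_cancel₀ (pow_ne_zero 2 hl'.ne_zero)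
      linear_combination h3

theorem nf_c (h : PQ p q) (a b x y : ℚ) (h1 : a ^ 2 - 2 * b ^ 2 - (p * q) * (x ^ 2 - 2 * y ^ 2) = -1)
    (h2 : a * b = (p * q) * (x * y)) : False := by
  obtain ⟨c, hc, hcs⟩ := common_den {a, b, x, y}
  obtain ⟨A, hA⟩ := hcs a (by simp)
  obtain ⟨B, hB⟩ := hcs b (by simp)
  obtain ⟨X, hX⟩ := hcs x (by simp)
  obtain ⟨Y, hY⟩ := hcs y (by simp)
  apply hc
  refine h.nf_c_int _ A B X Y c rfl ?_ ?_
  · have : ((A : ℚ)) ^ 2 - 2 * B ^ 2 - (p * q) * (X ^ 2 - 2 * Y ^ 2) = - c ^ 2 := by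
      rw [← hX, ← hY, ← hA, ← hB]; linear_combination c ^ 2 * h1
    exact_mod_cast this
  · have : (A : ℚ) * B = (p * q) * (X * Y) := by
      rw [← hX, ← hY, ← hA, ← hB]; linear_combination c ^ 2 * h2
    exact_mod_cast this
end PQ

theorem sq_fac {A B y : ℕ} (hc : A.Coprime B) (h : A * B = y ^ 2) :
    ∃ r s, A = r ^ 2 ∧ B = s ^ 2 ∧ r * s = y := by
  obtain ⟨r, hr⟩ := exists_eq_pow_of_mul_eq_pow (a := A) (b := B) (by
    rw [Nat.isUnit_iff]; exact hc) h
  obtain ⟨s, hs⟩ := exists_eq_pow_of_mul_eq_pow (a := B) (b := A) (by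
    rw [Nat.isUnit_iff]; exact hc.symm) (by rw [mul_comm]; exact h)
  refine ⟨r, s, hr, hs, ?_⟩
  have : (r * s) ^ 2 = y ^ 2 := by rw [← h, hr, hs]; ring
  exact Nat.pow_left_injective two_ne_zero this

theorem pq_fac {p q A B y : ℕ} (hp : p.Prime) (hq : q.Prime) (hc : A.Coprime B)
    (h : A * B = p * q * y ^ 2) :
    ∃ r s, r * s = y ∧ ((A = r ^ 2 ∧ B = p * q * s ^ 2) ∨ (A = p * q * r ^ 2 ∧ B = s ^ 2) ∨
      (A = p * r ^ 2 ∧ B = q * s ^ 2) ∨ (A = q * r ^ 2 ∧ B = p * s ^ 2)) := by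
  have step : ∀ {l : ℕ} {A B c : ℕ}, l.Prime → A * B = l * c → 
      (∃ A', A = l * A' ∧ A' * B = c) ∨ (∃ B', B = l * B' ∧ A * B' = c) := by
    intro l A B c hl h
    rcases hl.dvd_mul.1 (Dvd.intro _ h.symm) with ⟨A', rfl⟩ | ⟨B', rfl⟩
    · left
      exact ⟨A', rfl, Nat.eq_of_mul_eq_mul_left hl.pos (by rw [← h]; ring)⟩
    · right
      exact ⟨B', rfl, Nat.eq_of_mul_eq_mul_left hl.pos (by rw [← h]; ring)⟩
  rw [mul_assoc] at h
  rcases step hp h with ⟨A, rfl, h1⟩ | ⟨B, rfl, h1⟩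
  · have hc1 : A.Coprime B := Nat.Coprime.coprime_mul_left hc
    rcases step hq h1 with ⟨A, rfl, h2⟩ | ⟨B, rfl, h2⟩
    · obtain ⟨r, s, rfl, rfl, rfl⟩ := sq_fac (Nat.Coprime.coprime_mul_left hc1) h2
      exact ⟨r, s, rfl, Or.inr (Or.inl ⟨by ring, rfl⟩)⟩
    · obtain ⟨r, s, rfl, rfl, rfl⟩ := sq_fac (Nat.Coprime.coprime_mul_left_right hc1) h2
      exact ⟨r, s, rfl, Or.inr (Or.inr (Or.inl ⟨by ring, rfl⟩))⟩
  · have hc1 : A.Coprime B := Nat.Coprime.coprime_mul_left_right hc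
    rcases step hq h1 with ⟨A, rfl, h2⟩ | ⟨B, rfl, h2⟩
    · obtain ⟨r, s, rfl, rfl, rfl⟩ := sq_fac (Nat.Coprime.coprime_mul_left hc1) h2
      exact ⟨r, s, rfl, Or.inr (Or.inr (Or.inr ⟨by ring, rfl⟩))⟩
    · obtain ⟨r, s, rfl, rfl, rfl⟩ := sq_fac (Nat.Coprime.coprime_mul_left_right hc1) h2
      exact ⟨r, s, rfl, Or.inl ⟨rfl, by ring⟩⟩

namespace PQ
variable {p q : ℕ}

theorem not_dvd_one_p (h : PQ p q) : ¬ (p : ℤ) ∣ 1 := by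
  have := h.hp.two_le
  intro hd
  have := Int.le_of_dvd (by norm_num) hd
  omega
theorem not_dvd_one_q (h : PQ p q) : ¬ (q : ℤ) ∣ 1 := by
  have := h.hq.two_le
  intro hd
  have := Int.le_of_dvd (by norm_num) hd
  omega

theorem pell_aux (h : PQ p q) : ∀ y x : ℕ, 0 < y → x ^ 2 = p * q * y ^ 2 + 1 →
    ∃ u v : ℤ, p * u ^ 2 - q * v ^ 2 = 2 := by
  intro y
  induction y using Nat.strong_induction_on with
  | _ y ih =>
    intro x hy hxy
    have hpp := h.hp.pos
    have hqp := h.hq.pos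
    rcases Nat.even_or_odd' x with ⟨m, rfl | rfl⟩
    · have hm : 0 < m := by
        rcases Nat.eq_zero_or_pos m with rfl | hm
        · simp at hxy
        · exact hm
      obtain ⟨m, rfl⟩ : ∃ k, m = k + 1 := ⟨m - 1, by omega⟩
      have hfac : (2 * m + 3) * (2 * m + 1) = p * q * y ^ 2 := by
        have : (2 * m + 3) * (2 * m + 1) + 1 = (2 * (m + 1)) ^ 2 := by ring
        omega
      have hcop : (2 * m + 3).Coprime (2 * m + 1) := by
        rw [show 2 * m + 3 = 2 + (2 * m + 1) by ring, Nat.coprime_add_self_left]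
        simp
      obtain ⟨r, s, rs, H⟩ := pq_fac h.hp h.hq hcop hfac
      rcases H with ⟨h1, h2⟩ | ⟨h1, h2⟩ | ⟨h1, h2⟩ | ⟨h1, h2⟩
      · exfalso
        have e : (r : ℤ) ^ 2 - p * q * s ^ 2 = 2 := by
          zify at h1 h2; linear_combination h2 - h1
        exact h.not_dvd_one_p (h.NRp2 r 1 ⟨q * s ^ 2, by linear_combination e⟩).2
      · exfalso
        have e : (p * q * r ^ 2 : ℤ) - s ^ 2 = 2 := by
          zify at h1 h2; linear_combination h2 - h1
        exact h.not_dvd_one_p (h.NRpm2 s 1 ⟨q * r ^ 2, by linear_combination -e⟩).2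
      · exact ⟨r, s, by zify at h1 h2; linear_combination h2 - h1⟩
      · exfalso
        have e : (q * r ^ 2 : ℤ) - p * s ^ 2 = 2 := by
          zify at h1 h2; linear_combination h2 - h1
        have h3 : jacobiSym (-(2 * p)) q = -1 := by
          rw [show (-(2 * p : ℤ)) = -1 * (2 * p) by ring, jacobiSym.mul_left, jacobiSym.mul_left, h.q_neg,
            h.q_two, h.hleg]; rfl
        have := NR_of_leg h.hq h3 (p * s) 1 ⟨p * r ^ 2, by linear_combination -p * e⟩
        exact h.not_dvd_one_q this.2
    · have hye : ∃ w, y = 2 * w := by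
        rcases Nat.even_or_odd' y with ⟨w, hw | rfl⟩
        · exact ⟨w, hw⟩
        · exfalso
          have : Odd (p * q * (2 * w + 1) ^ 2) := by
            have h1 : Odd p := Nat.odd_iff.2 (by have := h.hp8; omega)
            have h2 : Odd q := Nat.odd_iff.2 (by have := h.hq8; omega)
            exact (h1.mul h2).mul (Odd.pow ⟨w, rfl⟩)
          have h3 : Odd ((2 * m + 1) ^ 2) := Odd.pow ⟨m, rfl⟩
          rw [hxy] at h3
          exact (Nat.not_even_iff_odd.2 h3) (this.add_odd odd_one)
      obtain ⟨w, rfl⟩ := hye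
      have hfac : (m + 1) * m = p * q * w ^ 2 := by nlinarith
      obtain ⟨r, s, rs, H⟩ := pq_fac h.hp h.hq (by simp) hfac
      rcases H with ⟨h1, h2⟩ | ⟨h1, h2⟩ | ⟨h1, h2⟩ | ⟨h1, h2⟩
      · have hr : 0 < r := by
          rcases Nat.eq_zero_or_pos r with rfl | hr
          · simp at h1
          · exact hr
        have hs : 0 < s := by
          rcases Nat.eq_zero_or_pos s with rfl | hr
          · simp at rs; omega
          · exact hr
        exact ih s (by nlinarith) r hs (by omega)
      · exfalso
        have e : (p * q * r ^ 2 : ℤ) - s ^ 2 = 1 := by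
          zify at h1 h2; linear_combination h2 - h1
        exact h.not_dvd_one_q (h.NRqm1 s 1 ⟨p * r ^ 2, by linear_combination -e⟩).2
      · exfalso
        have e : (p * r ^ 2 : ℤ) - q * s ^ 2 = 1 := by
          zify at h1 h2; linear_combination h2 - h1
        exact h.not_dvd_one_q (h.NRqp (p * r) 1 ⟨p * s ^ 2, by linear_combination p * e⟩).2
      · exfalso
        have e : (q * r ^ 2 : ℤ) - p * s ^ 2 = 1 := by
          zify at h1 h2; linear_combination h2 - h1
        exact h.not_dvd_one_p (h.NRpq (q * r) 1 ⟨q * s ^ 2, by linear_combination q * e⟩).2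

theorem not_sq (h : PQ p q) : ¬ IsSquare ((p : ℤ) * q) := by
  rintro ⟨r, hr⟩
  have hl' : Prime (p : ℤ) := Nat.prime_iff_prime_int.1 h.hp
  have : (p : ℤ) ∣ r * r := ⟨q, hr.symm⟩
  rcases (hl'.dvd_or_dvd this) with ⟨t, rfl⟩ | ⟨t, rfl⟩ <;>
  exact h.p_not_dvd ⟨t * t, by apply mul_left_cancel₀ hl'.ne_zero; linear_combination hr⟩

theorem pell (h : PQ p q) : ∃ u v : ℤ, p * u ^ 2 - q * v ^ 2 = 2 := by
  obtain ⟨x, y, hxy, hy⟩ := Pell.exists_of_not_isSquare (d := (p : ℤ) * q)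
    (by have := h.hp.pos; have := h.hq.pos; positivity) h.not_sq
  refine h.pell_aux y.natAbs x.natAbs (Int.natAbs_pos.2 hy) ?_
  zify
  rw [sq_abs, sq_abs]
  linear_combination hxy
end PQ

open IntermediateField NumberField
open scoped Pointwise
set_option linter.unusedSectionVars false

section QuadGen
variable {K L : Type*} [Field K] [NumberField K] [Field L] [NumberField L] [Algebra K L]
  [Algebra.IsQuadraticExtension K L]

theorem exists_ne_one : ∃ σ : Gal(L/K), σ ≠ 1 := by
  by_contra! h
  have h1 : Nat.card (Gal(L/K)) ≤ 1 := by
    have : Subsingleton (Gal(L/K)) := ⟨fun a b => by rw [h a, h b]⟩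
    exact Finite.card_le_one_iff_subsingleton.2 this
  rw [qa_card] at h1
  omega

theorem exists_conj_sub (a : K) (s : L) (hs : ∀ y : K, algebraMap K L y ≠ s)
    (b : K) (h : s ^ 2 - algebraMap K L a * s + algebraMap K L b = 0) :
    ∃ σ : Gal(L/K), σ ≠ 1 ∧ σ s = algebraMap K L a - s := by
  obtain ⟨σ, hσ⟩ := exists_ne_one (K := K) (L := L)
  refine ⟨σ, hσ, ?_⟩
  have h1 := congrArg σ h
  simp only [map_add, map_sub, map_pow, map_mul, AlgEquiv.commutes, map_zero] at h1
  have h2 : (σ s - s) * (σ s - (algebraMap K L a - s)) = 0 := by linear_combination h1 - h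
  rcases mul_eq_zero.1 h2 with h3 | h3
  · obtain ⟨y, hy⟩ := qa_fixed hσ (sub_eq_zero.1 h3)
    exact absurd hy (hs y)
  · exact sub_eq_zero.1 h3

theorem exists_conj_neg (s : L) (hs : ∀ y : K, algebraMap K L y ≠ s)
    (b : K) (h : s ^ 2 = algebraMap K L b) :
    ∃ σ : Gal(L/K), σ ≠ 1 ∧ σ s = - s := by
  obtain ⟨σ, h1, h2⟩ := exists_conj_sub 0 s hs (-b) (by simp [h])
  exact ⟨σ, h1, by simpa using h2⟩
end QuadGen

section Tower
variable {M : Type*} [Field M] [NumberField M]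

theorem gen_top (b : M) : ℚ⟮(AdjoinSimple.gen ℚ b)⟯ = ⊤ := by
  have key : ∀ A : Algebra ℚ ℚ⟮b⟯, A = (ℚ⟮b⟯).algebra' →
      @IntermediateField.adjoin ℚ _ ℚ⟮b⟯ _ A {AdjoinSimple.gen ℚ b} = ⊤ := by
    rintro A rfl
    apply IntermediateField.map_injective (ℚ⟮b⟯).val
    rw [IntermediateField.adjoin_map, ← AlgHom.fieldRange_eq_map]
    simp
  exact key _ (Subsingleton.elim _ _)

theorem finrank_tower (K : Type*) [Field K] [NumberField K] [Algebra K M] :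
    Module.finrank ℚ K * Module.finrank K M = Module.finrank ℚ M :=
  Module.finrank_mul_finrank ℚ K M

theorem norm_tower (K : Type*) [Field K] [NumberField K] [Algebra K M] (x : M) :
    Algebra.norm ℚ (Algebra.norm K x) = Algebra.norm ℚ x :=
  Algebra.norm_norm

theorem adjoin_top_mono (F : IntermediateField ℚ M) {S : Set M} {x : M} (h : IntermediateField.adjoin ℚ S = ⊤)
    (hS : S ⊆ F⟮x⟯) : F⟮x⟯ = ⊤ := by
  rw [← IntermediateField.restrictScalars_eq_top_iff (K := ℚ), eq_top_iff, ← h]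
  exact IntermediateField.adjoin_le_iff.2 hS

theorem finrank_le_two (F : IntermediateField ℚ M) {x : M} (h : F⟮x⟯ = ⊤) (a b : F)
    (hx : x ^ 2 - a * x + b = 0) : Module.finrank F M ≤ 2 := by
  rw [← IntermediateField.finrank_top', ← h, IntermediateField.adjoin.finrank (IsIntegral.of_finite F x)]
  let f : Polynomial F := Polynomial.X ^ 2 - Polynomial.C a * Polynomial.X + Polynomial.C b
  have hf : f.natDegree = 2 := by
    show (Polynomial.X ^ 2 - Polynomial.C a * Polynomial.X + Polynomial.C b).natDegree = 2
    compute_degree!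
  have hf0 : f ≠ 0 := fun h0 => by rw [h0] at hf; simp at hf
  rw [← hf]
  apply Polynomial.natDegree_le_of_dvd _ hf0
  apply minpoly.dvd
  simp only [f, map_add, map_sub, map_mul, map_pow, Polynomial.aeval_X, Polynomial.aeval_C]
  exact hx

theorem notMem_of_finrank (F : IntermediateField ℚ M) {x : M} (h : F⟮x⟯ = ⊤)
    (h2 : Module.finrank F M = 2) (y : F) : algebraMap F M y ≠ x := by
  rintro rfl
  have : F⟮algebraMap F M y⟯ = ⊥ := by
    rw [IntermediateField.adjoin_simple_eq_bot_iff]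
    exact ⟨y, rfl⟩
  rw [this] at h
  have h3 := IntermediateField.finrank_eq_one_iff.2 h.symm
  rw [IntermediateField.finrank_top', h2] at h3
  omega
end Tower

open IntermediateField NumberField
open scoped Pointwise
set_option linter.unusedSectionVars false

/-- `TT n a`: `a` is a conjugate of `2cos(2π/2^(n+2))`. -/
def TT {R : Type*} [CommRing R] : ℕ → R → Prop
  | 0, a => a = 0
  | n + 1, a => TT n (a ^ 2 - 2)

theorem TT_map {R S : Type*} [CommRing R] [CommRing S] (f : R →+* S) :
    ∀ (n : ℕ) {a : R}, TT n a → TT n (f a)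
  | 0, a, h => by show f a = 0; rw [show a = 0 from h, map_zero]
  | n + 1, a, h => by
    show TT n (f a ^ 2 - 2)
    have := TT_map f n (a := a ^ 2 - 2) h
    rwa [map_sub, map_pow, map_ofNat f 2] at this

theorem TT_of_map {R S : Type*} [CommRing R] [CommRing S] (f : R →+* S) (hf : Function.Injective f) :
    ∀ (n : ℕ) {a : R}, TT n (f a) → TT n a
  | 0, a, h => hf (by rw [map_zero]; exact h)
  | n + 1, a, h => by
    apply TT_of_map f hf n
    have : TT n (f a ^ 2 - 2) := h
    rwa [map_sub, map_pow, map_ofNat f 2]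

theorem TT_real : ∀ (n : ℕ) {z : ℂ}, TT n z → ∃ r : ℝ, z = r ∧ |r| < 2
  | 0, z, h => ⟨0, by rw [show z = 0 from h]; simp, by simp⟩
  | n + 1, z, h => by
    obtain ⟨w, hw, hw2⟩ := TT_real n (z := z ^ 2 - 2) h
    rw [abs_lt] at hw2
    have h1 : z ^ 2 = ((√(w + 2) : ℝ) : ℂ) ^ 2 := by
      rw [← Complex.ofReal_pow, Real.sq_sqrt (by linarith)]
      push_cast; linear_combination hw
    have h2 : √(w + 2) < 2 := by
      rw [Real.sqrt_lt' (by norm_num)]; linarith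
    have h3 := Real.sqrt_nonneg (w + 2)
    rcases sq_eq_sq_iff_eq_or_eq_neg.1 h1 with h1 | h1
    · exact ⟨_, h1, by rw [abs_lt]; constructor <;> linarith⟩
    · exact ⟨-√(w + 2), by rw [h1]; push_cast; rfl, by rw [abs_neg, abs_lt]; constructor <;> linarith⟩

theorem TT_integral {R : Type*} [CommRing R] : ∀ (n : ℕ) {a : R}, TT n a → IsIntegral ℤ a
  | 0, a, h => by rw [show a = 0 from h]; exact isIntegral_zero
  | n + 1, a, h => by
    have h1 : IsIntegral ℤ (a ^ 2 - 2) := TT_integral n h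
    have h2 : IsIntegral ℤ (a ^ 2) := by
      have := h1.add (isIntegral_algebraMap (R := ℤ) (x := (2 : ℤ)))
      simpa using this
    exact IsIntegral.of_pow (n := 2) (by norm_num) h2

open ComplexOrder in
theorem TT_pos {K : Type*} [Field K] {n : ℕ} {a : K} (h : TT n a) : TP (2 + a) := fun g => by
  obtain ⟨r, hr, hr2⟩ := TT_real n (TT_map g n h)
  rw [map_add, hr, map_ofNat]
  rw [abs_lt] at hr2
  have : (0 : ℝ) < 2 + r := by linarith
  exact_mod_cast this

/-- A field generated by elements whose conjugates are all real is totally real. -/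
theorem RealF_of_adjoin {K : Type*} [Field K] [NumberField K] {S : Set K}
    (hS : IntermediateField.adjoin ℚ S = ⊤) (h : ∀ g : K →+* ℂ, ∀ x ∈ S, (g x).im = 0) : RealF K := by
  intro g x
  have hx : x ∈ IntermediateField.adjoin ℚ S := by rw [hS]; trivial
  induction hx using IntermediateField.adjoin_induction with
  | mem x hx => exact h g x hx
  | algebraMap r => simp
  | add x y _ _ hx hy => simp [hx, hy]
  | inv x _ hx => simp [Complex.inv_im, hx]
  | mul x y _ _ hx hy => simp [Complex.mul_im, hx, hy]

/-- prime ideals containing `2` contain every `TT n a`. -/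
theorem TT_mem {R : Type*} [CommRing R] (P : Ideal R) [P.IsPrime] (h2 : (2 : R) ∈ P) :
    ∀ (n : ℕ) {a : R}, TT n a → a ∈ P
  | 0, a, h => by rw [show a = 0 from h]; exact P.zero_mem
  | n + 1, a, h => by
    have h1 : a ^ 2 - 2 ∈ P := TT_mem P h2 n h
    have h3 : a ^ 2 ∈ P := by have := P.add_mem h1 h2; simpa using this
    exact Ideal.IsPrime.mem_of_pow_mem inferInstance 2 h3

theorem adjoin_simple_mono {M : Type*} [Field M] [NumberField M] (F : IntermediateField ℚ M) {x : M}
    (h : ℚ⟮x⟯ = ⊤) : F⟮x⟯ = ⊤ :=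
  adjoin_top_mono F h (by
    rintro y hy
    rw [Set.mem_singleton_iff] at hy
    subst hy
    exact IntermediateField.mem_adjoin_simple_self F y)

theorem TT_gen {K : Type*} [Field K] [NumberField K] {n : ℕ} {b : K} (h : TT n b) :
    TT n (AdjoinSimple.gen ℚ b) := by
  apply TT_of_map (algebraMap ℚ⟮b⟯ K) (FaithfulSMul.algebraMap_injective _ _) n
  rw [AdjoinSimple.algebraMap_gen]
  exact h

theorem TT_finrank_le : ∀ (n : ℕ) (K : Type u) [Field K] [NumberField K] (a : K), TT n a → ℚ⟮a⟯ = ⊤ →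
    Module.finrank ℚ K ≤ 2 ^ n := by
  intro n
  induction n with
  | zero =>
    intro K _ _ a ha ht
    rw [show a = 0 from ha, IntermediateField.adjoin_zero] at ht
    have := IntermediateField.finrank_eq_one_iff.2 ht.symm
    rw [IntermediateField.finrank_top'] at this
    simp [this]
  | succ n ih =>
    intro K _ _ a ha ht
    obtain ⟨b, hb⟩ : ∃ b, b = a ^ 2 - 2 := ⟨_, rfl⟩
    have hb1 : TT n b := hb ▸ ha
    rw [← finrank_tower (ℚ⟮b⟯), pow_succ]
    apply Nat.mul_le_mul
    · exact ih ℚ⟮b⟯ (AdjoinSimple.gen ℚ b) (TT_gen hb1) (gen_top b)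
    · refine finrank_le_two _ (adjoin_simple_mono _ ht) 0 (-2 - AdjoinSimple.gen ℚ b) ?_
      have h1 : ((AdjoinSimple.gen ℚ b : ℚ⟮b⟯) : K) = b := rfl
      have h2 : ((2 : ℚ⟮b⟯) : K) = 2 := rfl
      push_cast
      rw [h1, h2, hb]
      ring

theorem int_of_finrank_one {K : Type*} [Field K] [NumberField K] (h : Module.finrank ℚ K = 1) (x : 𝓞 K) :
    ∃ m : ℤ, x = m := by
  have hb : (⊥ : IntermediateField ℚ K) = ⊤ := (IntermediateField.finrank_eq_one_iff.1 (by
    rw [IntermediateField.finrank_top', h])).symm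
  have hx : (algebraMap (𝓞 K) K x) ∈ (⊥ : IntermediateField ℚ K) := by rw [hb]; trivial
  obtain ⟨r, hr⟩ := IntermediateField.mem_bot.1 hx
  have hi : IsIntegral ℤ r := by
    rw [← isIntegral_algebraMap_iff (FaithfulSMul.algebraMap_injective ℚ K), hr]
    exact RingOfIntegers.isIntegral_coe x
  obtain ⟨m, hm⟩ := IsIntegrallyClosed.isIntegral_iff.1 hi
  refine ⟨m, ?_⟩
  apply RingOfIntegers.coe_injective
  rw [← hr, ← hm]
  simp

theorem odd_of_ker_le_one {G : Type*} [CommGroup G] [Finite G]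
    (h : Nat.card (powMonoidHom 2 : G →* G).ker ≤ 1) : Odd (Nat.card G) := by
  by_contra ho
  rw [Nat.not_odd_iff_even, even_iff_two_dvd] at ho
  have := Fact.mk Nat.prime_two
  obtain ⟨x, hx⟩ := exists_prime_orderOf_dvd_card' 2 ho
  have h1 := Finite.card_le_one_iff_subsingleton.1 h
  have h2 : x ∈ (powMonoidHom 2 : G →* G).ker := by
    rw [MonoidHom.mem_ker, powMonoidHom_apply, ← hx, pow_orderOf_eq_one]
  have h3 := congrArg Subtype.val (h1.elim ⟨x, h2⟩ 1)
  simp only [OneMemClass.coe_one] at h3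
  rw [h3, orderOf_one] at hx
  omega

theorem odd_of_pid {K : Type*} [Field K] [NumberField K] [IsPrincipalIdealRing (𝓞 K)] :
    Odd (Nat.card (ClassGroup (𝓞 K))) := by
  have : Nat.card (ClassGroup (𝓞 K)) = 1 :=
    (@Nat.card_eq_fintype_card _ (_)).trans card_classGroup_eq_one
  rw [this]
  exact odd_one

/-- absNorm of a principal ideal -/
theorem absNorm_of_norm {K : Type*} [Field K] [NumberField K] (x : 𝓞 K) (m : ℕ)
    (h : |Algebra.norm ℚ (algebraMap (𝓞 K) K x)| = m) : Ideal.absNorm (Ideal.span {x}) = m := by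
  rw [Ideal.absNorm_span_singleton]
  rw [← Algebra.coe_norm_int] at h
  have : |Algebra.norm ℤ x| = m := by exact_mod_cast h
  zify
  exact this

theorem eq_span_of_norm_two {K : Type*} [Field K] [NumberField K] (x : 𝓞 K)
    (h : |Algebra.norm ℚ (algebraMap (𝓞 K) K x)| = 2) (P : Ideal (𝓞 K)) (hP : P.IsPrime) (hx : x ∈ P) :
    P = Ideal.span {x} := by
  have h1 : Ideal.absNorm (Ideal.span {x}) = 2 := absNorm_of_norm x 2 (by exact_mod_cast h)
  have h2 : (Ideal.span {x}).IsPrime := Ideal.isPrime_of_irreducible_absNorm (by rw [h1]; exact Nat.prime_two)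
  have h3 : Ideal.span {x} ≠ ⊥ := by rintro h; rw [h] at h1; simp at h1
  have h4 := h2.isMaximal h3
  exact (h4.eq_of_le hP.ne_top (by rwa [Ideal.span_singleton_le_iff_mem])).symm

open IntermediateField NumberField
open scoped Pointwise
set_option linter.unusedSectionVars false

theorem rank_real {K : Type*} [Field K] [NumberField K] (h : RealF K) :
    Units.rank K + 1 = Module.finrank ℚ K := by
  have : IsTotallyReal K := ⟨fun v => by
    rw [InfinitePlace.isReal_iff, ComplexEmbedding.isReal_iff]
    ext x
    rw [ComplexEmbedding.conjugate_coe_eq]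
    exact Complex.conj_eq_iff_im.2 (h _ x)⟩
  have h1 := InfinitePlace.card_eq_nrRealPlaces_add_nrComplexPlaces K
  have h2 := IsTotallyReal.nrComplexPlaces_eq_zero K
  have h3 := InfinitePlace.card_add_two_mul_card_eq_rank K
  have h4 : 0 < Module.finrank ℚ K := Module.finrank_pos
  unfold Units.rank
  omega

theorem rank_complex {K : Type*} [Field K] [NumberField K] (i : K) (hi : i ^ 2 = -1) :
    2 * (Units.rank K + 1) = Module.finrank ℚ K := by
  have : IsTotallyComplex K := ⟨fun v => by
    rw [InfinitePlace.isComplex_iff, ComplexEmbedding.isReal_iff]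
    intro h
    have h1 := congrArg (fun f => f i) h
    simp only [ComplexEmbedding.conjugate_coe_eq] at h1
    rw [Complex.conj_eq_iff_im] at h1
    have h2 : (v.embedding i) ^ 2 = -1 := by rw [← map_pow, hi, map_neg, map_one]
    have h3 := congrArg Complex.re h2
    simp [sq, h1] at h3
    nlinarith [mul_self_nonneg (v.embedding i).re]⟩
  have h1 := InfinitePlace.card_eq_nrRealPlaces_add_nrComplexPlaces K
  have h2 := IsTotallyComplex.nrRealPlaces_eq_zero K
  have h3 := InfinitePlace.card_add_two_mul_card_eq_rank K
  have h4 : 0 < Module.finrank ℚ K := Module.finrank_pos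
  unfold Units.rank
  omega

theorem TT_step {n : ℕ} {K : Type*} [Field K] [NumberField K] {a b : K} (ha : TT n b) (hb : b = a ^ 2 - 2)
    (ht : ℚ⟮a⟯ = ⊤) (hf : Module.finrank ℚ K = 2 ^ (n + 1)) :
    Module.finrank ℚ ℚ⟮b⟯ = 2 ^ n ∧ Module.finrank ℚ⟮b⟯ K = 2 := by
  have h1 := TT_finrank_le n ℚ⟮b⟯ (AdjoinSimple.gen ℚ b) (TT_gen ha) (gen_top b)
  have h2 : Module.finrank ℚ⟮b⟯ K ≤ 2 := by
    refine finrank_le_two _ (adjoin_simple_mono _ ht) 0 (-2 - AdjoinSimple.gen ℚ b) ?_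
    have h1 : ((AdjoinSimple.gen ℚ b : ℚ⟮b⟯) : K) = b := rfl
    have h2 : ((2 : ℚ⟮b⟯) : K) = 2 := rfl
    push_cast
    rw [h1, h2, hb]
    ring
  have h3 := finrank_tower (M := K) (ℚ⟮b⟯)
  rw [hf, pow_succ] at h3
  have h4 : 0 < 2 ^ n := by positivity
  generalize Module.finrank ℚ ℚ⟮b⟯ = x at *
  generalize Module.finrank ℚ⟮b⟯ K = y at *
  have hy : y = 2 := by
    by_contra hne
    have : y ≤ 1 := by omega
    nlinarith
  subst hy
  exact ⟨by omega, rfl⟩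

theorem TT_RealF {n : ℕ} {K : Type*} [Field K] [NumberField K] {a : K} (ha : TT n a)
    (ht : ℚ⟮a⟯ = ⊤) : RealF K :=
  RealF_of_adjoin ht (by
    intro g x hx
    rw [Set.mem_singleton_iff] at hx
    subst hx
    obtain ⟨r, hr, _⟩ := TT_real n (TT_map g n ha)
    rw [hr]; simp)

open ComplexOrder in
theorem TT_main : ∀ (n : ℕ) (K : Type u) [Field K] [NumberField K] (a : K), TT n a → ℚ⟮a⟯ = ⊤ →
    Module.finrank ℚ K = 2 ^ n →
    Odd (Nat.card (ClassGroup (𝓞 K))) ∧ TPS K ∧ Algebra.norm ℚ (2 + a) = 2 ∧ Algebra.norm ℚ (2 - a) = 2 := by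
  intro n
  induction n with
  | zero =>
    intro K _ _ a ha ht hf
    rw [pow_zero] at hf
    have ha0 : a = 0 := ha
    have hn : Algebra.norm ℚ (2 : K) = 2 := by
      have := Algebra.norm_algebraMap (R := ℚ) (S := K) (2 : ℚ)
      rw [hf] at this
      simpa using this
    refine ⟨?_, ?_, by rw [ha0, add_zero, hn], by rw [ha0, sub_zero, hn]⟩
    · have : IsPrincipalIdealRing (𝓞 K) := IsPrincipalIdealRing.of_surjective (algebraMap ℤ (𝓞 K)) (by
        intro x
        obtain ⟨m, rfl⟩ := int_of_finrank_one hf x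
        exact ⟨m, by simp⟩)
      exact odd_of_pid
    · intro u hu
      obtain ⟨m, hm⟩ := int_of_finrank_one hf (u : 𝓞 K)
      obtain ⟨m', hm'⟩ := int_of_finrank_one hf ((u⁻¹ : (𝓞 K)ˣ) : 𝓞 K)
      have h1 : ((m * m' : ℤ) : 𝓞 K) = (1 : ℤ) := by
        push_cast; rw [← hm, ← hm', Units.mul_inv]
      have h2 : m * m' = 1 := by exact_mod_cast h1
      have hpos : 0 < m := by
        obtain ⟨g⟩ : Nonempty (K →+* ℂ) := inferInstance
        have := hu g
        rw [hm] at this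
        simpa using this
      have hm1 : m = 1 := Int.eq_one_or_neg_one_of_mul_eq_one h2 |>.resolve_right (by omega)
      refine ⟨1, ?_⟩
      ext
      rw [hm, hm1]
      simp
  | succ n ih =>
    intro K _ _ a ha ht hf
    obtain ⟨b, hb⟩ : ∃ b, b = a ^ 2 - 2 := ⟨_, rfl⟩
    have hb1 : TT n b := hb ▸ ha
    obtain ⟨f1, f2⟩ := TT_step hb1 hb ht hf
    let β := AdjoinSimple.gen ℚ b
    have hβ : algebraMap ℚ⟮b⟯ K β = b := AdjoinSimple.algebraMap_gen ℚ b
    have hTβ : TT n β := TT_gen hb1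
    obtain ⟨i1, i2, i3, i4⟩ := ih ℚ⟮b⟯ β hTβ (gen_top b) f1
    have hq : Algebra.IsQuadraticExtension ℚ⟮b⟯ K := ⟨f2⟩
    obtain ⟨σ, hσ, hσa⟩ := exists_conj_neg (K := ℚ⟮b⟯) a
      (notMem_of_finrank _ (adjoin_simple_mono _ ht) f2) (2 + β) (by rw [map_add, hβ, hb, map_ofNat]; ring)
    have hRK := TT_RealF (K := K) ha ht
    have hRF := TT_RealF hTβ (gen_top b)
    -- norms
    have n1 : ∀ x : K, x = 2 + a ∨ x = 2 - a → Algebra.norm ℚ x = 2 := by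
      intro x hx
      rw [← norm_tower ℚ⟮b⟯, ← i4]
      congr 1
      apply FaithfulSMul.algebraMap_injective ℚ⟮b⟯ K
      rw [qa_norm hσ, map_sub, hβ, map_ofNat]
      rcases hx with rfl | rfl
      · rw [map_add, hσa, map_ofNat]; linear_combination hb
      · rw [map_sub, hσa, map_ofNat]; linear_combination hb
    have n2 : |Algebra.norm ℚ a| = 2 := by
      have h1 : (Algebra.norm ℚ a) ^ 2 = 2 ^ 2 := by
        rw [← map_pow, show a ^ 2 = algebraMap ℚ⟮b⟯ K (2 + β) by
          rw [map_add, hβ, hb, map_ofNat]; ring, ← norm_tower ℚ⟮b⟯, Algebra.norm_algebraMap, f2, map_pow, i3]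
      rw [sq_eq_sq_iff_abs_eq_abs] at h1
      rw [h1]; norm_num
    -- integers
    let A : 𝓞 K := ⟨a, TT_integral _ ha⟩
    let B : 𝓞 ℚ⟮b⟯ := ⟨β, TT_integral _ hTβ⟩
    have hA : algebraMap (𝓞 K) K A = a := rfl
    have hB : algebraMap (𝓞 ℚ⟮b⟯) ℚ⟮b⟯ B = β := rfl
    have hTA : TT (n + 1) A := TT_of_map (algebraMap (𝓞 K) K) RingOfIntegers.coe_injective _ (by rw [hA]; exact ha)
    have hTB : TT n B := TT_of_map (algebraMap (𝓞 ℚ⟮b⟯) ℚ⟮b⟯) RingOfIntegers.coe_injective _ (by rw [hB]; exact hTβ)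
    have hram : ∀ P : Ideal (𝓞 K), RamP σ P → A ∈ P ∧ 2 ∈ P := by
      intro P hP
      have := hP.prime
      have h1 := hP.inertia A
      have h2 : σ • A - A = -(2 * A) := by
        apply RingOfIntegers.coe_injective
        rw [map_sub, coe_smul_int, hA, hσa, map_neg, map_mul, hA, map_ofNat]
        ring
      rw [h2, neg_mem_iff] at h1
      have hA2 : A ^ 2 = 2 + algebraMap (𝓞 ℚ⟮b⟯) (𝓞 K) B := by
        apply RingOfIntegers.coe_injective
        rw [map_pow, map_add, hA, map_ofNat]
        show a ^ 2 = 2 + algebraMap ℚ⟮b⟯ K β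
        rw [hβ, hb]; ring
      rcases this.mem_or_mem h1 with h2 | h2
      · exact ⟨TT_mem P h2 _ hTA, h2⟩
      · refine ⟨h2, ?_⟩
        -- `(A)` has norm two
        have h3 := eq_span_of_norm_two A n2 P this h2
        have h4 : Ideal.absNorm P = 2 := by
          rw [h3]; exact absNorm_of_norm A 2 (by exact_mod_cast n2)
        have := Ideal.absNorm_mem P
        rw [h4] at this
        exact_mod_cast this
    have hSP : ∀ P : Ideal (𝓞 K), RamP σ P → P = Ideal.span {A} := fun P hP =>
      eq_span_of_norm_two A n2 P hP.prime (hram P hP).1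
    have hodd : Odd (Nat.card (ClassGroup (𝓞 K))) := by
      apply odd_of_ker_le_one
      have := chevalley hσ i1 (by
        have := rank_real hRK
        have := rank_real hRF
        rw [hf] at *; rw [f1] at *
        rw [pow_succ] at *
        omega) {Ideal.span {A}} (by simpa using hSP) ⊤ (fun _ _ => trivial)
      simpa using this
    refine ⟨hodd, ?_, n1 _ (Or.inl rfl), n1 _ (Or.inr rfl)⟩
    intro u hu
    obtain ⟨c, hc, w, hw⟩ := lemU hσ i1 hRK i2 (Submonoid.powers (2 + B)) (by
        rintro c ⟨k, rfl⟩
        rw [map_pow, map_add, map_ofNat, hB]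
        exact (TT_pos hTβ).pow k) (by
        intro P hP
        have hpr := hP.prime
        refine ⟨2 + B, Submonoid.mem_powers _, ?_⟩
        apply eq_span_of_norm_two
        · rw [map_add, map_ofNat, hB, i3]; norm_num
        · infer_instance
        · apply Ideal.add_mem
          · rw [Ideal.mem_comap, map_ofNat]; exact (hram P hP).2
          · rw [Ideal.mem_comap]
            refine TT_mem P (hram P hP).2 n (TT_map _ _ hTB)) u hu
    obtain ⟨k, rfl⟩ := hc
    have hu2 : algebraMap (𝓞 K) K u = (a ^ k * w) ^ 2 := by
      rw [hw, map_pow, map_add, map_ofNat, hB, map_pow, map_add, hβ, map_ofNat, hb]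
      ring
    have hintg : IsIntegral ℤ (a ^ k * w) := IsIntegral.of_pow (n := 2) (by norm_num) (by
      rw [← hu2]; exact RingOfIntegers.isIntegral_coe _)
    obtain ⟨W, hW⟩ : ∃ W : 𝓞 K, algebraMap (𝓞 K) K W = a ^ k * w := ⟨⟨_, hintg⟩, rfl⟩
    have hu3 : (u : 𝓞 K) = W ^ 2 := RingOfIntegers.coe_injective (by
      rw [hu2, map_pow, hW])
    have hun : IsUnit W := (isUnit_pow_iff two_ne_zero).1 (hu3 ▸ u.isUnit)
    obtain ⟨v, hv⟩ := hun
    refine ⟨v, ?_⟩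
    apply Units.ext
    rw [hu3, ← hv, Units.val_pow_eq_pow_val]

open IntermediateField NumberField
open scoped Pointwise
set_option linter.unusedSectionVars false

theorem cyc_of_top {F M : Type*} [Field F] [Field M] [Algebra F M] [Algebra.IsIntegral F M] {ζ : M} {m : ℕ} [NeZero m]
    (hζ : IsPrimitiveRoot ζ m) (h : F⟮ζ⟯ = ⊤) : IsCyclotomicExtension {m} F M := by
  have h1 := hζ.intermediateField_adjoin_isCyclotomicExtension F
  have e : F⟮ζ⟯ ≃ₐ[F] M := (IntermediateField.equivOfEq h).trans IntermediateField.topEquiv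
  exact IsCyclotomicExtension.equiv {m} F F⟮ζ⟯ e

theorem prim_of_neg_one {M : Type*} [Field M] [CharZero M] {ζ : M} {n : ℕ} (h : ζ ^ (2 ^ n) = -1) :
    IsPrimitiveRoot ζ (2 ^ (n + 1)) := by
  have : Fact (Nat.Prime 2) := ⟨Nat.prime_two⟩
  have h2 : ζ ^ 2 ^ (n + 1) = 1 := by rw [pow_succ, pow_mul, h]; norm_num
  have h3 : ¬ ζ ^ 2 ^ n = 1 := by rw [h]; norm_num
  have := orderOf_eq_prime_pow h3 h2
  rw [← this]
  exact IsPrimitiveRoot.orderOf ζ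

theorem gauss_pid {K : Type*} [Field K] [NumberField K] {i : K} (hi : i ^ 2 = -1) (ht : ℚ⟮i⟯ = ⊤) :
    IsPrincipalIdealRing (𝓞 K) := by
  have h1 : IsPrimitiveRoot i (2 ^ (1 + 1)) := prim_of_neg_one (by simpa using hi)
  have : Fact (Nat.Prime 2) := ⟨Nat.prime_two⟩
  have hc : IsCyclotomicExtension {2 ^ (1 + 1)} ℚ K := cyc_of_top h1 ht
  have hf : Module.finrank ℚ K = 2 := by
    rw [IsCyclotomicExtension.finrank (n := 2 ^ (1 + 1)) K (Polynomial.cyclotomic.irreducible_rat (by simp))]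
    rw [Nat.totient_prime_pow Nat.prime_two (by norm_num)]; norm_num
  apply RingOfIntegers.isPrincipalIdealRing_of_abs_discr_lt
  rw [IsCyclotomicExtension.Rat.discr_prime_pow 2 (1 + 1) K, hf,
    IsCyclotomicExtension.Rat.nrComplexPlaces_eq_totient_div_two (2 ^ (1 + 1)) K,
    Nat.totient_prime_pow Nat.prime_two (by norm_num)]
  have h3 := Real.pi_gt_three
  norm_num [Nat.factorial]
  nlinarith

theorem ZZ_main : ∀ (n : ℕ) (K : Type u) [Field K] [NumberField K] (z : K), z ^ 2 ^ (n + 1) = -1 → ℚ⟮z⟯ = ⊤ →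
    Odd (Nat.card (ClassGroup (𝓞 K))) ∧ Module.finrank ℚ K = 2 ^ (n + 1) ∧ Algebra.norm ℚ (1 - z) = 2 := by
  intro n
  induction n with
  | zero =>
    intro K _ _ z hz ht
    have hz2 : z ^ 2 = -1 := by simpa using hz
    have := gauss_pid hz2 ht
    have h1 := prim_of_neg_one hz
    have hf : Module.finrank ℚ K = 2 := by
      have := cyc_of_top (F := ℚ) h1 ht
      rw [IsCyclotomicExtension.finrank (n := 2 ^ (0 + 1 + 1)) K (Polynomial.cyclotomic.irreducible_rat (by simp))]
      rw [Nat.totient_prime_pow Nat.prime_two (by norm_num)]; norm_num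
    refine ⟨odd_of_pid, by simpa using hf, ?_⟩
    have hq : Algebra.IsQuadraticExtension ℚ K := ⟨hf⟩
    obtain ⟨σ, hσ, hσa⟩ := exists_conj_neg (K := ℚ) z (by
      rintro y rfl
      rw [← map_pow] at hz2
      have h3 : y ^ 2 = -1 := (algebraMap ℚ K).injective (by simpa using hz2)
      nlinarith [sq_nonneg y]) (-1) (by simpa using hz2)
    apply (algebraMap ℚ K).injective
    rw [qa_norm hσ, map_sub, hσa, map_ofNat, map_one]
    linear_combination -hz2
  | succ n ih =>
    intro K _ _ z hz ht
    obtain ⟨b, hb⟩ : ∃ b, b = z ^ 2 := ⟨_, rfl⟩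
    have hb1 : b ^ 2 ^ (n + 1) = -1 := by
      rw [hb, ← pow_mul, ← hz, pow_succ 2 (n + 1), mul_comm]
    let β := AdjoinSimple.gen ℚ b
    have hβ : algebraMap ℚ⟮b⟯ K β = b := AdjoinSimple.algebraMap_gen ℚ b
    have hTβ : β ^ 2 ^ (n + 1) = -1 := FaithfulSMul.algebraMap_injective ℚ⟮b⟯ K (by
      rw [map_pow, hβ, hb1, map_neg, map_one])
    obtain ⟨i1, f1, i3⟩ := ih ℚ⟮b⟯ β hTβ (gen_top b)
    have hf : Module.finrank ℚ K = 2 ^ (n + 1 + 1) := by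
      have := cyc_of_top (F := ℚ) (prim_of_neg_one hz) ht
      rw [IsCyclotomicExtension.finrank (n := 2 ^ (n + 1 + 1 + 1)) K (Polynomial.cyclotomic.irreducible_rat (by simp))]
      rw [Nat.totient_prime_pow Nat.prime_two (by norm_num)]; simp
    have f2 : Module.finrank ℚ⟮b⟯ K = 2 := by
      have := finrank_tower (M := K) ℚ⟮b⟯
      rw [hf, f1, pow_succ 2 (n + 1)] at this
      exact Nat.eq_of_mul_eq_mul_left (by positivity) this
    have hq : Algebra.IsQuadraticExtension ℚ⟮b⟯ K := ⟨f2⟩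
    obtain ⟨σ, hσ, hσa⟩ := exists_conj_neg (K := ℚ⟮b⟯) z
      (notMem_of_finrank _ (adjoin_simple_mono _ ht) f2) β (by rw [hβ, hb])
    have n1 : Algebra.norm ℚ (1 - z) = 2 := by
      rw [← norm_tower ℚ⟮b⟯, ← i3]
      congr 1
      apply FaithfulSMul.algebraMap_injective ℚ⟮b⟯ K
      rw [qa_norm hσ, map_sub σ, hσa, map_one, map_sub, hβ, map_one]
      linear_combination hb
    obtain ⟨A, hA⟩ : ∃ A : 𝓞 K, algebraMap (𝓞 K) K A = z := ⟨⟨z, IsIntegral.of_pow (n := 2 ^ (n + 1 + 1)) (by positivity) (by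
      rw [hz]; exact isIntegral_one.neg)⟩, rfl⟩
    have hAu : A * A ^ (2 ^ (n + 1 + 1) - 1) = -1 := by
      rw [← pow_succ', Nat.sub_add_cancel Nat.one_le_two_pow]
      apply RingOfIntegers.coe_injective
      rw [map_pow, hA, hz, map_neg, map_one]
    have hA2 : A ^ 2 ^ (n + 1 + 1) = -1 := by
      apply RingOfIntegers.coe_injective
      rw [map_pow, hA, hz, map_neg, map_one]
    have hSP : ∀ P : Ideal (𝓞 K), RamP σ P → P = Ideal.span {1 - A} := by
      intro P hP
      have := hP.prime
      have h1 := hP.inertia A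
      have h2 : σ • A - A = -(2 * A) := by
        apply RingOfIntegers.coe_injective
        rw [map_sub, coe_smul_int, hA, hσa, map_neg, map_mul, hA, map_ofNat]
        ring
      rw [h2, neg_mem_iff] at h1
      have h3 : (2 : 𝓞 K) ∈ P := by
        rcases this.mem_or_mem h1 with h | h
        · exact h
        · exfalso
          have h4 := P.mul_mem_right (A ^ (2 ^ (n + 1 + 1) - 1)) h
          rw [hAu, neg_mem_iff] at h4
          exact this.ne_top ((Ideal.eq_top_iff_one _).2 h4)
      apply eq_span_of_norm_two _ _ P this
      · -- `(1 - A)^(2^N) ≡ 1 - A^(2^N) = 2`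
        have h4 : (1 - A) ^ 2 ^ (n + 1 + 1) ∈ P := by
          rw [← Ideal.Quotient.eq_zero_iff_mem] at h3 ⊢
          rw [map_ofNat] at h3
          have hch : CharP (𝓞 K ⧸ P) 2 := by
            have : Fact (Nat.Prime 2) := ⟨Nat.prime_two⟩
            exact CharTwo.of_one_ne_zero_of_two_eq_zero one_ne_zero h3
          have : Fact (Nat.Prime 2) := ⟨Nat.prime_two⟩
          rw [map_pow, map_sub, sub_pow_char_pow, ← map_pow _ A, hA2, map_one, one_pow, map_neg, map_one]
          rw [sub_neg_eq_add]
          linear_combination h3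
        exact this.mem_of_pow_mem _ h4
      · rw [map_sub, map_one, hA, n1]; norm_num
    refine ⟨?_, hf, n1⟩
    apply odd_of_ker_le_one
    obtain ⟨i, hi⟩ : ∃ i : K, i ^ 2 = -1 := ⟨z ^ 2 ^ (n + 1), by rw [← pow_mul, ← pow_succ, hz]⟩
    obtain ⟨j, hj⟩ : ∃ i : ℚ⟮b⟯, i ^ 2 = -1 := ⟨β ^ 2 ^ n, by rw [← pow_mul, ← pow_succ, hTβ]⟩
    have := chevalley hσ i1 (by
      have := rank_complex i hi
      have := rank_complex j hj
      rw [hf] at *; rw [f1] at *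
      rw [pow_succ] at *
      omega) {Ideal.span {1 - A}} (by simpa using hSP) ⊤ (fun _ _ => trivial)
    simpa using this

open IntermediateField NumberField
open scoped Pointwise
set_option linter.unusedSectionVars false

theorem frob_cyc {K : Type*} [Field K] [NumberField K] {m : ℕ} [NeZero m] [IsCyclotomicExtension {m} ℚ K]
    (p : ℕ) (hp : p.Prime) (hpm : p.Coprime m) (x : 𝓞 K) :
    x ^ p ^ m.totient - x ∈ Ideal.span {(p : 𝓞 K)} := by
  have hζ := IsCyclotomicExtension.zeta_spec m ℚ K
  have htop := IsCyclotomicExtension.Rat.adjoin_singleton_eq_top (K := K) (n := m) hζ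
  have hx : x ∈ Algebra.adjoin ℤ {hζ.toInteger} := by rw [htop]; trivial
  have := Fact.mk hp
  have hne : Nontrivial (𝓞 K ⧸ Ideal.span {(p : 𝓞 K)}) := by
    apply Ideal.Quotient.nontrivial_iff.2
    rw [Ne, Ideal.span_singleton_eq_top]
    intro h
    have h1 := (Nat.Prime.one_lt hp).ne'
    have h2 : Ideal.absNorm (Ideal.span {(p : 𝓞 K)}) = 1 := by
      rw [Ideal.span_singleton_eq_top.2 h]; exact Ideal.absNorm_top
    rw [Ideal.absNorm_span_natCast] at h2
    rw [Nat.pow_eq_one] at h2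
    rcases h2 with h2 | h2
    · exact h1 h2
    · have : 0 < Module.finrank ℤ (𝓞 K) := Module.finrank_pos
      omega
  have hch : CharP (𝓞 K ⧸ Ideal.span {(p : 𝓞 K)}) p := by
    refine (CharP.charP_iff_prime_eq_zero hp).2 ?_
    rw [← map_natCast (Ideal.Quotient.mk _), Ideal.Quotient.eq_zero_iff_mem]
    exact Ideal.mem_span_singleton_self _
  rw [← Ideal.Quotient.eq_zero_iff_mem, map_sub, map_pow, sub_eq_zero]
  induction hx using Algebra.adjoin_induction with
  | mem y hy =>
    rw [Set.mem_singleton_iff] at hy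
    rw [hy, ← map_pow]
    congr 1
    have h1 := Nat.ModEq.pow_totient hpm
    have h2 : hζ.toInteger ^ m = 1 := hζ.toInteger_isPrimitiveRoot.pow_eq_one
    rw [← pow_mod_orderOf]
    conv_rhs => rw [← pow_one hζ.toInteger, ← pow_mod_orderOf]
    rw [← hζ.toInteger_isPrimitiveRoot.eq_orderOf, h1]
  | algebraMap r =>
    rw [eq_intCast, map_intCast]
    rw [← iterateFrobenius_def, map_intCast]
  | add x y _ _ hx hy =>
    rw [map_add, add_pow_char_pow, hx, hy]
  | mul x y _ _ hx hy =>
    rw [map_mul, mul_pow, hx, hy]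

theorem PQ.sqrt_not_cyc {p q : ℕ} (h : PQ p q) {K : Type*} [Field K] [NumberField K] {m : ℕ}
    [IsCyclotomicExtension {2 ^ m} ℚ K] (s : K) : s ^ 2 ≠ p * q := by
  intro hs
  obtain ⟨S, hS⟩ : ∃ A : 𝓞 K, algebraMap (𝓞 K) K A = s := ⟨⟨s, IsIntegral.of_pow (n := 2) (by positivity) (by
      rw [hs]; exact_mod_cast isIntegral_algebraMap (R := ℤ) (x := ((p * q : ℕ) : ℤ)))⟩, rfl⟩
  have h2 : S ^ 2 = p * q := RingOfIntegers.coe_injective (by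
    rw [map_pow, hS, hs, map_mul, map_natCast, map_natCast])
  have hp2 : 2 ≤ p := h.hp.two_le
  have hcop : p.Coprime (2 ^ m) := by
    apply Nat.Coprime.pow_right
    rw [Nat.coprime_two_right, Nat.odd_iff]
    have := h.hp8; omega
  have h3 := frob_cyc (K := K) p h.hp hcop S
  have hN : 2 ≤ p ^ (2 ^ m).totient := by
    have : 0 < (2 ^ m).totient := Nat.totient_pos.2 (by positivity)
    calc 2 ≤ p := hp2
      _ = p ^ 1 := (pow_one p).symm
      _ ≤ _ := Nat.pow_le_pow_right (by omega) this
  have h4 : S ^ p ^ (2 ^ m).totient ∈ Ideal.span {(p : 𝓞 K)} := by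
    obtain ⟨k, hk⟩ := Nat.exists_eq_add_of_le hN
    rw [hk, pow_add, h2, Ideal.mem_span_singleton]
    exact ⟨q * S ^ k, by ring⟩
  have h5 : S ∈ Ideal.span {(p : 𝓞 K)} := by
    have := Ideal.sub_mem _ h4 h3
    simpa using this
  obtain ⟨y, hy⟩ := Ideal.mem_span_singleton.1 h5
  have hp0 : (p : 𝓞 K) ≠ 0 := by exact_mod_cast h.hp.ne_zero
  have h6 : (q : 𝓞 K) = p * y ^ 2 := by
    apply mul_left_cancel₀ hp0
    rw [← h2, hy]; ring
  have h7 := congrArg (Algebra.norm ℤ) h6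
  have h8 : (p : ℤ) ∣ (q : ℤ) ^ Module.finrank ℤ (𝓞 K) := by
    have e1 : Algebra.norm ℤ (q : 𝓞 K) = (q : ℤ) ^ Module.finrank ℤ (𝓞 K) := by
      have := Algebra.norm_algebraMap (R := ℤ) (S := 𝓞 K) (q : ℤ)
      simpa using this
    have e2 : Algebra.norm ℤ (p : 𝓞 K) = (p : ℤ) ^ Module.finrank ℤ (𝓞 K) := by
      have := Algebra.norm_algebraMap (R := ℤ) (S := 𝓞 K) (p : ℤ)
      simpa using this
    rw [← e1, h7, map_mul, e2]
    exact Dvd.dvd.mul_right (dvd_pow_self _ Module.finrank_pos.ne') _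
  exact h.p_not_dvd (Int.Prime.dvd_pow' h.hp h8)

open IntermediateField NumberField
open scoped Pointwise
set_option linter.unusedSectionVars false

theorem gen_top2 {M : Type*} [Field M] [NumberField M] (E : IntermediateField ℚ M) (a b : M)
    (hE : E = IntermediateField.adjoin ℚ {a, b}) :
    ∃ x y : E, algebraMap E M x = a ∧ algebraMap E M y = b ∧ IntermediateField.adjoin ℚ {x, y} = ⊤ := by
  have ha : a ∈ E := by rw [hE]; exact IntermediateField.subset_adjoin _ _ (by simp)
  have hb : b ∈ E := by rw [hE]; exact IntermediateField.subset_adjoin _ _ (by simp)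
  refine ⟨⟨a, ha⟩, ⟨b, hb⟩, rfl, rfl, ?_⟩
  have key : ∀ A : Algebra ℚ E, A = E.algebra' →
      @IntermediateField.adjoin ℚ _ E _ A {⟨a, ha⟩, ⟨b, hb⟩} = ⊤ := by
    rintro A rfl
    apply IntermediateField.map_injective E.val
    rw [IntermediateField.adjoin_map, ← AlgHom.fieldRange_eq_map]
    simp [Set.image_insert_eq, hE]
  exact key _ (Subsingleton.elim _ _)

structure Setup (p q n : ℕ) {L : Type*} [Field L] [NumberField L] (ζ s : L) : Prop where
  pq : PQ p q
  hn : 1 ≤ n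
  hζ : ζ ^ 2 ^ (n + 1) = -1
  hs : s ^ 2 = p * q
  top : IntermediateField.adjoin ℚ {ζ, s} = ⊤

theorem TT_of_ZZ {R : Type*} [Field R] : ∀ (n : ℕ) {z : R}, z ^ 2 ^ (n + 1) = -1 → TT n (z + z⁻¹)
  | 0, z, h => by
    show z + z⁻¹ = 0
    have h0 : z ≠ 0 := by rintro rfl; simp at h
    field_simp
    have : z ^ 2 = -1 := by simpa using h
    rw [this]; ring
  | n + 1, z, h => by
    have h0 : z ≠ 0 := by rintro rfl; simp at h
    show TT n ((z + z⁻¹) ^ 2 - 2)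
    have := TT_of_ZZ n (z := z ^ 2) (by rw [← pow_mul, ← h, ← pow_succ'])
    convert this using 1
    field_simp
    ring

variable {p q n : ℕ} {L : Type*} [Field L] [NumberField L] {ζ s : L}

theorem gen_ZZ {m : ℕ} (h : ζ ^ m = -1) : (AdjoinSimple.gen ℚ ζ) ^ m = -1 := by
  apply FaithfulSMul.algebraMap_injective ℚ⟮ζ⟯ L
  rw [map_pow, AdjoinSimple.algebraMap_gen, h, map_neg, map_one]

namespace Setup
variable (S : Setup p q n ζ s)

theorem ζ0 (S : Setup p q n ζ s) : ζ ≠ 0 := by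
  rintro rfl; have := S.hζ; simp at this

theorem Ktop (S : Setup p q n ζ s) : ℚ⟮ζ⟯⟮s⟯ = ⊤ :=
  adjoin_top_mono _ S.top (by
    rintro x (rfl | hx)
    · exact IntermediateField.algebraMap_mem ℚ⟮x⟯⟮s⟯ (AdjoinSimple.gen ℚ x)
    · rw [Set.mem_singleton_iff] at hx
      rw [hx]
      exact IntermediateField.mem_adjoin_simple_self _ s)

theorem finK (S : Setup p q n ζ s) : Module.finrank ℚ ℚ⟮ζ⟯ = 2 ^ (n + 1) :=
  (ZZ_main n ℚ⟮ζ⟯ _ (gen_ZZ S.hζ) (gen_top ζ)).2.1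

theorem oddK (S : Setup p q n ζ s) : Odd (Nat.card (ClassGroup (𝓞 ℚ⟮ζ⟯))) :=
  (ZZ_main n ℚ⟮ζ⟯ _ (gen_ZZ S.hζ) (gen_top ζ)).1

theorem s_notin (S : Setup p q n ζ s) (y : ℚ⟮ζ⟯) : algebraMap ℚ⟮ζ⟯ L y ≠ s := by
  intro h
  have := cyc_of_top (F := ℚ) (prim_of_neg_one (gen_ZZ S.hζ)) (gen_top ζ)
  apply S.pq.sqrt_not_cyc (m := n + 1 + 1) y
  apply FaithfulSMul.algebraMap_injective ℚ⟮ζ⟯ L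
  rw [map_pow, h, S.hs, map_mul, map_natCast, map_natCast]

theorem finKL (S : Setup p q n ζ s) : Module.finrank ℚ⟮ζ⟯ L = 2 := by
  have h1 : Module.finrank ℚ⟮ζ⟯ L ≤ 2 := finrank_le_two _ S.Ktop 0 (-(p * q)) (by
    push_cast
    rw [S.hs]; ring)
  have h2 : 0 < Module.finrank ℚ⟮ζ⟯ L := Module.finrank_pos
  have h3 : Module.finrank ℚ⟮ζ⟯ L ≠ 1 := by
    intro h
    have hb := IntermediateField.finrank_eq_one_iff.1 (show Module.finrank ℚ⟮ζ⟯ (⊤ : IntermediateField ℚ⟮ζ⟯ L) = 1 by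
      rw [IntermediateField.finrank_top']; exact h)
    have hx : s ∈ (⊥ : IntermediateField ℚ⟮ζ⟯ L) := by rw [← hb]; trivial
    obtain ⟨r, hr⟩ := IntermediateField.mem_bot.1 hx
    exact S.s_notin r hr
  omega

theorem fin (S : Setup p q n ζ s) : Module.finrank ℚ L = 2 ^ (n + 2) := by
  rw [← finrank_tower ℚ⟮ζ⟯, S.finK, S.finKL, ← pow_succ]

theorem no_root (S : Setup p q n ζ s) (w : L) : w ^ 2 ^ (n + 2) ≠ -1 := by
  intro h
  have h1 := (ZZ_main (n + 1) ℚ⟮w⟯ _ (gen_ZZ h) (gen_top w)).2.1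
  have h2 : ℚ⟮w⟯ = ⊤ := by
    apply IntermediateField.eq_of_le_of_finrank_le' le_top
    have := finrank_tower (M := L) ℚ⟮w⟯
    rw [S.fin, h1] at this
    have h3 : Module.finrank ℚ⟮w⟯ L = 1 := Nat.eq_of_mul_eq_mul_left (by positivity : 0 < 2 ^ (n + 2)) (by rw [mul_one]; exact this)
    rw [h3]
    exact Module.finrank_pos
  have := cyc_of_top (F := ℚ) (prim_of_neg_one h) h2
  exact S.pq.sqrt_not_cyc (m := n + 2 + 1) s S.hs

theorem prim (S : Setup p q n ζ s) : IsPrimitiveRoot ζ (2 ^ (n + 2)) := prim_of_neg_one S.hζ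

theorem sz_top (S : Setup p q n ζ s) : ℚ⟮s⟯⟮ζ⟯ = ⊤ :=
  adjoin_top_mono _ S.top (by
    rintro x (rfl | hx)
    · exact IntermediateField.mem_adjoin_simple_self _ x
    · rw [Set.mem_singleton_iff] at hx
      rw [hx]
      exact IntermediateField.algebraMap_mem ℚ⟮s⟯⟮ζ⟯ (AdjoinSimple.gen ℚ s))

theorem fins (S : Setup p q n ζ s) : 2 ^ (n + 1) ≤ Module.finrank ℚ⟮s⟯ L := by
  have h1 : Module.finrank ℚ ℚ⟮s⟯ ≤ 2 := by
    rw [IntermediateField.adjoin.finrank (IsIntegral.of_finite ℚ s)]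
    let f : Polynomial ℚ := Polynomial.X ^ 2 - Polynomial.C (p * q : ℚ)
    have hf : f.natDegree = 2 := Polynomial.natDegree_X_pow_sub_C
    rw [← hf]
    apply Polynomial.natDegree_le_of_dvd
    · apply minpoly.dvd
      simp [f, S.hs]
    · intro h; rw [h] at hf; simp at hf
  have h2 := finrank_tower (M := L) ℚ⟮s⟯
  rw [S.fin, show n + 2 = (n + 1) + 1 by rfl, pow_succ] at h2
  nlinarith

theorem aut (S : Setup p q n ζ s) (a : ℕ) (ha : Odd a) : ∃ g : Gal(L/ℚ), g ζ = ζ ^ a ∧ g s = s := by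
  have hc : IsCyclotomicExtension {2 ^ (n + 2)} ℚ⟮s⟯ L := cyc_of_top S.prim S.sz_top
  have hg : IsGalois ℚ⟮s⟯ L := IsCyclotomicExtension.isGalois {2 ^ (n + 2)} ℚ⟮s⟯ L
  have hi : IsIntegral ℚ⟮s⟯ ζ := IsIntegral.of_finite _ _
  have hd : (minpoly ℚ⟮s⟯ ζ).natDegree = Module.finrank ℚ⟮s⟯ L := by
    rw [← IntermediateField.adjoin.finrank hi, S.sz_top, IntermediateField.finrank_top']
  let f : Polynomial ℚ⟮s⟯ := Polynomial.X ^ 2 ^ (n + 1) - Polynomial.C (-1)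
  have hf : f.natDegree = 2 ^ (n + 1) := Polynomial.natDegree_X_pow_sub_C
  have hfm : f.Monic := Polynomial.monic_X_pow_sub_C _ (by positivity)
  have hm : minpoly ℚ⟮s⟯ ζ = f := by
    apply Polynomial.eq_of_dvd_of_natDegree_le_of_leadingCoeff
    · apply minpoly.dvd; simp [f, S.hζ]
    · rw [hf, hd]; exact S.fins
    · rw [hfm.leadingCoeff, (minpoly.monic hi).leadingCoeff]
  obtain ⟨g, hg⟩ := minpoly.exists_algEquiv_of_root' (K := ℚ⟮s⟯) (x := ζ ^ a) hi.isAlgebraic (by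
    rw [hm]
    simp only [f, map_sub, map_pow, Polynomial.aeval_X, map_neg, map_one]
    rw [← pow_mul, mul_comm, pow_mul, S.hζ, ha.neg_one_pow]; ring)
  refine ⟨AlgEquiv.ofRingEquiv (f := (g : L ≃+* L)) (fun x => by simp), hg, ?_⟩
  have := g.commutes (AdjoinSimple.gen ℚ s)
  rwa [AdjoinSimple.algebraMap_gen] at this

end Setup

open IntermediateField NumberField
open scoped Pointwise
set_option linter.unusedSectionVars false

theorem finrank_sqrt {M : Type*} [Field M] [NumberField M] (s : M) (c : ℚ) (hs : s ^ 2 = algebraMap ℚ M c)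
    (hc : ∀ r : ℚ, r ^ 2 ≠ c) : Module.finrank ℚ ℚ⟮s⟯ = 2 := by
  have h1 : Module.finrank ℚ ℚ⟮s⟯ ≤ 2 := by
    rw [IntermediateField.adjoin.finrank (IsIntegral.of_finite ℚ s)]
    let f : Polynomial ℚ := Polynomial.X ^ 2 - Polynomial.C c
    have hf : f.natDegree = 2 := Polynomial.natDegree_X_pow_sub_C
    rw [← hf]
    apply Polynomial.natDegree_le_of_dvd
    · apply minpoly.dvd
      simp [f, hs]
    · intro h; rw [h] at hf; simp at hf
  have h2 : 0 < Module.finrank ℚ ℚ⟮s⟯ := Module.finrank_pos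
  have h3 : Module.finrank ℚ ℚ⟮s⟯ ≠ 1 := by
    intro h
    rw [IntermediateField.finrank_eq_one_iff, IntermediateField.adjoin_simple_eq_bot_iff,
      IntermediateField.mem_bot] at h
    obtain ⟨r, hr⟩ := h
    apply hc r
    apply (algebraMap ℚ M).injective
    rw [← hs, ← hr, map_pow]
  omega

/-- elements of a quadratic field -/
theorem quad_elt {Q : Type*} [Field Q] [NumberField Q] [Algebra.IsQuadraticExtension ℚ Q]
    {σ : Gal(Q/ℚ)} (hσ : σ ≠ 1) (t : Q) (ht0 : t ≠ 0) (ht : σ t = -t) (y : Q) :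
    ∃ X Y : ℚ, y = algebraMap ℚ Q X + algebraMap ℚ Q Y * t := by
  obtain ⟨A, hA⟩ := qa_fixed hσ (x := (y + σ y) / 2) (by
    rw [map_div₀, map_add, qa_invol hσ, map_ofNat, add_comm])
  obtain ⟨B, hB⟩ := qa_fixed hσ (x := (y - σ y) / (2 * t)) (by
    rw [map_div₀, map_sub, qa_invol hσ, map_mul, ht, map_ofNat]; field_simp; ring)
  refine ⟨A, B, ?_⟩
  rw [hA, hB]; field_simp; ring

theorem NF {M : Type*} [Field M] [NumberField M] (s : M) (c : ℚ) (hs : s ^ 2 = algebraMap ℚ M c)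
    (hc : ∀ r : ℚ, r ^ 2 ≠ c) (w : M) : ∃ X Y : ℚ, Algebra.norm ℚ w = X ^ 2 - c * Y ^ 2 := by
  have h2 := finrank_sqrt s c hs hc
  have hq : Algebra.IsQuadraticExtension ℚ ℚ⟮s⟯ := ⟨h2⟩
  let t := AdjoinSimple.gen ℚ s
  have hts : t ^ 2 = algebraMap ℚ ℚ⟮s⟯ c := FaithfulSMul.algebraMap_injective ℚ⟮s⟯ M (by
    rw [map_pow, AdjoinSimple.algebraMap_gen, hs, ← IsScalarTower.algebraMap_apply])
  obtain ⟨σ, hσ, ht⟩ := exists_conj_neg (K := ℚ) t (by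
    intro r hr
    apply hc r
    apply (algebraMap ℚ ℚ⟮s⟯).injective
    rw [← hts, ← hr, map_pow]) c hts
  have ht0 : t ≠ 0 := by
    intro h
    rw [h] at hts
    apply hc 0
    apply (algebraMap ℚ ℚ⟮s⟯).injective
    rw [← hts]; simp
  obtain ⟨X, Y, hXY⟩ := quad_elt hσ t ht0 ht (Algebra.norm ℚ⟮s⟯ w)
  refine ⟨X, Y, ?_⟩
  rw [← norm_tower ℚ⟮s⟯]
  apply (algebraMap ℚ ℚ⟮s⟯).injective
  rw [qa_norm hσ, hXY, map_add, map_mul, ht, AlgEquiv.commutes, AlgEquiv.commutes, map_sub, map_pow, map_mul,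
    map_pow, ← hts]
  ring

theorem pow_mod8 {l : ℕ} (hl : l % 8 = 3 ∨ l % 8 = 5) (g : ℕ) :
    (Even g → l ^ g % 8 = 1) ∧ (Odd g → l ^ g % 8 = 3 ∨ l ^ g % 8 = 5) ∧ (Odd g → l ^ (2 * g) % 16 = 9) := by
  have h2 : l ^ 2 % 8 = 1 := by rcases hl with h | h <;> simp [Nat.pow_mod, h]
  have e : ∀ k, l ^ (2 * k) % 8 = 1 := fun k => by rw [pow_mul, Nat.pow_mod, h2]; simp
  refine ⟨?_, ?_, ?_⟩
  · rintro ⟨k, rfl⟩; rw [← two_mul]; exact e k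
  · rintro ⟨k, rfl⟩; rw [pow_succ, Nat.mul_mod, e k]
    simpa using hl
  · rintro ⟨k, rfl⟩
    have h9 : l ^ 2 % 16 = 9 := by
      have : l % 16 = 3 ∨ l % 16 = 11 ∨ l % 16 = 5 ∨ l % 16 = 13 := by omega
      rcases this with h | h | h | h <;> simp [Nat.pow_mod, h]
    rw [pow_mul, pow_succ, pow_mul, Nat.mul_mod, h9, Nat.pow_mod]
    simp [Nat.pow_mod, h9]

theorem ord_minus {l : ℕ} (hl : l % 8 = 3 ∨ l % 8 = 5) : ∀ (n : ℕ) (f : ℕ), 1 ≤ n →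
    2 ^ (n + 2) ∣ l ^ f - 1 → 2 ^ n ∣ f := by
  intro n
  induction n with
  | zero => intro f h; omega
  | succ n ih =>
    intro f _ h
    have hl0 : 0 < l := by omega
    have hpos : ∀ g, 0 < l ^ g := fun g => pow_pos hl0 g
    have h8 : 8 ∣ l ^ f - 1 := dvd_trans ⟨2 ^ n, by ring⟩ h
    have hf : Even f := by
      by_contra ho
      rw [Nat.not_even_iff_odd] at ho
      have := (pow_mod8 hl f).2.1 ho
      have := hpos f
      omega
    obtain ⟨g, hg⟩ := hf
    rw [← two_mul] at hg
    rcases Nat.eq_zero_or_pos n with h0 | h0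
    · subst h0; rw [hg]; simp
    have hge : Even g := by
      by_contra ho
      rw [Nat.not_even_iff_odd] at ho
      have h1 := (pow_mod8 hl g).2.2 ho
      rw [← hg] at h1
      have h16 : 16 ∣ l ^ f - 1 := dvd_trans ⟨2 ^ (n - 1), by
        obtain ⟨m, rfl⟩ : ∃ m, n = m + 1 := ⟨n - 1, by omega⟩
        simp only [Nat.add_sub_cancel]; ring⟩ h
      have := hpos f
      omega
    have h1 := (pow_mod8 hl g).1 hge
    have h3 : l ^ f - 1 = (l ^ g - 1) * (2 * ((l ^ g + 1) / 2)) := by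
      have : 2 * ((l ^ g + 1) / 2) = l ^ g + 1 := by omega
      rw [this, hg, mul_comm 2 g, pow_mul, mul_comm]
      exact Nat.sq_sub_sq (l ^ g) 1
    rw [h3, pow_succ 2 (n + 1 + 1), show (l ^ g - 1) * (2 * ((l ^ g + 1) / 2)) = ((l ^ g - 1) * ((l ^ g + 1) / 2)) * 2 by ring] at h
    have h4 := Nat.dvd_of_mul_dvd_mul_right (by norm_num) h
    have h5 : 2 ^ (n + 2) ∣ l ^ g - 1 := by
      refine Nat.Coprime.dvd_of_dvd_mul_right ?_ h4
      apply Nat.Coprime.pow_left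
      rw [Nat.coprime_two_left]
      rw [Nat.odd_iff]; omega
    rw [hg, pow_succ']
    exact Nat.mul_dvd_mul_left 2 (ih g h0 h5)

theorem ord_lemma {l : ℕ} (hl : l % 8 = 3 ∨ l % 8 = 5) {n : ℕ} (hn : 1 ≤ n) (f : ℕ)
    (h : 2 ^ (n + 2) ∣ l ^ f - 1 ∨ 2 ^ (n + 2) ∣ l ^ f + 1) : 2 ^ n ∣ f := by
  rcases h with h | h
  · exact ord_minus hl n f hn h
  · exfalso
    have h8 : 8 ∣ l ^ f + 1 := dvd_trans ⟨2 ^ (n - 1), by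
      obtain ⟨m, rfl⟩ : ∃ m, n = m + 1 := ⟨n - 1, by omega⟩
      simp only [Nat.add_sub_cancel]; ring⟩ h
    have := pow_mod8 hl f
    rcases Nat.even_or_odd f with he | he
    · have := this.1 he; omega
    · have := this.2.1 he; omega

theorem ZZ_of_TT {R : Type*} [Field R] : ∀ (n : ℕ) {z : R}, z ≠ 0 → TT n (z + z⁻¹) → z ^ 2 ^ (n + 1) = -1
  | 0, z, h0, h => by
    have h : z + z⁻¹ = 0 := h
    field_simp at h
    linear_combination h
  | n + 1, z, h0, h => by
    have h1 : TT n ((z + z⁻¹) ^ 2 - 2) := h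
    have := ZZ_of_TT n (z := z ^ 2) (by positivity) (by
      convert h1 using 1
      field_simp
      ring)
    rw [← this, ← pow_mul, ← pow_succ']

theorem res_big {K : Type*} [Field K] [NumberField K] {n : ℕ} (hn : 1 ≤ n) {a : 𝓞 K} (ha : TT n a)
    {l : ℕ} (hlp : l.Prime) (hl : l % 8 = 3 ∨ l % 8 = 5) (P : Ideal (𝓞 K)) (hP : P.IsPrime) (hlP : (l : 𝓞 K) ∈ P) :
    l ^ 2 ^ n ≤ Ideal.absNorm P := by
  have hPb : P ≠ ⊥ := by
    rintro rfl
    rw [Ideal.mem_bot] at hlP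
    exact hlp.ne_zero (by exact_mod_cast hlP)
  have hPm : P.IsMaximal := hP.isMaximal hPb
  have := Fact.mk hlp
  let _ := Ideal.Quotient.field P
  have hfin : Finite (𝓞 K ⧸ P) := Ideal.finiteQuotientOfFreeOfNeBot P hPb
  let _ := Fintype.ofFinite (𝓞 K ⧸ P)
  have hch : CharP (𝓞 K ⧸ P) l := by
    refine (CharP.charP_iff_prime_eq_zero hlp).2 ?_
    rw [← map_natCast (Ideal.Quotient.mk _), Ideal.Quotient.eq_zero_iff_mem]
    exact hlP
  obtain ⟨f, _, hf⟩ := FiniteField.card (𝓞 K ⧸ P) l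
  have hN : Ideal.absNorm P = l ^ (f : ℕ) := by
    rw [← hf, Ideal.absNorm_apply, Submodule.cardQuot_apply, Nat.card_eq_fintype_card]
  let E := AlgebraicClosure (𝓞 K ⧸ P)
  let g : 𝓞 K →+* E := (algebraMap (𝓞 K ⧸ P) E).comp (Ideal.Quotient.mk P)
  have hchE : CharP E l := charP_of_injective_algebraMap (algebraMap (𝓞 K ⧸ P) E).injective l
  obtain ⟨z, hz⟩ := IsAlgClosed.exists_root (Polynomial.X ^ 2 - Polynomial.C (g a) * Polynomial.X + 1 : Polynomial E) (by
    have : (Polynomial.X ^ 2 - Polynomial.C (g a) * Polynomial.X + 1 : Polynomial E).degree = 2 := by compute_degree!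
    rw [this]; norm_num)
  have hz2 : z ^ 2 - g a * z + 1 = 0 := by simpa [Polynomial.IsRoot] using hz
  have hz0 : z ≠ 0 := by rintro rfl; simp at hz2
  have hza : z + z⁻¹ = g a := by
    have h1 : z * z⁻¹ = 1 := mul_inv_cancel₀ hz0
    apply mul_left_cancel₀ hz0
    linear_combination hz2 + h1
  have hzz : z ^ 2 ^ (n + 1) = -1 := ZZ_of_TT n hz0 (by rw [hza]; exact TT_map g n ha)
  have h2 : (2 : E) ≠ 0 := by
    intro h
    have h3 : ((2 : ℕ) : E) = 0 := by exact_mod_cast h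
    rw [CharP.cast_eq_zero_iff E l] at h3
    have := Nat.le_of_dvd (by norm_num) h3
    omega
  have hord : orderOf z = 2 ^ (n + 1 + 1) := by
    have : Fact (Nat.Prime 2) := ⟨Nat.prime_two⟩
    apply orderOf_eq_prime_pow
    · rw [hzz]; intro h; apply h2; linear_combination -h
    · rw [pow_succ, pow_mul, hzz]; norm_num
  have hfr : (g a) ^ l ^ (f : ℕ) = g a := by
    show (algebraMap (𝓞 K ⧸ P) E _) ^ _ = _
    rw [← map_pow]
    show _ = (algebraMap (𝓞 K ⧸ P) E _)
    congr 1
    rw [← hf]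
    exact FiniteField.pow_card _
  have h4 : (z ^ l ^ (f : ℕ)) ^ 2 - g a * z ^ l ^ (f : ℕ) + 1 = 0 := by
    have h5 : (z ^ 2 - g a * z + 1) ^ l ^ (f : ℕ) = 0 ^ l ^ (f : ℕ) := by rw [hz2]
    rw [add_pow_char_pow, sub_pow_char_pow, mul_pow, hfr, one_pow, zero_pow (by have := hlp.pos; positivity)] at h5
    rw [← h5]; ring
  have h5 : (z ^ l ^ (f : ℕ) - z) * (z ^ l ^ (f : ℕ) * z - 1) = 0 := by
    linear_combination z * h4 - (z ^ l ^ (f : ℕ)) * hz2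
  have h6 : 2 ^ n ∣ (f : ℕ) := by
    apply ord_lemma hl hn
    rcases mul_eq_zero.1 h5 with h | h
    · left
      have hle : 1 ≤ l ^ (f : ℕ) := Nat.one_le_pow _ _ hlp.pos
      rw [← show n + 1 + 1 = n + 2 by rfl, ← hord, orderOf_dvd_iff_pow_eq_one]
      apply mul_right_cancel₀ hz0
      rw [← pow_succ, Nat.sub_add_cancel hle, one_mul]
      exact sub_eq_zero.1 h
    · right
      rw [← show n + 1 + 1 = n + 2 by rfl, ← hord, orderOf_dvd_iff_pow_eq_one, pow_succ]
      exact sub_eq_zero.1 h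
  rw [hN]
  exact Nat.pow_le_pow_right hlp.pos (Nat.le_of_dvd f.pos h6)

open IntermediateField NumberField
open scoped Pointwise
set_option linter.unusedSectionVars false

theorem eq_span_of_big {K : Type*} [Field K] [NumberField K] {l N : ℕ} (hl : l.Prime)
    (hf : Module.finrank ℚ K = N) (P : Ideal (𝓞 K)) (hlP : (l : 𝓞 K) ∈ P)
    (hb : l ^ N ≤ Ideal.absNorm P) : P = Ideal.span {(l : 𝓞 K)} := by
  have hle : Ideal.span {(l : 𝓞 K)} ≤ P := by rwa [Ideal.span_singleton_le_iff_mem]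
  obtain ⟨J, hJ⟩ := Ideal.dvd_iff_le.2 hle
  have h1 := congrArg Ideal.absNorm hJ
  rw [Ideal.absNorm_span_natCast, map_mul, RingOfIntegers.rank, hf] at h1
  have hpos : 0 < l ^ N := pow_pos hl.pos _
  have h2 : Ideal.absNorm J = 1 := by
    have h3 : Ideal.absNorm J ≠ 0 := by
      intro h; rw [h] at h1; omega
    by_contra hne
    have : 2 ≤ Ideal.absNorm J := by omega
    nlinarith
  rw [Ideal.absNorm_eq_one_iff] at h2
  rw [hJ, h2, Ideal.mul_top]

theorem M_fin {M : Type*} [Field M] [NumberField M] {n : ℕ} {α s : M} {c : ℚ} (hα : TT n α)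
    (hs : s ^ 2 = algebraMap ℚ M c) (ht : IntermediateField.adjoin ℚ {α, s} = ⊤) :
    Module.finrank ℚ M ≤ 2 ^ (n + 1) ∧ ℚ⟮α⟯⟮s⟯ = ⊤ ∧
    (Module.finrank ℚ M = 2 ^ (n + 1) → Module.finrank ℚ ℚ⟮α⟯ = 2 ^ n ∧ Module.finrank ℚ⟮α⟯ M = 2) := by
  have htop : ℚ⟮α⟯⟮s⟯ = ⊤ :=
    adjoin_top_mono _ ht (by
      rintro x (rfl | hx)
      · exact IntermediateField.algebraMap_mem ℚ⟮x⟯⟮s⟯ (AdjoinSimple.gen ℚ x)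
      · rw [Set.mem_singleton_iff] at hx
        rw [hx]
        exact IntermediateField.mem_adjoin_simple_self _ s)
  have h1 := TT_finrank_le n ℚ⟮α⟯ (AdjoinSimple.gen ℚ α) (TT_gen hα) (gen_top α)
  have h2 : Module.finrank ℚ⟮α⟯ M ≤ 2 := finrank_le_two _ htop 0 (-algebraMap ℚ _ c) (by
    push_cast
    rw [hs]
    rw [show ((algebraMap ℚ ℚ⟮α⟯ c : ℚ⟮α⟯) : M) = algebraMap ℚ M c by
      rw [eq_ratCast, eq_ratCast]; rfl]
    ring)
  have h3 := finrank_tower (M := M) ℚ⟮α⟯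
  have h4 : 0 < 2 ^ n := by positivity
  rw [pow_succ]
  refine ⟨by rw [← h3]; exact Nat.mul_le_mul h1 h2, htop, fun h => ?_⟩
  rw [h] at h3
  generalize Module.finrank ℚ ℚ⟮α⟯ = x at *
  generalize Module.finrank ℚ⟮α⟯ M = y at *
  have hy : y = 2 := by
    by_contra hne
    have : y ≤ 1 := by omega
    nlinarith
  subst hy
  exact ⟨by omega, rfl⟩

theorem norm_unit {M : Type*} [Field M] [NumberField M] (u : (𝓞 M)ˣ) :
    |Algebra.norm ℚ (algebraMap (𝓞 M) M u)| = 1 := by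
  have := NumberField.isUnit_iff_norm.1 u.isUnit
  simpa using this

open ComplexOrder in
theorem M_units {p q n : ℕ} (h : PQ p q) (hn : 1 ≤ n) {M : Type*} [Field M] [NumberField M] {α s : M} (hα : TT n α)
    (hs : s ^ 2 = p * q) (ht : IntermediateField.adjoin ℚ {α, s} = ⊤) (hf : Module.finrank ℚ M = 2 ^ (n + 1))
    (u : (𝓞 M)ˣ) (hu : TP (algebraMap (𝓞 M) M u)) :
    ∃ r : ℕ, Odd r ∧ ∃ w : M, algebraMap (𝓞 M) M u = r * w ^ 2 := by
  have hs' : s ^ 2 = algebraMap ℚ M (p * q) := by rw [hs]; simp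
  obtain ⟨-, htop, hff⟩ := M_fin hα hs' ht
  obtain ⟨f1, f2⟩ := hff hf
  let β := AdjoinSimple.gen ℚ α
  have hβ : algebraMap ℚ⟮α⟯ M β = α := AdjoinSimple.algebraMap_gen ℚ α
  have hTβ : TT n β := TT_gen hα
  obtain ⟨i1, i2, i3, i4⟩ := TT_main n ℚ⟮α⟯ β hTβ (gen_top α) f1
  have hq : Algebra.IsQuadraticExtension ℚ⟮α⟯ M := ⟨f2⟩
  obtain ⟨σ, hσ, hσs⟩ := exists_conj_neg (K := ℚ⟮α⟯) s
      (notMem_of_finrank _ htop f2) (p * q) (by rw [hs, map_mul, map_natCast, map_natCast])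
  have hpq0 : (0 : ℝ) ≤ p * q := by positivity
  have hRM : RealF M := RealF_of_adjoin ht (by
    rintro g x (rfl | hx)
    · obtain ⟨r, hr, _⟩ := TT_real n (TT_map g n hα)
      rw [hr]; simp
    · rw [Set.mem_singleton_iff] at hx
      rw [hx]
      have h1 : (g s) ^ 2 = ((√(p * q) : ℝ) : ℂ) ^ 2 := by
        rw [← map_pow, hs, ← Complex.ofReal_pow, Real.sq_sqrt hpq0]; simp
      rcases sq_eq_sq_iff_eq_or_eq_neg.1 h1 with h1 | h1 <;> rw [h1] <;> simp)
  obtain ⟨S, hS⟩ : ∃ A : 𝓞 M, algebraMap (𝓞 M) M A = s := ⟨⟨s, IsIntegral.of_pow (n := 2) (by positivity) (by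
      rw [hs]; exact_mod_cast isIntegral_algebraMap (R := ℤ) (x := ((p * q : ℕ) : ℤ)))⟩, rfl⟩
  obtain ⟨B, hB⟩ : ∃ B : 𝓞 ℚ⟮α⟯, algebraMap (𝓞 ℚ⟮α⟯) ℚ⟮α⟯ B = β := ⟨⟨β, TT_integral _ hTβ⟩, rfl⟩
  have hTB : TT n B := TT_of_map (algebraMap (𝓞 ℚ⟮α⟯) ℚ⟮α⟯) RingOfIntegers.coe_injective _ (by rw [hB]; exact hTβ)
  have hS2 : S ^ 2 = p * q := RingOfIntegers.coe_injective (by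
    rw [map_pow, hS, hs, map_mul, map_natCast, map_natCast])
  let BB : Submonoid (𝓞 ℚ⟮α⟯) :=
    { carrier := {b | ∃ i j k : ℕ, b = (2 + B) ^ i * p ^ j * q ^ k}
      one_mem' := ⟨0, 0, 0, by simp⟩
      mul_mem' := by
        rintro _ _ ⟨i, j, k, rfl⟩ ⟨i', j', k', rfl⟩
        exact ⟨i + i', j + j', k + k', by ring⟩ }
  have hpp := h.hp.pos
  have hqp := h.hq.pos
  have hTPn : ∀ m : ℕ, 0 < m → TP (m : ℚ⟮α⟯) := fun m hm g => by
    rw [map_natCast]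
    exact_mod_cast hm
  obtain ⟨b, ⟨i, j, k, rfl⟩, w, hw⟩ := lemU hσ i1 hRM i2 BB (by
      rintro c ⟨i, j, k, rfl⟩
      simp only [map_mul, map_pow, map_add, map_ofNat, hB, map_natCast]
      exact (((TT_pos hTβ).pow i).mul ((hTPn p hpp).pow j)).mul ((hTPn q hqp).pow k)) (by
      intro P hP
      have hpr := hP.prime
      have h1 := hP.inertia S
      have h2 : σ • S - S = -(2 * S) := by
        apply RingOfIntegers.coe_injective
        rw [map_sub, coe_smul_int, hS, hσs, map_neg, map_mul, hS, map_ofNat]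
        ring
      rw [h2, neg_mem_iff] at h1
      have hunder : (P.under (𝓞 ℚ⟮α⟯)).IsPrime := inferInstance
      rcases hpr.mem_or_mem h1 with h2 | h2
      · refine ⟨2 + B, ⟨1, 0, 0, by simp⟩, ?_⟩
        apply eq_span_of_norm_two
        · rw [map_add, map_ofNat, hB, i3]; norm_num
        · infer_instance
        · apply Ideal.add_mem
          · rw [Ideal.mem_comap, map_ofNat]; exact h2
          · rw [Ideal.mem_comap]
            refine TT_mem P h2 n (TT_map _ _ hTB)
      · have h3 : (p : 𝓞 M) * q ∈ P := by
          rw [← hS2, sq]; exact P.mul_mem_left _ h2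
        rcases hpr.mem_or_mem h3 with h4 | h4
        · refine ⟨p, ⟨0, 1, 0, by simp⟩, ?_⟩
          have h5 : (p : 𝓞 ℚ⟮α⟯) ∈ P.under (𝓞 ℚ⟮α⟯) := by rw [Ideal.mem_comap, map_natCast]; exact h4
          exact eq_span_of_big h.hp f1 _ h5 (res_big hn hTB h.hp (Or.inr h.hp8) _ hunder h5)
        · refine ⟨q, ⟨0, 0, 1, by simp⟩, ?_⟩
          have h5 : (q : 𝓞 ℚ⟮α⟯) ∈ P.under (𝓞 ℚ⟮α⟯) := by rw [Ideal.mem_comap, map_natCast]; exact h4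
          exact eq_span_of_big h.hq f1 _ h5 (res_big hn hTB h.hq (Or.inl h.hq8) _ hunder h5)) u hu
  have hu2 : algebraMap (𝓞 M) M u = (2 + α) ^ i * ((p ^ j * q ^ k : ℕ) : M) * w ^ 2 := by
    rw [hw]
    simp only [map_mul, map_pow, map_add, map_ofNat, hB, map_natCast, hβ]
    push_cast; ring
  obtain ⟨r, hr⟩ : ∃ r, r = p ^ j * q ^ k := ⟨_, rfl⟩
  rw [← hr] at hu2
  have hro : Odd r := by
    rw [hr]
    have := h.hp8
    have := h.hq8
    exact (Odd.pow (by rw [Nat.odd_iff]; omega)).mul (Odd.pow (by rw [Nat.odd_iff]; omega))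
  have hr0 : (r : ℚ) ≠ 0 := by
    have := hro.pos
    positivity
  have n1 : Algebra.norm ℚ (2 + α) = 2 ^ 2 := by
    rw [show 2 + α = algebraMap ℚ⟮α⟯ M (2 + β) by rw [map_add, hβ, map_ofNat], ← norm_tower ℚ⟮α⟯,
      Algebra.norm_algebraMap, f2, map_pow, i3]
  have n2 : Algebra.norm ℚ (r : M) = r ^ 2 ^ (n + 1) := by
    rw [← map_natCast (algebraMap ℚ M), Algebra.norm_algebraMap, hf]
  have n3 := norm_unit u
  rw [hu2, map_mul, map_mul, map_pow, map_pow, n1, n2] at n3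
  obtain ⟨R, hR, hR0⟩ : ∃ R : ℚ, (r : ℚ) ^ 2 ^ (n + 1) = R ^ 4 ∧ R ≠ 0 := by
    obtain ⟨m, rfl⟩ : ∃ m, n = m + 1 := ⟨n - 1, by omega⟩
    exact ⟨r ^ 2 ^ m, by rw [← pow_mul]; ring_nf, by positivity⟩
  have hi : Even i := by
    by_contra hodd
    rw [Nat.not_even_iff_odd] at hodd
    obtain ⟨m, hm⟩ := hodd
    obtain ⟨X, Y, hXY⟩ := NF s (p * q) hs' (by
      intro r hr
      apply h.not_sq
      have h2 : IsSquare (((p * q : ℤ)) : ℚ) := ⟨r, by rw [← sq, hr]; push_cast; ring⟩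
      exact Rat.isSquare_intCast_iff.1 h2) w
    rw [hR] at n3
    have n4 : |2 ^ i * R ^ 2 * Algebra.norm ℚ w| = 1 := by
      rw [← sq_eq_sq₀ (abs_nonneg _) (by norm_num), sq_abs, one_pow, ← n3, abs_of_nonneg]
      · rw [show ((2:ℚ)^2)^i = (2^i)^2 by rw [← pow_mul, ← pow_mul, mul_comm]]; ring
      · positivity
    have key : ∀ e : ℚ, 2 ^ i * R ^ 2 * Algebra.norm ℚ w = e →
        (X * (2 ^ (m + 1) * R)) ^ 2 - (p * q) * (Y * (2 ^ (m + 1) * R)) ^ 2 = 2 * e := by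
      intro e he
      rw [← he, hXY, hm]
      ring
    rcases eq_or_eq_neg_of_abs_eq n4 with h5 | h5
    · exact h.nf_two _ _ (by simpa using key _ h5)
    · exact h.nf_neg_two _ _ (by simpa using key _ h5)
  obtain ⟨m, hm⟩ := hi
  refine ⟨r, hro, (2 + α) ^ m * w, ?_⟩
  rw [hu2, hm]; ring

open IntermediateField NumberField
open scoped Pointwise
set_option linter.unusedSectionVars false

def NRep (d : ℕ) {K : Type*} [Field K] (x : K) : Prop := ∃ a b : K, x = a ^ 2 - d * b ^ 2

theorem NRep.mul {d : ℕ} {K : Type*} [Field K] {x y : K} (hx : NRep d x) (hy : NRep d y) : NRep d (x * y) := by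
  obtain ⟨a, b, rfl⟩ := hx
  obtain ⟨u, v, rfl⟩ := hy
  exact ⟨a * u + d * b * v, a * v + b * u, by ring⟩

theorem NRep.sq (d : ℕ) {K : Type*} [Field K] (x : K) : NRep d (x ^ 2) := ⟨x, 0, by ring⟩

theorem NRep.descend {d : ℕ} {K L : Type*} [Field K] [NumberField K] [Field L] [NumberField L] [Algebra K L]
    [Algebra.IsQuadraticExtension K L] {σ : Gal(L/K)} (hσ : σ ≠ 1) {x : L} (hx : NRep d x) (y : K)
    (hy : algebraMap K L y = x * σ x) : NRep d y := by
  obtain ⟨a, b, rfl⟩ := hx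
  obtain ⟨A, hA⟩ := qa_fixed hσ (x := a * σ a + d * b * σ b) (by
    simp only [map_add, map_mul, map_natCast, qa_invol hσ]; ring)
  obtain ⟨B, hB⟩ := qa_fixed hσ (x := a * σ b + b * σ a) (by
    simp only [map_add, map_mul, qa_invol hσ]; ring)
  refine ⟨A, B, FaithfulSMul.algebraMap_injective K L ?_⟩
  rw [hy]
  simp only [map_sub, map_mul, map_pow, map_natCast, hA, hB]
  ring

variable {p q : ℕ}

theorem not_rep_i (h : PQ p q) (K : Type*) [Field K] [NumberField K] (z : K) (hz : z ^ 2 = -1) (ht : ℚ⟮z⟯ = ⊤)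
    (hf : Module.finrank ℚ K = 2) : ¬ NRep (p * q) z := by
  have hq : Algebra.IsQuadraticExtension ℚ K := ⟨hf⟩
  have hn : ∀ y : ℚ, algebraMap ℚ K y ≠ z := by
    rintro y rfl
    have : y ^ 2 = -1 := FaithfulSMul.algebraMap_injective ℚ K (by rw [map_pow, hz, map_neg, map_one])
    nlinarith
  obtain ⟨σ, hσ, hσz⟩ := exists_conj_neg (K := ℚ) z hn (-1) (by rw [hz]; simp)
  have hz0 : z ≠ 0 := by rintro rfl; simp at hz
  rintro ⟨A, B, hAB⟩
  obtain ⟨a, b, rfl⟩ := quad_elt hσ z hz0 hσz A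
  obtain ⟨x, y, rfl⟩ := quad_elt hσ z hz0 hσz B
  have h1 : algebraMap ℚ K (a ^ 2 - b ^ 2 - (p * q) * (x ^ 2 - y ^ 2)) + algebraMap ℚ K (2 * a * b - 2 * (p * q) * (x * y) - 1) * z = 0 := by
    simp only [map_sub, map_mul, map_pow, map_natCast, map_ofNat, map_one]
    push_cast at hAB
    linear_combination -hAB - ((algebraMap ℚ K b) ^ 2 - p * q * (algebraMap ℚ K y) ^ 2) * hz
  have h2 : 2 * a * b - 2 * (p * q) * (x * y) - 1 = 0 := by
    by_contra h0
    apply hn (-(a ^ 2 - b ^ 2 - (p * q) * (x ^ 2 - y ^ 2)) / (2 * a * b - 2 * (p * q) * (x * y) - 1))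
    rw [map_div₀, div_eq_iff ((map_ne_zero _).2 h0), map_neg]
    linear_combination -h1
  rw [h2, map_zero, zero_mul, add_zero, map_eq_zero] at h1
  exact h.nf_i a b x y (by linear_combination h1) (by linear_combination h2)

theorem not_rep_c1 (h : PQ p q) (K : Type*) [Field K] [NumberField K] (z : K) (hz : z ^ 4 = -1) (ht : ℚ⟮z⟯ = ⊤)
    (hf : Module.finrank ℚ K = 4) : ¬ NRep (p * q) (1 + z + z⁻¹) := by
  obtain ⟨w, hw⟩ : ∃ w, w = z + z ^ 3 := ⟨_, rfl⟩
  have hw2 : w ^ 2 = -2 := by rw [hw]; linear_combination (2 + z ^ 2) * hz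
  have hz0 : z ≠ 0 := by rintro rfl; simp at hz
  have hzi : z⁻¹ = -z ^ 3 := inv_eq_of_mul_eq_one_right (by linear_combination -hz)
  have hr : ∀ r : ℚ, r ^ 2 ≠ -2 := fun r hr => by nlinarith
  have f1 := finrank_sqrt w (-2) (by rw [hw2]; simp) hr
  have f2 : Module.finrank ℚ⟮w⟯ K = 2 := by
    have := finrank_tower (M := K) ℚ⟮w⟯
    rw [f1, hf] at this
    omega
  have hq : Algebra.IsQuadraticExtension ℚ⟮w⟯ K := ⟨f2⟩
  let β := AdjoinSimple.gen ℚ w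
  have hβ : algebraMap ℚ⟮w⟯ K β = w := AdjoinSimple.algebraMap_gen ℚ w
  have hβ2 : β ^ 2 = -2 := FaithfulSMul.algebraMap_injective ℚ⟮w⟯ K (by
    rw [map_pow, hβ, hw2, map_neg, map_ofNat])
  obtain ⟨σ, hσ, hσz⟩ := exists_conj_sub (K := ℚ⟮w⟯) β z (notMem_of_finrank _ (adjoin_simple_mono _ ht) f2) (-1) (by
    rw [hβ, map_neg, map_one]; linear_combination -z * hw - hz)
  rw [hβ] at hσz
  intro hrep
  have h1 : NRep (p * q) (-1 : ℚ⟮w⟯) := hrep.descend hσ _ (by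
    rw [map_neg, map_one, map_add σ, map_add σ, map_one, map_inv₀, hzi, hσz]
    have : w - z = z ^ 3 := by linear_combination hw
    rw [this, ← inv_pow, hzi]
    linear_combination (-z ^ 8 + z ^ 6 + z ^ 5 + z ^ 4 - z - 2) * hz)
  have hq2 : Algebra.IsQuadraticExtension ℚ ℚ⟮w⟯ := ⟨f1⟩
  have hn : ∀ y : ℚ, algebraMap ℚ ℚ⟮w⟯ y ≠ β := by
    intro y hy
    apply hr y
    apply FaithfulSMul.algebraMap_injective ℚ ℚ⟮w⟯
    rw [map_pow, hy, hβ2]; simp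
  obtain ⟨τ, hτ, hτz⟩ := exists_conj_neg (K := ℚ) β hn (-2) (by rw [hβ2]; simp)
  have hβ0 : β ≠ 0 := by intro h0; rw [h0] at hβ2; simp at hβ2
  obtain ⟨A, B, hAB⟩ := h1
  obtain ⟨a, b, rfl⟩ := quad_elt hτ β hβ0 hτz A
  obtain ⟨x, y, rfl⟩ := quad_elt hτ β hβ0 hτz B
  have h1 : algebraMap ℚ ℚ⟮w⟯ (a ^ 2 - 2 * b ^ 2 - (p * q) * (x ^ 2 - 2 * y ^ 2) + 1) + algebraMap ℚ ℚ⟮w⟯ (2 * (a * b - (p * q) * (x * y))) * β = 0 := by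
    simp only [map_sub, map_mul, map_pow, map_natCast, map_ofNat, map_one, map_add]
    push_cast at hAB
    linear_combination -hAB - ((algebraMap ℚ ℚ⟮w⟯ b) ^ 2 - p * q * (algebraMap ℚ ℚ⟮w⟯ y) ^ 2) * hβ2
  have h2 : 2 * (a * b - (p * q) * (x * y)) = 0 := by
    by_contra h0
    apply hn (-(a ^ 2 - 2 * b ^ 2 - (p * q) * (x ^ 2 - 2 * y ^ 2) + 1) / (2 * (a * b - (p * q) * (x * y))))
    rw [map_div₀, div_eq_iff ((map_ne_zero _).2 h0), map_neg]
    linear_combination -h1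
  rw [h2, map_zero, zero_mul, add_zero, map_eq_zero] at h1
  exact h.nf_c a b x y (by linear_combination h1) (by linear_combination h2 / 2)

theorem not_rep (h : PQ p q) : ∀ (n : ℕ) (K : Type*) [Field K] [NumberField K] (z : K), z ^ 2 ^ (n + 1) = -1 →
    ℚ⟮z⟯ = ⊤ → ¬ NRep (p * q) z ∧ ¬ NRep (p * q) (z * (1 + z + z⁻¹)) ∧ (1 ≤ n → ¬ NRep (p * q) (1 + z + z⁻¹)) := by
  intro n
  induction n with
  | zero =>
    intro K _ _ z hz ht
    have hf := (ZZ_main 0 K z hz ht).2.1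
    have hz2 : z ^ 2 = -1 := by simpa using hz
    have h1 := not_rep_i h K z hz2 ht (by simpa using hf)
    have hz0 : z ≠ 0 := by rintro rfl; simp at hz2
    refine ⟨h1, ?_, fun h => by omega⟩
    have : z * (1 + z + z⁻¹) = z := by field_simp; linear_combination hz2
    rwa [this]
  | succ n ih =>
    intro K _ _ z hz ht
    have hf := (ZZ_main _ K z hz ht).2.1
    have hz0 : z ≠ 0 := by rintro rfl; simp at hz
    obtain ⟨b, hb⟩ : ∃ b, b = z ^ 2 := ⟨_, rfl⟩
    have hb1 : b ^ 2 ^ (n + 1) = -1 := by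
      rw [hb, ← pow_mul, ← hz, pow_succ 2 (n + 1), mul_comm]
    let β := AdjoinSimple.gen ℚ b
    have hβ : algebraMap ℚ⟮b⟯ K β = b := AdjoinSimple.algebraMap_gen ℚ b
    have hTβ : β ^ 2 ^ (n + 1) = -1 := FaithfulSMul.algebraMap_injective ℚ⟮b⟯ K (by
      rw [map_pow, hβ, hb1, map_neg, map_one])
    have f1 := (ZZ_main _ _ β hTβ (gen_top b)).2.1
    obtain ⟨i1, i2, i3⟩ := ih ℚ⟮b⟯ β hTβ (gen_top b)
    have f2 : Module.finrank ℚ⟮b⟯ K = 2 := by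
      have := finrank_tower (M := K) ℚ⟮b⟯
      rw [hf, f1, pow_succ 2 (n + 1)] at this
      exact Nat.eq_of_mul_eq_mul_left (by positivity) this
    have hq : Algebra.IsQuadraticExtension ℚ⟮b⟯ K := ⟨f2⟩
    obtain ⟨σ, hσ, hσa⟩ := exists_conj_neg (K := ℚ⟮b⟯) z
      (notMem_of_finrank _ (adjoin_simple_mono _ ht) f2) β (by rw [hβ, hb])
    have hm : NRep (p * q) (-1 : ℚ⟮b⟯) := by
      have : (-1 : ℚ⟮b⟯) = (β ^ 2 ^ n) ^ 2 := by rw [← pow_mul, ← pow_succ, hTβ]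
      rw [this]
      exact NRep.sq _ _
    have hbi : b⁻¹ = z⁻¹ ^ 2 := by rw [hb, inv_pow]
    have hzz : z * z⁻¹ = 1 := mul_inv_cancel₀ hz0
    refine ⟨fun hr => i1 ?_, fun hr => i2 ?_, fun _ hr => ?_⟩
    · have h1 : NRep (p * q) (-β) := hr.descend hσ _ (by
        rw [map_neg, hβ, hσa]; linear_combination -hb)
      simpa using hm.mul h1
    · exact hr.descend hσ _ (by
        simp only [map_mul, map_add, map_inv₀, map_one, hβ, hσa, inv_neg, hbi]
        generalize z⁻¹ = y at *
        rw [hb]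
        linear_combination (-2 * z ^ 2) * hzz)
    · rcases Nat.eq_zero_or_pos n with rfl | hn
      · exact not_rep_c1 h K z (by simpa using hz) ht (by simpa using hf) hr
      · apply i3 hn
        have h1 : NRep (p * q) (-(1 + β + β⁻¹)) := hr.descend hσ _ (by
          simp only [map_neg, map_add, map_inv₀, map_one, hβ, hσa, inv_neg, hbi]
          generalize z⁻¹ = y at *
          rw [hb]
          linear_combination (2) * hzz)
        simpa using hm.mul h1

open IntermediateField NumberField
open scoped Pointwise
set_option linter.unusedSectionVars false

theorem ram_card {K L : Type*} [Field K] [NumberField K] [Field L] [NumberField L] [Algebra K L]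
    [Algebra.IsQuadraticExtension K L] {σ : Gal(L/K)} {l N : ℕ} (hl : l.Prime) (hN : 0 < N)
    (hf : Module.finrank ℚ L = 4 * N)
    (hb : ∀ P : Ideal (𝓞 L), P.IsPrime → (l : 𝓞 L) ∈ P → l ^ N ≤ Ideal.absNorm P)
    (T : Finset (Ideal (𝓞 L))) (hT : ∀ P ∈ T, RamP σ P ∧ (l : 𝓞 L) ∈ P) : T.card ≤ 2 := by
  have h1 : ∏ P ∈ T, P ^ 2 ∣ Ideal.span {(l : 𝓞 L)} := by
    apply Finset.prod_dvd_of_coprime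
    · intro P hP Q hQ hPQ
      have mP : P.IsMaximal := (hT P hP).1.prime.isMaximal (hT P hP).1.ne_bot
      have mQ : Q.IsMaximal := (hT Q hQ).1.prime.isMaximal (hT Q hQ).1.ne_bot
      exact (Ideal.isCoprime_of_isMaximal hPQ).pow
    · intro P hP
      rw [Ideal.dvd_iff_le, ← (hT P hP).1.sq, Ideal.span_singleton_le_iff_mem]
      have : (l : 𝓞 L) = algebraMap (𝓞 K) (𝓞 L) (l : 𝓞 K) := by simp
      rw [this]
      apply Ideal.mem_map_of_mem
      rw [Ideal.mem_comap, ← this]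
      exact (hT P hP).2
  obtain ⟨J, hJ⟩ := h1
  have h2 := congrArg Ideal.absNorm hJ
  rw [Ideal.absNorm_span_natCast, map_mul, RingOfIntegers.rank, hf, map_prod] at h2
  have h3 : (l ^ (2 * N)) ^ T.card ≤ ∏ P ∈ T, Ideal.absNorm (P ^ 2) := by
    apply Finset.pow_card_le_prod
    intro P hP
    rw [map_pow, mul_comm, pow_mul]
    exact Nat.pow_le_pow_left (hb P (hT P hP).1.prime (hT P hP).2) 2
  have hpos : 0 < l ^ (4 * N) := pow_pos hl.pos _
  have h4 : 0 < Ideal.absNorm J := by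
    rcases Nat.eq_zero_or_pos (Ideal.absNorm J) with h | h
    · rw [h, mul_zero] at h2; omega
    · exact h
  have h5 : l ^ (2 * N * T.card) ≤ l ^ (4 * N) := by
    rw [h2, pow_mul]
    exact h3.trans (Nat.le_mul_of_pos_right _ h4)
  have h6 := (Nat.pow_le_pow_iff_right hl.one_lt).1 h5
  have : 2 * N * T.card ≤ 2 * N * 2 := by linarith
  exact Nat.le_of_mul_le_mul_left this (by omega)

theorem exists_finset_of_card {α : Type*} (A : Set α) (k : ℕ)
    (h : ∀ T : Finset α, (∀ x ∈ T, x ∈ A) → T.card ≤ k) : ∃ T : Finset α, (∀ x ∈ A, x ∈ T) ∧ T.card ≤ k := by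
  have hfin : A.Finite := by
    by_contra hinf
    obtain ⟨T, hT, hc⟩ := Set.Infinite.exists_subset_card_eq hinf (k + 1)
    have := h T (fun x hx => hT hx)
    omega
  exact ⟨hfin.toFinset, by simp, h _ (by simp)⟩

theorem index_four {G : Type*} [CommGroup G] (H : Subgroup G) (hfin : H.index ≠ 0) (hsq : ∀ x : G, x ^ 2 ∈ H)
    (z c : G) (hz : z ∉ H) (hc : c ∉ H) (hzc : z * c ∉ H) : 4 ≤ H.index := by
  classical
  have : H.FiniteIndex := ⟨hfin⟩
  have hq : ∀ x : G ⧸ H, x * x = 1 := by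
    intro x
    induction x using QuotientGroup.induction_on with
    | H x => rw [← QuotientGroup.mk_mul, QuotientGroup.eq_one_iff, ← sq]; exact hsq x
  rw [← QuotientGroup.eq_one_iff] at hz hc hzc
  rw [QuotientGroup.mk_mul] at hzc
  generalize (z : G ⧸ H) = x at *
  generalize (c : G ⧸ H) = y at *
  have hxy : x ≠ y := by rintro rfl; exact hzc (hq x)
  have : ({1, x, y, x * y} : Finset (G ⧸ H)).card = 4 := by
    rw [Finset.card_insert_of_notMem, Finset.card_insert_of_notMem, Finset.card_insert_of_notMem]
    · simp
    · simpa [eq_comm] using hz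
    · simp [hxy, hc]
    · simp [Ne.symm hz, Ne.symm hc, Ne.symm hzc]
  have hft : Finite (G ⧸ H) := Subgroup.finite_quotient_of_finiteIndex
  let _ := Fintype.ofFinite (G ⧸ H)
  rw [← this, Subgroup.index, Nat.card_eq_fintype_card]
  exact Finset.card_le_univ _

variable {p q n : ℕ} {L : Type*} [Field L] [NumberField L] {ζ s : L}

namespace Setup

theorem i2 (S : Setup p q n ζ s) : (ζ ^ 2 ^ n) ^ 2 = -1 := by rw [← pow_mul, ← pow_succ, S.hζ]

theorem ts (S : Setup p q n ζ s) : (ζ ^ 2 ^ n * s) ^ 2 = -(p * q) := by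
  rw [mul_pow, S.i2, S.hs]; ring

theorem s0 (S : Setup p q n ζ s) : s ≠ 0 := by
  intro h
  have := S.hs
  rw [h] at this
  have h1 : (p : L) ≠ 0 := by exact_mod_cast S.pq.hp.ne_zero
  have h2 : (q : L) ≠ 0 := by exact_mod_cast S.pq.hq.ne_zero
  have h3 := mul_ne_zero h1 h2
  rw [← this] at h3
  simp at h3

theorem mod8 (S : Setup p q n ζ s) : ∃ c : ℕ, 8 * c = 1 + p * q := by
  have h1 := S.pq.hp8
  have h2 := S.pq.hq8
  have : p * q % 8 = 7 := by rw [Nat.mul_mod, h1, h2]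
  exact ⟨(1 + p * q) / 8, by omega⟩

theorem exW (S : Setup p q n ζ s) : ∃ (c : ℕ) (W : 𝓞 L), 8 * c = 1 + p * q ∧ W * (1 - W) = 2 * c ∧
    algebraMap (𝓞 L) L W = (1 + ζ ^ 2 ^ n * s) / 2 := by
  obtain ⟨c, hc⟩ := S.mod8
  have hc' : (8 * c : L) = 1 + p * q := by exact_mod_cast hc
  obtain ⟨x, hx⟩ : ∃ x, x = (1 + ζ ^ 2 ^ n * s) / 2 := ⟨_, rfl⟩
  have h1 : x * (1 - x) = 2 * c := by
    rw [hx]; linear_combination (-1 / 4) * S.ts - hc' / 4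
  have hi : IsIntegral ℤ x := by
    refine ⟨Polynomial.X ^ 2 - Polynomial.X + Polynomial.C (2 * c : ℤ), by monicity!, ?_⟩
    simp only [Polynomial.eval₂_add, Polynomial.eval₂_sub, Polynomial.eval₂_pow, Polynomial.eval₂_X, Polynomial.eval₂_C]
    rw [map_mul, map_ofNat, map_natCast]
    linear_combination -h1
  obtain ⟨W, hW⟩ : ∃ A : 𝓞 L, algebraMap (𝓞 L) L A = x := ⟨⟨x, hi⟩, rfl⟩
  refine ⟨c, W, hc, ?_, by rw [hW, hx]⟩
  apply RingOfIntegers.coe_injective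
  simp only [map_mul, map_sub, map_one, hW, h1, map_ofNat, map_natCast]

theorem exZ (S : Setup p q n ζ s) : ∃ Z : 𝓞 L, algebraMap (𝓞 L) L Z = ζ ∧ Z ^ 2 ^ (n + 1) = -1 := by
  obtain ⟨A, hA⟩ : ∃ A : 𝓞 L, algebraMap (𝓞 L) L A = ζ :=
    ⟨⟨ζ, IsIntegral.of_pow (n := 2 ^ (n + 1)) (by positivity) (by
      rw [S.hζ]; exact isIntegral_one.neg)⟩, rfl⟩
  refine ⟨A, hA, ?_⟩
  apply RingOfIntegers.coe_injective
  rw [map_pow, hA, S.hζ, map_neg, map_one]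

theorem big (S : Setup p q n ζ s) {l : ℕ} (hlp : l.Prime) (hl : l % 8 = 3 ∨ l % 8 = 5)
    (P : Ideal (𝓞 L)) (hP : P.IsPrime) (hlP : (l : 𝓞 L) ∈ P) : l ^ 2 ^ n ≤ Ideal.absNorm P := by
  have ht := TT_of_ZZ n S.hζ
  obtain ⟨a, ha⟩ : ∃ A : 𝓞 L, algebraMap (𝓞 L) L A = ζ + ζ⁻¹ := ⟨⟨ζ + ζ⁻¹, TT_integral n ht⟩, rfl⟩
  rw [← ha] at ht
  exact res_big S.hn (TT_of_map (algebraMap (𝓞 L) L) RingOfIntegers.coe_injective n ht) hlp hl P hP hlP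

end Setup

theorem unit_c {R : Type*} [CommRing R] [IsDomain R] {z : R} {n : ℕ} (hz : z ^ 2 ^ (n + 1) = -1) (h1 : z ≠ 1) :
    IsUnit (1 + z + z ^ 2) := by
  obtain ⟨k, hk⟩ : ∃ k, z ^ (3 * k) = z := by
    have h3 : Nat.Coprime 3 (2 ^ (n + 2)) := by
      apply Nat.Coprime.pow_right; norm_num
    have h1 : 1 < 2 ^ (n + 2) := Nat.one_lt_two_pow (by omega)
    obtain ⟨k, -, hk⟩ := Nat.exists_mul_mod_eq_one_of_coprime h3 h1
    refine ⟨k, ?_⟩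
    have h2 : z ^ 2 ^ (n + 2) = 1 := by rw [pow_succ 2 (n + 1), pow_mul, hz]; norm_num
    rw [← Nat.div_add_mod (3 * k) (2 ^ (n + 2)), pow_add, pow_mul, h2, one_pow, one_mul, hk, pow_one]
  have h2 := mul_geom_sum (z ^ 3) k
  rw [← pow_mul, hk] at h2
  refine IsUnit.of_mul_eq_one (∑ i ∈ Finset.range k, (z ^ 3) ^ i) ?_
  apply mul_left_cancel₀ (sub_ne_zero.2 h1)
  linear_combination h2

theorem Setup.tors (S : Setup p q n ζ s) :
    Nat.card (powMonoidHom 2 : ClassGroup (𝓞 L) →* ClassGroup (𝓞 L)).ker ≤ 2 := by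
  classical
  have hq : Algebra.IsQuadraticExtension ℚ⟮ζ⟯ L := ⟨S.finKL⟩
  obtain ⟨σ, hσ, hσs⟩ := exists_conj_neg (K := ℚ⟮ζ⟯) s S.s_notin (p * q) (by rw [S.hs]; simp)
  let z := AdjoinSimple.gen ℚ ζ
  have hz : algebraMap ℚ⟮ζ⟯ L z = ζ := AdjoinSimple.algebraMap_gen ℚ ζ
  have hσζ : σ ζ = ζ := by have h := σ.commutes z; rwa [hz] at h
  have hzz : z ^ 2 ^ (n + 1) = -1 := gen_ZZ S.hζ
  have hz0 : z ≠ 0 := by intro h; rw [h, map_zero] at hz; exact S.ζ0 hz.symm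
  obtain ⟨c, W, hc, hW, hW2⟩ := S.exW
  have hram : ∀ P, RamP σ P → (p : 𝓞 L) ∈ P ∨ (q : 𝓞 L) ∈ P := by
    intro P hP
    have h1 := hP.inertia W
    have h2 : (σ • W - W) ^ 2 = -(p * q) := by
      apply RingOfIntegers.coe_injective
      rw [map_pow, map_sub, coe_smul_int, hW2]
      simp only [map_div₀, map_add, map_mul, map_pow, hσs, hσζ, map_one, map_ofNat, map_neg, map_natCast]
      linear_combination S.ts
    have h3 := P.pow_mem_of_mem h1 2 (by norm_num)
    rw [h2, neg_mem_iff] at h3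
    exact hP.prime.mem_or_mem h3
  have hfin : Module.finrank ℚ L = 4 * 2 ^ n := by rw [S.fin]; ring
  obtain ⟨Sp, hSp, hSpc⟩ := exists_finset_of_card {P | RamP σ P ∧ (p : 𝓞 L) ∈ P} 2 (fun T hT =>
    ram_card S.pq.hp (by positivity) hfin (S.big S.pq.hp (Or.inr S.pq.hp8)) T hT)
  obtain ⟨Sq, hSq, hSqc⟩ := exists_finset_of_card {P | RamP σ P ∧ (q : 𝓞 L) ∈ P} 2 (fun T hT =>
    ram_card S.pq.hq (by positivity) hfin (S.big S.pq.hq (Or.inl S.pq.hq8)) T hT)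
  let H : Subgroup (𝓞 ℚ⟮ζ⟯)ˣ :=
    { carrier := {e | NRep (p * q) (algebraMap (𝓞 ℚ⟮ζ⟯) ℚ⟮ζ⟯ e)}
      one_mem' := ⟨1, 0, by simp⟩
      mul_mem' := fun {a b} ha hb => by
        have := NRep.mul ha hb
        rw [← map_mul, ← Units.val_mul] at this
        exact this
      inv_mem' := fun {a} ha => by
        have := NRep.mul ha (NRep.sq (p * q) (algebraMap (𝓞 ℚ⟮ζ⟯) ℚ⟮ζ⟯ (a⁻¹ : (𝓞 ℚ⟮ζ⟯)ˣ)))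
        rw [← map_pow, ← map_mul, sq, ← mul_assoc, ← Units.val_mul, mul_inv_cancel, Units.val_one, one_mul] at this
        exact this }
  have hHm : ∀ e, e ∈ H ↔ NRep (p * q) (algebraMap (𝓞 ℚ⟮ζ⟯) ℚ⟮ζ⟯ e) := fun e => Iff.rfl
  have hsq : ∀ e, e ^ 2 ∈ H := fun e => by
    rw [hHm, Units.val_pow_eq_pow_val, map_pow]; exact NRep.sq _ _
  have hidx : H.index ≠ 0 := by
    have hle : (powMonoidHom 2 : (𝓞 ℚ⟮ζ⟯)ˣ →* (𝓞 ℚ⟮ζ⟯)ˣ).range ≤ H := by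
      rintro _ ⟨x, rfl⟩
      exact hsq x
    have h2 : (powMonoidHom 2 : (𝓞 ℚ⟮ζ⟯)ˣ →* (𝓞 ℚ⟮ζ⟯)ˣ).range.index ≠ 0 := by
      rw [sqIdx, card_sq_ker']; positivity
    exact fun h => h2 (Nat.eq_zero_of_zero_dvd (h ▸ Subgroup.index_dvd_of_le hle))
  obtain ⟨r1, r2, r3⟩ := not_rep S.pq n ℚ⟮ζ⟯ z hzz (gen_top ζ)
  obtain ⟨Z, hZ⟩ : ∃ A : 𝓞 ℚ⟮ζ⟯, algebraMap (𝓞 ℚ⟮ζ⟯) ℚ⟮ζ⟯ A = z :=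
    ⟨⟨z, IsIntegral.of_pow (n := 2 ^ (n + 1)) (by positivity) (by
      rw [hzz]; exact isIntegral_one.neg)⟩, rfl⟩
  have hZZ : Z ^ 2 ^ (n + 1) = -1 := by
    apply RingOfIntegers.coe_injective
    rw [map_pow, hZ, hzz, map_neg, map_one]
  have hZu : IsUnit Z := by
    have : IsUnit (Z ^ 2 ^ (n + 1)) := by rw [hZZ]; exact isUnit_one.neg
    exact (isUnit_pow_iff (by positivity)).1 this
  have hZ1 : Z ≠ 1 := by
    rintro rfl
    rw [one_pow] at hZZ
    have h2 : (2 : 𝓞 ℚ⟮ζ⟯) = 0 := by linear_combination hZZ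
    exact two_ne_zero h2
  obtain ⟨u, hu⟩ := hZu
  obtain ⟨v, hv⟩ := unit_c hZZ hZ1
  have hvz : algebraMap (𝓞 ℚ⟮ζ⟯) ℚ⟮ζ⟯ v = z * (1 + z + z⁻¹) := by
    rw [hv]; simp only [map_add, map_pow, map_one, hZ]; field_simp; ring
  have huz : algebraMap (𝓞 ℚ⟮ζ⟯) ℚ⟮ζ⟯ u = z := by rw [hu, hZ]
  have hidx4 : 4 ≤ H.index := index_four H hidx hsq u v (by rwa [hHm, huz]) (by rwa [hHm, hvz]) (by
    rw [hHm, Units.val_mul, map_mul, huz, hvz]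
    intro h
    apply r3 S.hn
    have := NRep.mul h (NRep.sq (p * q) z⁻¹)
    have e : z * (z * (1 + z + z⁻¹)) * z⁻¹ ^ 2 = 1 + z + z⁻¹ := by field_simp
    rwa [e] at this)
  have hH : ∀ e : (𝓞 ℚ⟮ζ⟯)ˣ, (∃ x : L, Algebra.norm ℚ⟮ζ⟯ x = algebraMap (𝓞 ℚ⟮ζ⟯) ℚ⟮ζ⟯ e) → e ∈ H := by
    rintro e ⟨x, hx⟩
    rw [hHm, ← hx]
    have s0 := S.s0
    obtain ⟨A, hA⟩ := qa_fixed hσ (x := (x + σ x) / 2) (by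
      rw [map_div₀, map_add, qa_invol hσ, map_ofNat, add_comm])
    obtain ⟨B, hB⟩ := qa_fixed hσ (x := (x - σ x) / (2 * s)) (by
      rw [map_div₀, map_sub, qa_invol hσ, map_mul, hσs, map_ofNat]; field_simp; ring)
    refine ⟨A, B, FaithfulSMul.algebraMap_injective ℚ⟮ζ⟯ L ?_⟩
    rw [qa_norm hσ]
    simp only [map_sub, map_mul, map_pow, map_natCast, hA, hB]
    push_cast
    rw [← S.hs]
    field_simp
    ring
  have key := chevalley hσ S.oddK (by
      have h1 := rank_complex _ S.i2
      have h2 := rank_complex (z ^ 2 ^ n) (by rw [← pow_mul, ← pow_succ, hzz])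
      rw [S.fin] at h1; rw [S.finK] at h2
      rw [pow_succ] at h1
      omega) (Sp ∪ Sq) (by
      intro P hP
      rw [Finset.mem_union]
      exact (hram P hP).imp (fun h => hSp P ⟨hP, h⟩) (fun h => hSq P ⟨hP, h⟩)) H hH
  have h1 : (Sp ∪ Sq).card ≤ 4 := (Finset.card_union_le _ _).trans (by omega)
  have h2 : 2 ^ (Sp ∪ Sq).card ≤ 2 ^ 4 := Nat.pow_le_pow_right (by norm_num) h1
  nlinarith

open IntermediateField NumberField
open scoped Pointwise
set_option linter.unusedSectionVars false

theorem ideal_sq_inj {R : Type*} [CommRing R] [IsDedekindDomain R] {I J : Ideal R} (h : I ^ 2 = J ^ 2) : I = J := by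
  have key : ∀ A B : Ideal R, A ^ 2 = B ^ 2 → A ∣ B := fun A B hAB =>
    (UniqueFactorizationMonoid.pow_dvd_pow_iff_dvd (by norm_num)).1 hAB.dvd
  exact le_antisymm (Ideal.dvd_iff_le.1 (key _ _ h.symm)) (Ideal.dvd_iff_le.1 (key _ _ h))

theorem prod_sq {R : Type*} [CommRing R] [IsDedekindDomain R] (T : Finset (Ideal R)) (a b : Ideal R)
    (hT : ∀ P ∈ T, P ^ 2 = a ∨ P ^ 2 = b) :
    (∏ P ∈ T, P) ^ 2 = 1 ∨ (∏ P ∈ T, P) ^ 2 = a ∨ (∏ P ∈ T, P) ^ 2 = b ∨ (∏ P ∈ T, P) ^ 2 = a * b := by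
  classical
  have key : ∀ (U : Finset (Ideal R)) (a : Ideal R), (∀ P ∈ U, P ^ 2 = a) → (∏ P ∈ U, P) ^ 2 = 1 ∨ (∏ P ∈ U, P) ^ 2 = a := by
    intro U a hU
    have h1 : U.card ≤ 1 := Finset.card_le_one.2 (fun P hP Q hQ => ideal_sq_inj ((hU P hP).trans (hU Q hQ).symm))
    rcases Nat.le_one_iff_eq_zero_or_eq_one.1 h1 with h | h
    · rw [Finset.card_eq_zero] at h; left; simp [h]
    · obtain ⟨P, rfl⟩ := Finset.card_eq_one.1 h
      right; simpa using hU P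
  rw [← Finset.prod_filter_mul_prod_filter_not T (fun P => P ^ 2 = a), mul_pow]
  have h1 := key (T.filter (fun P => P ^ 2 = a)) a (by simp)
  have h2 := key (T.filter (fun P => ¬ P ^ 2 = a)) b (by
    intro P hP
    rw [Finset.mem_filter] at hP
    exact (hT P hP.1).resolve_left hP.2)
  rcases h1 with h1 | h1 <;> rcases h2 with h2 | h2 <;> rw [h1, h2] <;> simp

theorem rat_card : Nat.card (ClassGroup (𝓞 ℚ)) = 1 := by
  have := Rat.classNumber_eq
  rw [NumberField.classNumber] at this
  rw [Nat.card_eq_fintype_card, this]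

section
variable {p q : ℕ} {k : Type*} [Field k] [NumberField k]

theorem absNorm_sq_span (hf : Module.finrank ℚ k = 2) {l : ℕ} {I : Ideal (𝓞 k)} (h : I ^ 2 = Ideal.span {(l : 𝓞 k)}) :
    Ideal.absNorm I = l := by
  have h1 := congrArg Ideal.absNorm h
  rw [Ideal.absNorm_span_natCast, RingOfIntegers.rank, hf, map_pow] at h1
  exact Nat.pow_left_injective (by norm_num : 2 ≠ 0) h1

theorem ram_sq (hf : Module.finrank ℚ k = 2) [Algebra.IsQuadraticExtension ℚ k] {σ : Gal(k/ℚ)} {P : Ideal (𝓞 k)}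
    (hP : RamP σ P) {l : ℕ} (hl : l.Prime) (hlP : (l : 𝓞 k) ∈ P) : P ^ 2 = Ideal.span {(l : 𝓞 k)} := by
  have h1 : P ^ 2 ∣ Ideal.span {(l : 𝓞 k)} := by
    rw [Ideal.dvd_iff_le, ← hP.sq, Ideal.span_singleton_le_iff_mem]
    have : (l : 𝓞 k) = algebraMap (𝓞 ℚ) (𝓞 k) (l : 𝓞 ℚ) := by simp
    rw [this]
    apply Ideal.mem_map_of_mem
    rw [Ideal.mem_comap, ← this]
    exact hlP
  obtain ⟨J, hJ⟩ := h1
  have h2 := congrArg Ideal.absNorm hJ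
  rw [Ideal.absNorm_span_natCast, map_mul, RingOfIntegers.rank, hf, map_pow] at h2
  have h3 : Ideal.absNorm P ∣ l := (Nat.pow_dvd_pow_iff (by norm_num : 2 ≠ 0)).1 ⟨_, h2⟩
  have h4 : Ideal.absNorm P = l := by
    rcases (Nat.dvd_prime hl).1 h3 with h | h
    · exact absurd (Ideal.absNorm_eq_one_iff.1 h) hP.prime.ne_top
    · exact h
  rw [h4] at h2
  have h5 : Ideal.absNorm J = 1 := Nat.eq_of_mul_eq_mul_left (pow_pos hl.pos 2) (by rw [mul_one]; exact h2.symm)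
  rw [hJ, Ideal.absNorm_eq_one_iff.1 h5, Ideal.mul_top]

variable {t : k}

theorem k_norm (h : PQ p q) (ht : t ^ 2 = -(p * q)) (x : k) : ∃ X Y : ℚ, Algebra.norm ℚ x = X ^ 2 + (p * q) * Y ^ 2 := by
  obtain ⟨X, Y, hXY⟩ := NF t (-(p * q)) (by rw [ht]; simp) (by
    intro r hr
    have h1 : (0 : ℚ) < p := by exact_mod_cast h.hp.pos
    have h2 : (0 : ℚ) < q := by exact_mod_cast h.hq.pos
    nlinarith [mul_pos h1 h2, sq_nonneg r]) x
  exact ⟨X, Y, by rw [hXY]; ring⟩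

theorem k_norm_nonneg (h : PQ p q) (ht : t ^ 2 = -(p * q)) (x : k) : 0 ≤ Algebra.norm ℚ x := by
  obtain ⟨X, Y, hXY⟩ := k_norm h ht x
  rw [hXY]; positivity

theorem absNorm_span_q (x : 𝓞 k) : ((Ideal.absNorm (Ideal.span {x}) : ℕ) : ℚ) = |Algebra.norm ℚ (algebraMap (𝓞 k) k x)| := by
  rw [Ideal.absNorm_span_singleton, ← Algebra.coe_norm_int, Nat.cast_natAbs]
  push_cast; rfl

theorem k_nonsq (h : PQ p q) (ht : t ^ 2 = -(p * q)) (hf : Module.finrank ℚ k = 2) {I : Ideal (𝓞 k)} (hI0 : I ≠ ⊥)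
    (hI : I ^ 2 = Ideal.span {(p : 𝓞 k)} ∨ I ^ 2 = Ideal.span {(q : 𝓞 k)}) (y : ClassGroup (𝓞 k)) :
    cl I ≠ y ^ 2 := by
  intro hy
  obtain ⟨J, hJ0, rfl⟩ := cl_surj y
  rw [← cl_pow hJ0, cl_eq_iff hI0 (pow_ne_zero 2 hJ0)] at hy
  obtain ⟨a, b, ha, hb, hab⟩ := hy
  have key : ∃ X Y : ℚ, (Ideal.absNorm I : ℚ) = X ^ 2 + (p * q) * Y ^ 2 := by
    have h1 := congrArg (fun I => (Ideal.absNorm I : ℚ)) hab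
    simp only [map_mul, Nat.cast_mul, absNorm_span_q, map_pow, Nat.cast_pow] at h1
    rw [abs_of_nonneg (k_norm_nonneg h ht _), abs_of_nonneg (k_norm_nonneg h ht _)] at h1
    obtain ⟨X, Y, hXY⟩ := k_norm h ht (algebraMap (𝓞 k) k b / algebraMap (𝓞 k) k a)
    have ha' : Algebra.norm ℚ (algebraMap (𝓞 k) k a) ≠ 0 := by
      rw [Algebra.norm_ne_zero_iff]; simpa using ha
    have ha2 : algebraMap (𝓞 k) k a ≠ 0 := by simpa using ha
    have hdiv := map_mul (Algebra.norm ℚ) (algebraMap (𝓞 k) k b / algebraMap (𝓞 k) k a) (algebraMap (𝓞 k) k a)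
    rw [div_mul_cancel₀ _ ha2, hXY] at hdiv
    refine ⟨X * Ideal.absNorm J, Y * Ideal.absNorm J, ?_⟩
    apply mul_left_cancel₀ ha'
    rw [h1, hdiv]; ring
  obtain ⟨X, Y, hXY⟩ := key
  rcases hI with hI | hI
  · rw [absNorm_sq_span hf hI] at hXY
    exact h.nf_p X Y hXY.symm
  · rw [absNorm_sq_span hf hI] at hXY
    exact h.nf_q X Y hXY.symm

theorem k_two (h : PQ p q) (ht : t ^ 2 = -(p * q)) (hf : Module.finrank ℚ k = 2) (W : 𝓞 k)
    (hW : algebraMap (𝓞 k) k W = (1 + t) / 2) (c : ClassGroup (𝓞 k)) (hc : c ^ 2 = 1) :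
    c = 1 ∨ ∃ I : Ideal (𝓞 k), I ≠ ⊥ ∧ c = cl I ∧ (I ^ 2 = Ideal.span {(p : 𝓞 k)} ∨ I ^ 2 = Ideal.span {(q : 𝓞 k)}) := by
  have hq : Algebra.IsQuadraticExtension ℚ k := ⟨hf⟩
  obtain ⟨σ, hσ, hσt⟩ := exists_conj_neg (K := ℚ) t (by
    rintro y rfl
    have h3 : y ^ 2 = -(p * q) := (algebraMap ℚ k).injective (by rw [map_pow, ht]; simp)
    have h1 : (0 : ℚ) < p := by exact_mod_cast h.hp.pos
    have h2 : (0 : ℚ) < q := by exact_mod_cast h.hq.pos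
    nlinarith [mul_pos h1 h2, sq_nonneg y]) (-(p * q)) (by rw [ht]; simp)
  obtain ⟨I, hI, rfl⟩ := cl_surj c
  have h1 := cl_conj_of_sq hσ (by rw [rat_card]; exact odd_one) hI hc
  rw [cl_eq_iff (smul_ne_bot σ hI) hI] at h1
  obtain ⟨b, a, hb, ha, hab⟩ := h1
  have hNN : a * σ • a = b * σ • b := by
    have h2 := congrArg (fun J => σ • J) hab
    simp only [smul_mul', smul_span, qa_invol_ideal hσ] at h2
    have h3 : Ideal.span {b * σ • b} = Ideal.span {a * σ • a} := by
      have hII : I * σ • I ≠ ⊥ := mul_ne_zero hI (smul_ne_bot σ hI)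
      apply mul_right_cancel₀ hII
      rw [← Ideal.span_singleton_mul_span_singleton, ← Ideal.span_singleton_mul_span_singleton]
      calc _ = (Ideal.span {b} * σ • I) * (Ideal.span {σ • b} * I) := by ring
        _ = (Ideal.span {a} * I) * (Ideal.span {σ • a} * σ • I) := by rw [hab, h2]
        _ = _ := by ring
    have e : ∀ x : 𝓞 k, algebraMap (𝓞 k) k (x * σ • x) = algebraMap ℚ k (Algebra.norm ℚ (algebraMap (𝓞 k) k x)) := by
      intro x; rw [qa_norm hσ, map_mul, coe_smul_int]
    have h4 := congrArg (fun I => (Ideal.absNorm I : ℚ)) h3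
    simp only [absNorm_span_q, e, Algebra.norm_algebraMap, hf, abs_pow, sq_abs] at h4
    have h5 := (sq_eq_sq₀ (k_norm_nonneg h ht _) (k_norm_nonneg h ht _)).1 h4
    apply RingOfIntegers.coe_injective
    rw [e, e, h5]
  obtain ⟨J, hJ0, hJf, hJ⟩ := qa_KL hσ hI ha hb hab 1 (by simp [hNN])
  obtain ⟨A, T, hA, hT, hJT⟩ := qa_fixed_ideal hσ J hJ0 hJf
  have hT0 : (∏ P ∈ T, P) ≠ ⊥ := by
    intro h; rw [h, Ideal.mul_bot] at hJT; exact hJ0 hJT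
  have hc : cl I = cl (∏ P ∈ T, P) := by
    rw [← hJ, hJT, cl_mul (extI_ne_bot hA) hT0]
    have := cl_ext_pow' (L := k) rat_card hA
    rw [pow_one] at this
    rw [this, one_mul]
  have hTT : ∀ P ∈ T, P ^ 2 = Ideal.span {(p : 𝓞 k)} ∨ P ^ 2 = Ideal.span {(q : 𝓞 k)} := by
    intro P hP
    have h1 := (hT P hP).inertia W
    have h2 : (σ • W - W) ^ 2 = -(p * q) := by
      apply RingOfIntegers.coe_injective
      rw [map_pow, map_sub, coe_smul_int, hW]
      simp only [map_div₀, map_add, map_mul, hσt, map_one, map_ofNat, map_neg, map_natCast]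
      linear_combination ht
    have h3 := P.pow_mem_of_mem h1 2 (by norm_num)
    rw [h2, neg_mem_iff] at h3
    exact ((hT P hP).prime.mem_or_mem h3).imp (ram_sq hf (hT P hP) h.hp) (ram_sq hf (hT P hP) h.hq)
  rw [hc]
  rcases prod_sq T _ _ hTT with h1 | h1 | h1 | h1
  · left
    have : (∏ P ∈ T, P) = 1 := ideal_sq_inj (by rw [h1, one_pow])
    rw [this, Ideal.one_eq_top, cl_top]
  · right; exact ⟨_, hT0, rfl, Or.inl h1⟩
  · right; exact ⟨_, hT0, rfl, Or.inr h1⟩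
  · left
    have h2 : (2 * W - 1) ^ 2 = -(p * q) := by
      apply RingOfIntegers.coe_injective
      simp only [map_pow, map_sub, map_mul, hW, map_ofNat, map_one, map_neg, map_natCast]
      linear_combination ht
    have : (∏ P ∈ T, P) = Ideal.span {2 * W - 1} := ideal_sq_inj (by
      rw [h1, Ideal.span_singleton_pow, h2, Ideal.span_singleton_neg, Ideal.span_singleton_mul_span_singleton])
    rw [this, cl_span]

theorem k_main (h : PQ p q) (ht : t ^ 2 = -(p * q)) (hf : Module.finrank ℚ k = 2) (W : 𝓞 k)
    (hW : algebraMap (𝓞 k) k W = (1 + t) / 2) (c : ClassGroup (𝓞 k)) :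
    ∃ m : ℕ, Odd m ∧ (c ^ m = 1 ∨ ∃ I : Ideal (𝓞 k), I ≠ ⊥ ∧ c ^ m = cl I ∧ (I ^ 2 = Ideal.span {(p : 𝓞 k)} ∨ I ^ 2 = Ideal.span {(q : 𝓞 k)})) := by
  obtain ⟨a, m, hm, ham⟩ := Nat.exists_eq_two_pow_mul_odd (orderOf_pos c).ne'
  refine ⟨m, hm, ?_⟩
  rcases a with - | a
  · left; rw [← pow_orderOf_eq_one c, ham]; simp
  · right
    have h1 : (c ^ (2 ^ a * m)) ^ 2 = 1 := by
      rw [← pow_mul, ← pow_orderOf_eq_one c, ham]; ring_nf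
    rcases k_two h ht hf W hW _ h1 with h2 | ⟨I, hI0, hI, hI2⟩
    · exfalso
      have h3 := orderOf_dvd_of_pow_eq_one h2
      have h4 : 0 < 2 ^ a * m := by have := hm.pos; positivity
      have := Nat.le_of_dvd h4 h3
      rw [ham, pow_succ] at this
      nlinarith
    · rcases a with - | a
      · exact ⟨I, hI0, by rw [← hI]; simp, hI2⟩
      · exfalso
        apply k_nonsq h ht hf hI0 hI2 (c ^ (2 ^ a * m))
        rw [← hI, ← pow_mul]; ring_nf
end

open IntermediateField NumberField
open scoped Pointwise
set_option linter.unusedSectionVars false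

theorem assoc_one_add {R : Type*} [CommRing R] [IsDomain R] {z : R} {k : ℕ} (hk : Even k) (h : z ^ k = -1) :
    Associated (1 + z) (1 - z) := by
  have key : ∀ y : R, y ^ k = -1 → (1 - y) ∣ (1 + y) := by
    intro y hy
    have := sub_one_dvd_pow_sub_one y (k + 1)
    rw [pow_succ, hy] at this
    rw [← neg_dvd, ← dvd_neg]
    convert this using 1 <;> ring
  apply associated_of_dvd_dvd
  · have := key (-z) (by rw [hk.neg_pow, h])
    simpa [← sub_eq_add_neg] using this
  · exact key z h

theorem assoc_pow {R : Type*} [CommRing R] [IsDomain R] {z : R} {m : ℕ} (h : z ^ 2 ^ m = -1) (k : ℕ) (hk : k ≤ m) :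
    Associated ((1 - z) ^ 2 ^ k) (1 - z ^ 2 ^ k) := by
  induction k with
  | zero => simp
  | succ k ih =>
    have h1 := ih (by omega)
    have h2 : (z ^ 2 ^ k) ^ 2 ^ (m - k) = -1 := by
      rw [← pow_mul, ← pow_add, Nat.add_sub_cancel' (by omega), h]
    have h3 := assoc_one_add (Nat.even_pow.2 ⟨even_two, by omega⟩) h2
    have h4 : 1 - z ^ 2 ^ (k + 1) = (1 - z ^ 2 ^ k) * (1 + z ^ 2 ^ k) := by rw [pow_succ, pow_mul]; ring
    rw [h4, pow_succ 2 k, pow_mul, sq]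
    exact h1.mul_mul (h1.trans h3.symm)

theorem span_pair_pow {R : Type*} [CommRing R] {x w : R} (k : ℕ) (hk : x ^ (k + 1) ∣ w * (1 - w)) :
    (Ideal.span {x, w}) ^ (k + 1) = Ideal.span {x ^ (k + 1), w} := by
  induction k with
  | zero => simp
  | succ k ih =>
    rw [pow_succ, ih (dvd_trans (pow_dvd_pow _ (by omega)) hk), Ideal.span_pair_mul_span_pair]
    apply le_antisymm
    · rw [Ideal.span_le]
      rintro y (rfl | rfl | rfl | rfl)
      · exact Ideal.subset_span (by simp [pow_succ])
      · exact Ideal.mul_mem_left _ _ (Ideal.subset_span (by simp))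
      · exact Ideal.mul_mem_right _ _ (Ideal.subset_span (by simp))
      · exact Ideal.mul_mem_right _ _ (Ideal.subset_span (by simp))
    · rw [Ideal.span_le]
      have h1 : x ^ (k + 1 + 1) ∈ Ideal.span {x ^ (k + 1) * x, x ^ (k + 1) * w, w * x, w * w} :=
        Ideal.subset_span (by simp [pow_succ])
      rintro y (rfl | rfl)
      · exact h1
      · obtain ⟨r, hr⟩ := hk
        have : y = x ^ (k + 1 + 1) * r + y * y := by rw [← hr]; ring
        have h2 : y * y ∈ Ideal.span {x ^ (k + 1) * x, x ^ (k + 1) * y, y * x, y * y} := Ideal.subset_span (by simp)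
        have h3 := Ideal.add_mem _ (Ideal.mul_mem_right r _ h1) h2
        rw [← this] at h3
        exact h3

theorem span_pair_conj {R : Type*} [CommRing R] {x w : R} (hk : x ∣ w * (1 - w)) :
    Ideal.span {x, w} * Ideal.span {x, 1 - w} = Ideal.span {x} := by
  rw [Ideal.span_pair_mul_span_pair]
  apply le_antisymm
  · rw [Ideal.span_le]
    rintro y (rfl | rfl | rfl | rfl)
    · exact Ideal.mul_mem_right _ _ (Ideal.subset_span (by simp))
    · exact Ideal.mul_mem_right _ _ (Ideal.subset_span (by simp))
    · exact Ideal.mul_mem_left _ _ (Ideal.subset_span (by simp))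
    · exact Ideal.mem_span_singleton.2 hk
  · rw [Ideal.span_singleton_le_iff_mem]
    have h2 : w * x ∈ Ideal.span {x * x, x * (1 - w), w * x, w * (1 - w)} := Ideal.subset_span (by simp)
    have h3 : x * (1 - w) ∈ Ideal.span {x * x, x * (1 - w), w * x, w * (1 - w)} := Ideal.subset_span (by simp)
    have := Ideal.add_mem _ h2 h3
    convert this using 1; ring

variable {p q n : ℕ} {L : Type*} [Field L] [NumberField L] {ζ s : L}

/-- integral data attached to a setup -/
structure IData (n : ℕ) {L : Type*} [Field L] [NumberField L] (ζ s : L) (Z W : 𝓞 L) (c : ℕ) : Prop where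
  hZ : algebraMap (𝓞 L) L Z = ζ
  hZ2 : Z ^ 2 ^ (n + 1) = -1
  hW : algebraMap (𝓞 L) L W = (1 + ζ ^ 2 ^ n * s) / 2
  hW2 : W * (1 - W) = 2 * c

theorem Setup.idata (S : Setup p q n ζ s) : ∃ Z W c, IData n ζ s Z W c := by
  obtain ⟨c, W, -, h2, h3⟩ := S.exW
  obtain ⟨Z, h4, h5⟩ := S.exZ
  exact ⟨Z, W, c, h4, h5, h3, h2⟩

section
variable {Z W : 𝓞 L} {c : ℕ} (S : Setup p q n ζ s) (D : IData n ζ s Z W c)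

/-- the prime above two -/
def PP (Z W : 𝓞 L) : Ideal (𝓞 L) := Ideal.span {1 - Z, W}

theorem IData.dvd2 (D : IData n ζ s Z W c) (k : ℕ) (hk : k ≤ 2 ^ (n + 1)) : (1 - Z) ^ k ∣ W * (1 - W) := by
  have h := (assoc_pow D.hZ2 (n + 1) le_rfl).dvd
  rw [D.hZ2] at h
  rw [D.hW2]
  refine dvd_trans (pow_dvd_pow _ hk) (dvd_trans h ⟨c, by ring⟩)

theorem IData.pow (D : IData n ζ s Z W c) (k : ℕ) (h0 : 0 < k) (hk : k ≤ 2 ^ (n + 1)) :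
    PP Z W ^ k = Ideal.span {(1 - Z) ^ k, W} := by
  obtain ⟨j, rfl⟩ : ∃ j, k = j + 1 := ⟨k - 1, by omega⟩
  exact span_pair_pow j (D.dvd2 _ hk)

theorem IData.pow2 (D : IData n ζ s Z W c) (k : ℕ) (hk : k ≤ n + 1) :
    PP Z W ^ 2 ^ k = Ideal.span {1 - Z ^ 2 ^ k, W} := by
  rw [D.pow _ (by positivity) (Nat.pow_le_pow_right (by norm_num) hk), Ideal.span_insert, Ideal.span_insert,
    Ideal.span_singleton_eq_span_singleton.2 (assoc_pow D.hZ2 k hk)]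

theorem IData.conj (D : IData n ζ s Z W c) : PP Z W * PP Z (1 - W) = Ideal.span {1 - Z} :=
  span_pair_conj (by simpa using D.dvd2 1 Nat.one_le_two_pow)

theorem IData.coprime : IsCoprime (PP Z W) (PP Z (1 - W)) := by
  rw [Ideal.isCoprime_iff_exists]
  exact ⟨W, Ideal.subset_span (by simp), 1 - W, Ideal.subset_span (by simp), by ring⟩

theorem smul_topI {K : Type*} [Field K] [Algebra K L] (σ : Gal(L/K)) : σ • (⊤ : Ideal (𝓞 L)) = ⊤ := by
  rw [Ideal.eq_top_iff_one]
  have := Ideal.smul_mem_pointwise_smul σ (1 : 𝓞 L) ⊤ trivial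
  rwa [smul_one] at this

theorem smul_PP {K : Type*} [Field K] [Algebra K L] (σ : Gal(L/K)) (Z W : 𝓞 L) : σ • PP Z W = PP (σ • Z) (σ • W) := by
  rw [PP, Ideal.pointwise_smul_def, Ideal.map_span, PP]
  congr 1
  simp [Set.image_insert_eq, smul_sub, smul_one]

theorem norm_one_sub (S : Setup p q n ζ s) (D : IData n ζ s Z W c) : Ideal.absNorm (Ideal.span {1 - Z}) = 4 := by
  have h : Algebra.norm ℚ (algebraMap (𝓞 L) L (1 - Z)) = 4 := by
    have h1 := (ZZ_main n ℚ⟮ζ⟯ _ (gen_ZZ S.hζ) (gen_top ζ)).2.2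
    have h2 : algebraMap (𝓞 L) L (1 - Z) = algebraMap ℚ⟮ζ⟯ L (1 - AdjoinSimple.gen ℚ ζ) := by
      rw [map_sub, map_sub, D.hZ, AdjoinSimple.algebraMap_gen, map_one, map_one]
    rw [h2, ← norm_tower ℚ⟮ζ⟯, Algebra.norm_algebraMap, S.finKL, map_pow, h1]; norm_num
  have := absNorm_span_q (1 - Z)
  rw [h] at this
  have h4 : |(4 : ℚ)| = 4 := by norm_num
  rw [h4] at this
  exact_mod_cast this

theorem norm_PP (S : Setup p q n ζ s) (D : IData n ζ s Z W c) : Ideal.absNorm (PP Z W) = 2 ∧ Ideal.absNorm (PP Z (1 - W)) = 2 := by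
  have hq : Algebra.IsQuadraticExtension ℚ⟮ζ⟯ L := ⟨S.finKL⟩
  obtain ⟨σ, hσ, hσs⟩ := exists_conj_neg (K := ℚ⟮ζ⟯) s S.s_notin (p * q) (by rw [S.hs]; simp)
  have hσζ : σ ζ = ζ := by
    have h := σ.commutes (AdjoinSimple.gen ℚ ζ)
    rwa [AdjoinSimple.algebraMap_gen] at h
  have e1 : σ • Z = Z := by
    apply RingOfIntegers.coe_injective
    rw [coe_smul_int, D.hZ, hσζ]
  have e2 : σ • W = 1 - W := by
    apply RingOfIntegers.coe_injective
    rw [coe_smul_int, map_sub, D.hW]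
    simp only [map_div₀, map_add, map_mul, map_pow, hσs, hσζ, map_one, map_ofNat]
    ring
  have h1 : σ • PP Z W = PP Z (1 - W) := by rw [smul_PP, e1, e2]
  have h2 := congrArg Ideal.absNorm D.conj
  rw [norm_one_sub S D, map_mul] at h2
  have h3 : PP Z W ≠ ⊤ := by
    intro h
    rw [h, smul_topI] at h1
    rw [← h1, h] at h2
    simp at h2
  have h4 : PP Z (1 - W) ≠ ⊤ := by
    intro h
    rw [h] at h1
    apply h3
    have := congrArg (fun I => σ⁻¹ • I) h1
    simpa [smul_topI] using this
  have h5 : Ideal.absNorm (PP Z W) ≠ 1 := by rwa [Ne, Ideal.absNorm_eq_one_iff]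
  have h6 : Ideal.absNorm (PP Z (1 - W)) ≠ 1 := by rwa [Ne, Ideal.absNorm_eq_one_iff]
  generalize Ideal.absNorm (PP Z W) = a at *
  generalize Ideal.absNorm (PP Z (1 - W)) = b at *
  have ha : a ≤ 4 := Nat.le_of_dvd (by norm_num) ⟨b, h2.symm⟩
  have ha0 : a ≠ 0 := by rintro rfl; simp at h2
  have hb : b ≤ 4 := Nat.le_of_dvd (by norm_num) ⟨a, by rw [mul_comm]; exact h2.symm⟩
  interval_cases a <;> omega

theorem PP_prime (S : Setup p q n ζ s) (D : IData n ζ s Z W c) : (PP Z W).IsPrime ∧ (PP Z (1 - W)).IsPrime := by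
  obtain ⟨h1, h2⟩ := norm_PP S D
  exact ⟨Ideal.isPrime_of_irreducible_absNorm (by rw [h1]; exact Nat.prime_two),
    Ideal.isPrime_of_irreducible_absNorm (by rw [h2]; exact Nat.prime_two)⟩

theorem PP_ne_bot (S : Setup p q n ζ s) (D : IData n ζ s Z W c) : PP Z W ≠ ⊥ ∧ PP Z (1 - W) ≠ ⊥ := by
  obtain ⟨h1, h2⟩ := norm_PP S D
  constructor
  · intro h; rw [h] at h1; simp at h1
  · intro h; rw [h] at h2; simp at h2

theorem PP_nonsq (S : Setup p q n ζ s) (D : IData n ζ s Z W c) (y : ClassGroup (𝓞 L)) : cl (PP Z W) ≠ y ^ 2 := by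
  intro hy
  obtain ⟨J, hJ0, rfl⟩ := cl_surj y
  rw [← cl_pow hJ0, cl_eq_iff (PP_ne_bot S D).1 (pow_ne_zero 2 hJ0)] at hy
  obtain ⟨a, b, ha, hb, hab⟩ := hy
  have h1 := congrArg (fun I => (Ideal.absNorm I : ℚ)) hab
  simp only [map_mul, Nat.cast_mul, absNorm_span_q, map_pow, Nat.cast_pow, (norm_PP S D).1] at h1
  have ha2 : algebraMap (𝓞 L) L a ≠ 0 := by simpa using ha
  have ha' : Algebra.norm ℚ (algebraMap (𝓞 L) L a) ≠ 0 := by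
    rw [Algebra.norm_ne_zero_iff]; exact ha2
  obtain ⟨X, Y, hXY⟩ := NF s (p * q) (by rw [S.hs]; simp) (by
      intro r hr
      apply S.pq.not_sq
      have h2 : IsSquare (((p * q : ℤ)) : ℚ) := ⟨r, by rw [← sq, hr]; push_cast; ring⟩
      exact Rat.isSquare_intCast_iff.1 h2) (algebraMap (𝓞 L) L b / algebraMap (𝓞 L) L a)
  have hdiv := map_mul (Algebra.norm ℚ) (algebraMap (𝓞 L) L b / algebraMap (𝓞 L) L a) (algebraMap (𝓞 L) L a)
  rw [div_mul_cancel₀ _ ha2, hXY] at hdiv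
  rw [hdiv, abs_mul] at h1
  have h2 : |(X * Ideal.absNorm J) ^ 2 - (p * q) * (Y * Ideal.absNorm J) ^ 2| = 2 := by
    apply mul_left_cancel₀ (abs_ne_zero.2 ha')
    push_cast at h1
    rw [h1, show (X * Ideal.absNorm J) ^ 2 - (p * q) * (Y * Ideal.absNorm J) ^ 2 = (X ^ 2 - (p * q) * Y ^ 2) * (Ideal.absNorm J : ℚ) ^ 2 by ring,
      abs_mul, abs_of_nonneg (sq_nonneg (Ideal.absNorm J : ℚ))]
    ring
  rcases eq_or_eq_neg_of_abs_eq h2 with h3 | h3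
  · exact S.pq.nf_two _ _ h3
  · exact S.pq.nf_neg_two _ _ h3
end

open IntermediateField NumberField
open scoped Pointwise
set_option linter.unusedSectionVars false

section H2
variable {p q n : ℕ} {L : Type*} [Field L] [NumberField L] {ζ s : L}

theorem span_sq_of (r : 𝓞 L) (b : L) (e e' : 𝓞 L) (he : e * e' = 1)
    (hb : b ^ 2 = algebraMap (𝓞 L) L (r * e)) : ∃ B : 𝓞 L, Ideal.span {B} ^ 2 = Ideal.span {r} := by
  obtain ⟨B, hB⟩ : ∃ B : 𝓞 L, algebraMap (𝓞 L) L B = b :=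
    ⟨⟨b, IsIntegral.of_pow (n := 2) (by norm_num) (by rw [hb]; exact RingOfIntegers.isIntegral_coe _)⟩, rfl⟩
  refine ⟨B, ?_⟩
  have h1 : B ^ 2 = r * e := by
    apply RingOfIntegers.coe_injective
    rw [map_pow, hB, hb]
  rw [Ideal.span_singleton_pow, h1, Ideal.span_singleton_eq_span_singleton]
  exact ⟨⟨e', e, by rw [mul_comm, he], he⟩, by
    show r * e * e' = r
    rw [mul_assoc, he, mul_one]⟩

theorem Setup.beta (S : Setup p q n ζ s) :
    (∃ B : 𝓞 L, Ideal.span {B} ^ 2 = Ideal.span {(p : 𝓞 L)}) ∧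
    (∃ B : 𝓞 L, Ideal.span {B} ^ 2 = Ideal.span {(q : 𝓞 L)}) := by
  obtain ⟨u, v, huv⟩ := S.pq.pell
  obtain ⟨T, hT⟩ : ∃ T : 𝓞 L, algebraMap (𝓞 L) L T = s :=
    ⟨⟨s, IsIntegral.of_pow (n := 2) (by norm_num) (by
      rw [S.hs]; exact_mod_cast isIntegral_natCast (p * q))⟩, rfl⟩
  obtain ⟨Z, hZ, hZ2⟩ := S.exZ
  have huvL : (p : L) * u ^ 2 - q * v ^ 2 = 2 := by exact_mod_cast congrArg (Int.cast : ℤ → L) huv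
  have huvO : (p : 𝓞 L) * u ^ 2 - q * v ^ 2 = 2 := by exact_mod_cast congrArg (Int.cast : ℤ → 𝓞 L) huv
  have hT2 : T ^ 2 = p * q := by
    apply RingOfIntegers.coe_injective
    rw [map_pow, hT, S.hs]; simp
  have hI2 : (Z ^ 2 ^ n) ^ 2 = -1 := by rw [← pow_mul, ← pow_succ, hZ2]
  have hi2 := S.i2
  have hI : algebraMap (𝓞 L) L (Z ^ 2 ^ n) = ζ ^ 2 ^ n := by rw [map_pow, hZ]
  generalize Z ^ 2 ^ n = I at *
  generalize ζ ^ 2 ^ n = i at *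
  have h1i : 1 + i ≠ 0 := by
    intro h
    have : i = -1 := by linear_combination h
    rw [this] at hi2
    norm_num at hi2
  have he : (-I * ((1 + q * v ^ 2) + u * v * T)) * (I * ((1 + q * v ^ 2) - u * v * T)) = 1 := by
    have : ((1 + q * v ^ 2) + u * v * T) * ((1 + q * v ^ 2) - u * v * T) = 1 := by
      linear_combination (-(u * v : 𝓞 L) ^ 2) * hT2 - q * v ^ 2 * huvO
    linear_combination (-I ^ 2) * this - hI2
  have hd : (1 + i) ^ 2 = 2 * i := by linear_combination hi2
  constructor
  · refine span_sq_of _ ((p * u + v * s) / (1 + i)) _ _ he ?_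
    rw [div_pow, div_eq_iff (pow_ne_zero 2 h1i), hd]
    simp only [map_mul, map_add, map_neg, map_pow, map_one, map_natCast, map_intCast, hI, hT]
    linear_combination (v : L) ^ 2 * S.hs + p * huvL + 2 * p * ((1 + q * v ^ 2) + u * v * s) * hi2
  · refine span_sq_of _ ((q * v + u * s) / (1 + i)) _ _ he ?_
    rw [div_pow, div_eq_iff (pow_ne_zero 2 h1i), hd]
    simp only [map_mul, map_add, map_neg, map_pow, map_one, map_natCast, map_intCast, hI, hT]
    linear_combination (u : L) ^ 2 * S.hs + q * huvL + 2 * q * ((1 + q * v ^ 2) + u * v * s) * hi2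

section
variable {K : Type*} [Field K] [NumberField K] [Algebra K L]
theorem extG_ne_bot {I : Ideal (𝓞 K)} (h : I ≠ ⊥) : extI L I ≠ ⊥ := by
  rw [extI, Ne, Ideal.map_eq_bot_iff_of_injective]
  · exact h
  · exact FaithfulSMul.algebraMap_injective (𝓞 K) (𝓞 L)
theorem extG_mul (I J : Ideal (𝓞 K)) : extI L (I * J) = extI L I * extI L J := Ideal.map_mul _ _ _
theorem extG_pow (I : Ideal (𝓞 K)) (n : ℕ) : extI L (I ^ n) = extI L I ^ n := Ideal.map_pow _ _ _
theorem extG_span (x : 𝓞 K) : extI L (Ideal.span {x}) = Ideal.span {algebraMap (𝓞 K) (𝓞 L) x} := by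
  rw [extI, Ideal.map_span, Set.image_singleton]
end

theorem PP_upper {Z W : 𝓞 L} {c : ℕ} (S : Setup p q n ζ s) (D : IData n ζ s Z W c) :
    ∃ m : ℕ, Odd m ∧ cl (PP Z W) ^ (2 ^ (n + 1) * m) = 1 := by
  have hf : Module.finrank ℚ ℚ⟮ζ ^ 2 ^ n * s⟯ = 2 := by
    refine finrank_sqrt _ (-(p * q)) (by rw [S.ts]; simp) ?_
    intro r hr
    have h1 : (0 : ℚ) < p * q := by
      have := S.pq.hp.pos; have := S.pq.hq.pos; positivity
    nlinarith [sq_nonneg r]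
  have hts := S.ts
  have hWt := D.hW
  generalize ζ ^ 2 ^ n * s = t at *
  obtain ⟨t', ht'⟩ : ∃ t', t' = AdjoinSimple.gen ℚ t := ⟨_, rfl⟩
  have ht2 : algebraMap ℚ⟮t⟯ L t' = t := by rw [ht', AdjoinSimple.algebraMap_gen]
  have hW1 : algebraMap ℚ⟮t⟯ L ((1 + t') / 2) = algebraMap (𝓞 L) L W := by
    rw [hWt, map_div₀, map_add, ht2, map_one, map_ofNat]
  obtain ⟨w, hw⟩ : ∃ w : 𝓞 ℚ⟮t⟯, algebraMap (𝓞 ℚ⟮t⟯) ℚ⟮t⟯ w = (1 + t') / 2 :=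
    ⟨⟨(1 + t') / 2, (isIntegral_algebraMap_iff (algebraMap ℚ⟮t⟯ L).injective).1 (by
      rw [hW1]; exact RingOfIntegers.isIntegral_coe _)⟩, rfl⟩
  have hwW : algebraMap (𝓞 ℚ⟮t⟯) (𝓞 L) w = W := by
    apply RingOfIntegers.coe_injective
    rw [← hW1, ← hw]; rfl
  have hP0 : Ideal.span {(2 : 𝓞 ℚ⟮t⟯), w} ≠ ⊥ := by
    intro h
    have : (2 : 𝓞 ℚ⟮t⟯) ∈ Ideal.span {(2 : 𝓞 ℚ⟮t⟯), w} := Ideal.subset_span (by simp)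
    rw [h] at this
    simp at this
  have hext : extI L (Ideal.span {(2 : 𝓞 ℚ⟮t⟯), w}) = PP Z W ^ 2 ^ (n + 1) := by
    rw [D.pow2 (n + 1) le_rfl, D.hZ2, extI, Ideal.map_span, Set.image_insert_eq, Set.image_singleton, hwW, map_ofNat]
    norm_num
  obtain ⟨m, hm, hm2⟩ := k_main (k := ℚ⟮t⟯) (t := t') S.pq (by
    apply (algebraMap ℚ⟮t⟯ L).injective
    rw [map_pow, ht2, hts]; simp) hf w hw (cl (Ideal.span {(2 : 𝓞 ℚ⟮t⟯), w}))
  refine ⟨m, hm, ?_⟩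
  rw [← cl_pow (PP_ne_bot S D).1, pow_mul, ← hext, ← extG_pow]
  have hPm : Ideal.span {(2 : 𝓞 ℚ⟮t⟯), w} ^ m ≠ ⊥ := pow_ne_zero m hP0
  rw [← cl_pow hP0] at hm2
  rcases hm2 with h | ⟨I, hI0, h, h2⟩
  · obtain ⟨x, hx⟩ := (cl_eq_one_iff hPm).1 h
    rw [hx, extG_span, cl_span]
  · obtain ⟨x, y, hx, hy, hxy⟩ := (cl_eq_iff hPm hI0).1 h
    have hB : ∃ B, extI L I = Ideal.span {B} := by
      rcases h2 with h2 | h2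
      · obtain ⟨B, hB⟩ := S.beta.1
        refine ⟨B, ideal_sq_inj ?_⟩
        rw [hB, ← extG_pow, h2, extG_span, map_natCast]
      · obtain ⟨B, hB⟩ := S.beta.2
        refine ⟨B, ideal_sq_inj ?_⟩
        rw [hB, ← extG_pow, h2, extG_span, map_natCast]
    obtain ⟨B, hB⟩ := hB
    have h3 := congrArg cl (congrArg (extI L) hxy)
    rw [extG_mul, extG_mul, cl_mul (extG_ne_bot (span_ne_bot hx)) (extG_ne_bot hPm),
      cl_mul (extG_ne_bot (span_ne_bot hy)) (extG_ne_bot hI0), extG_span, extG_span, cl_span, cl_span, hB, cl_span] at h3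
    simpa using h3

end H2

open IntermediateField NumberField
open scoped Pointwise
set_option linter.unusedSectionVars false

section H3
variable {p q n : ℕ} {L : Type*} [Field L] [NumberField L] {ζ s : L}

theorem Setup.exJ (S : Setup p q n ζ s) : ∃ M : IntermediateField ℚ L, Module.finrank ℚ M = 2 ^ (n + 1) ∧
    Module.finrank M L = 2 ∧ (∃ a b : M, TT n a ∧ b ^ 2 = p * q ∧ IntermediateField.adjoin ℚ {a, b} = ⊤) ∧
    ∃ J : Gal(L/M), J ≠ 1 ∧ J ζ = ζ⁻¹ ∧ J s = s := by
  obtain ⟨M, hM⟩ : ∃ M, M = IntermediateField.adjoin ℚ {ζ + ζ⁻¹, s} := ⟨_, rfl⟩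
  obtain ⟨a, b, ha, hb, hab⟩ := gen_top2 M (ζ + ζ⁻¹) s hM
  have hTT : TT n a := TT_of_map (algebraMap M L) (algebraMap M L).injective n (by
    rw [ha]; exact TT_of_ZZ n S.hζ)
  have hb2 : b ^ 2 = p * q := by
    apply (algebraMap M L).injective
    rw [map_pow, hb, S.hs]; simp
  have h1 := (M_fin (c := p * q) hTT (by rw [hb2]; simp) hab).1
  have hbM : s ∈ M := by rw [← hb]; exact b.2
  have htop : M⟮ζ⟯ = ⊤ := adjoin_top_mono M S.top (by
    rintro x (rfl | hx)
    · exact IntermediateField.mem_adjoin_simple_self _ _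
    · rw [Set.mem_singleton_iff] at hx
      rw [hx, ← hb]
      exact IntermediateField.algebraMap_mem _ b)
  have hrel : ζ ^ 2 - algebraMap M L a * ζ + algebraMap M L 1 = 0 := by
    have := S.ζ0
    rw [ha, map_one]; field_simp; ring
  have h2 := finrank_le_two M htop a 1 hrel
  have h3 := finrank_tower (M := L) M
  rw [S.fin] at h3
  have h4 : Module.finrank M L = 2 := by
    by_contra hne
    have : Module.finrank M L ≤ 1 := by omega
    have h5 : Module.finrank ℚ M * Module.finrank M L ≤ 2 ^ (n + 1) * 1 := Nat.mul_le_mul h1 this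
    rw [h3] at h5
    have : 2 ^ (n + 2) = 2 * 2 ^ (n + 1) := by ring
    have : 0 < 2 ^ (n + 1) := by positivity
    omega
  have h5 : Module.finrank ℚ M = 2 ^ (n + 1) := by
    rw [h4, pow_succ 2 (n + 1)] at h3
    exact Nat.eq_of_mul_eq_mul_right (by norm_num) h3
  have hq : Algebra.IsQuadraticExtension M L := ⟨h4⟩
  obtain ⟨J, hJ, hJζ⟩ := exists_conj_sub (K := M) a ζ (notMem_of_finrank M htop h4) 1 hrel
  refine ⟨M, h5, h4, ⟨a, b, hTT, hb2, hab⟩, J, hJ, by rw [hJζ, ha]; ring, ?_⟩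
  have h := J.commutes b
  rwa [hb] at h

theorem Setup.conjJ (S : Setup p q n ζ s) (J : L →+* L) (hζ : J ζ = ζ⁻¹) (hs : J s = s) (g : L →+* ℂ) (x : L) :
    g (J x) = starRingEnd ℂ (g x) := by
  have hx : x ∈ IntermediateField.adjoin ℚ {ζ, s} := by rw [S.top]; trivial
  induction hx using IntermediateField.adjoin_induction with
  | mem x hx =>
    rcases hx with rfl | hx
    · rw [hζ, map_inv₀]
      apply Complex.inv_eq_conj
      refine Complex.norm_eq_one_of_pow_eq_one (n := 2 ^ (n + 2)) ?_ (by positivity)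
      rw [← map_pow, pow_succ 2, pow_mul, S.hζ]; simp
    · rw [Set.mem_singleton_iff] at hx
      subst hx
      rw [hs, eq_comm, Complex.conj_eq_iff_im]
      have h1 : g x ^ 2 = ((p * q : ℝ) : ℂ) := by rw [← map_pow, S.hs]; simp
      have him := congrArg Complex.im h1
      have hre := congrArg Complex.re h1
      rw [Complex.ofReal_im, sq, Complex.mul_im] at him
      rw [Complex.ofReal_re, sq, Complex.mul_re] at hre
      by_contra hne
      have h0 : (g x).re = 0 := by
        have : (g x).re * (g x).im = 0 := by linarith
        exact (mul_eq_zero.1 this).resolve_right hne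
      rw [h0] at hre
      have : (0 : ℝ) ≤ p * q := by positivity
      have : 0 < (g x).im * (g x).im := mul_self_pos.2 hne
      linarith
  | algebraMap r => simp
  | add x y _ _ hx hy => simp [hx, hy]
  | inv x _ hx => simp [hx]
  | mul x y _ _ hx hy => simp [hx, hy]

theorem span_rho {Z W : 𝓞 L} {c : ℕ} (S : Setup p q n ζ s) (D : IData n ζ s Z W c) :
    Ideal.span {1 + Z ^ 2 ^ (n - 1)} = (PP Z W * PP Z (1 - W)) ^ 2 ^ (n - 1) := by
  have hn := S.hn
  have h2 : (Z ^ 2 ^ (n - 1)) ^ 2 ^ 2 = -1 := by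
    rw [← pow_mul, ← pow_add, show n - 1 + 2 = n + 1 by omega, D.hZ2]
  rw [D.conj, Ideal.span_singleton_pow, Ideal.span_singleton_eq_span_singleton]
  exact (assoc_one_add (k := 2 ^ 2) (by decide) h2).trans (assoc_pow D.hZ2 (n - 1) (by omega)).symm

theorem step1 {Z W : 𝓞 L} {c : ℕ} (S : Setup p q n ζ s) (D : IData n ζ s Z W c) (δ : 𝓞 L) (m : ℕ)
    (hδ : PP Z W ^ (2 ^ n * m) = Ideal.span {δ}) :
    ∃ (r : ℕ) (w : L) (u : (𝓞 L)ˣ), Odd r ∧ algebraMap (𝓞 L) L u = r * w ^ 2 ∧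
      ∀ g : L →+* ℂ, ‖g (algebraMap (𝓞 L) L δ)‖ ^ 2 = r * ‖g w‖ ^ 2 * (‖g (1 + ζ ^ 2 ^ (n - 1))‖ ^ 2) ^ m := by
  obtain ⟨M, fM, fL, ⟨a, b, hTT, hb, hab⟩, J, hJ, hJζ, hJs⟩ := S.exJ
  have hq : Algebra.IsQuadraticExtension M L := ⟨fL⟩
  have hn := S.hn
  have hζ0 := S.ζ0
  have hZu : Z * (J • Z) = 1 := by
    apply RingOfIntegers.coe_injective
    rw [map_mul, coe_smul_int, D.hZ, hJζ, mul_inv_cancel₀ hζ0, map_one]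
  have hi : (ζ⁻¹) ^ 2 ^ n = - ζ ^ 2 ^ n := by
    rw [inv_pow]
    have h1 := S.i2
    have h2 : ζ ^ 2 ^ n ≠ 0 := pow_ne_zero _ hζ0
    apply inv_eq_of_mul_eq_one_right
    linear_combination -h1
  have hJW : J • W = 1 - W := by
    apply RingOfIntegers.coe_injective
    rw [coe_smul_int, map_sub, D.hW]
    simp only [map_div₀, map_add, map_mul, map_pow, hJs, hJζ, map_one, map_ofNat, hi]
    ring
  have hJP : J • PP Z W = PP Z (1 - W) := by
    rw [smul_PP, hJW, PP, PP, Ideal.span_insert, Ideal.span_insert]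
    congr 1
    rw [Ideal.span_singleton_eq_span_singleton]
    refine ⟨⟨-Z, -(J • Z), by rw [neg_mul_neg, hZu], by rw [neg_mul_neg, mul_comm, hZu]⟩, ?_⟩
    show (1 - J • Z) * (-Z) = 1 - Z
    linear_combination hZu
  have hJP2 : J • PP Z (1 - W) = PP Z W := by rw [← hJP, qa_invol_ideal hJ]
  obtain ⟨ρ, hρ⟩ : ∃ ρ, ρ = 1 + Z ^ 2 ^ (n - 1) := ⟨_, rfl⟩
  have hρL : algebraMap (𝓞 L) L ρ = 1 + ζ ^ 2 ^ (n - 1) := by rw [hρ]; simp [D.hZ]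
  have hspρ := span_rho S D
  rw [← hρ] at hspρ
  have hsp : Ideal.span {(ρ * J • ρ) ^ m} = Ideal.span {δ * J • δ} := by
    have e1 : Ideal.span {J • δ} = PP Z (1 - W) ^ (2 ^ n * m) := by
      rw [← smul_span, ← hδ, smul_pow', hJP]
    have e2 : Ideal.span {J • ρ} = (PP Z W * PP Z (1 - W)) ^ 2 ^ (n - 1) := by
      rw [← smul_span, hspρ, smul_pow', smul_mul', hJP, hJP2, mul_comm]
    rw [← Ideal.span_singleton_pow, ← Ideal.span_singleton_mul_span_singleton,
      ← Ideal.span_singleton_mul_span_singleton, e1, e2, hspρ, ← hδ, ← pow_add, ← two_mul, ← pow_succ',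
      Nat.sub_add_cancel hn, ← pow_mul, mul_pow]
  obtain ⟨U, hU⟩ := Ideal.span_singleton_eq_span_singleton.1 hsp
  have hδ0 : δ ≠ 0 := by
    rintro rfl
    have := pow_ne_zero (2 ^ n * m) (PP_ne_bot S D).1
    rw [hδ] at this
    simp at this
  have hρ0 : ρ ≠ 0 := by
    rintro rfl
    have h1 : ζ ^ 2 ^ (n - 1) = -1 := by
      rw [map_zero] at hρL; linear_combination -hρL
    have h2 : ζ ^ 2 ^ n = 1 := by
      rw [← Nat.sub_add_cancel hn, pow_succ 2, pow_mul, h1]; norm_num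
    have := S.i2
    rw [h2] at this
    norm_num at this
  have inv : ∀ x : 𝓞 L, J • J • x = x := by
    intro x
    apply RingOfIntegers.coe_injective
    rw [coe_smul_int, coe_smul_int, qa_invol hJ]
  have hJU : J • (U : 𝓞 L) = U := by
    have h1 := congrArg (fun x => J • x) hU
    simp only [smul_mul', smul_pow', inv] at h1
    have h2 : (ρ * J • ρ) ^ m * (J • (U : 𝓞 L)) = (ρ * J • ρ) ^ m * U := by
      rw [hU, mul_comm ρ, mul_comm δ]; exact h1
    refine mul_left_cancel₀ (pow_ne_zero _ (mul_ne_zero hρ0 ?_)) h2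
    intro h0
    apply hρ0
    rw [← inv ρ, h0, smul_zero]
  have hJU' : J • ((U⁻¹ : (𝓞 L)ˣ) : 𝓞 L) = ((U⁻¹ : (𝓞 L)ˣ) : 𝓞 L) := by
    have h1 : J • ((U : 𝓞 L) * ((U⁻¹ : (𝓞 L)ˣ) : 𝓞 L)) = 1 := by rw [Units.mul_inv, smul_one]
    rw [smul_mul', hJU] at h1
    exact (Units.inv_eq_of_mul_eq_one_right h1).symm
  obtain ⟨y, hy⟩ := qa_fixed_int hJ hJU
  obtain ⟨y', hy'⟩ := qa_fixed_int hJ hJU'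
  have hyy : y * y' = 1 := by
    apply FaithfulSMul.algebraMap_injective (𝓞 M) (𝓞 L)
    rw [map_mul, hy, hy', Units.mul_inv, map_one]
  have hconj : ∀ (g : L →+* ℂ) (x : L), g (x * J x) = ((‖g x‖ ^ 2 : ℝ) : ℂ) := by
    intro g x
    have := S.conjJ (J : L →+* L) hJζ hJs g x
    rw [map_mul]
    erw [this]
    rw [Complex.mul_conj']; simp
  have hUL : algebraMap (𝓞 L) L U * (algebraMap (𝓞 L) L ρ * J (algebraMap (𝓞 L) L ρ)) ^ m =
      algebraMap (𝓞 L) L δ * J (algebraMap (𝓞 L) L δ) := by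
    rw [← coe_smul_int, ← coe_smul_int, ← map_mul, ← map_mul, ← map_pow, ← map_mul, ← hU, mul_comm]
  have hyL : algebraMap M L (algebraMap (𝓞 M) M y) = algebraMap (𝓞 L) L U := by
    rw [← hy]; rfl
  have hpos : ∀ (g : L →+* ℂ) (x : L), x ≠ 0 → 0 < ‖g x‖ ^ 2 := by
    intro g x hx
    have : g x ≠ 0 := by simpa using hx
    positivity
  have hδL : algebraMap (𝓞 L) L δ ≠ 0 := by simpa using hδ0
  have hρL0 : algebraMap (𝓞 L) L ρ ≠ 0 := by simpa using hρ0
  have hTP : TP (algebraMap (𝓞 M) M y) := by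
    apply TP.descend (L := L)
    intro g
    rw [hyL]
    have h1 := congrArg g hUL
    rw [map_mul, map_pow, hconj, hconj] at h1
    have h2 := pow_pos (hpos g _ hρL0) m
    have h3 : g (algebraMap (𝓞 L) L U) = ((‖g (algebraMap (𝓞 L) L δ)‖ ^ 2 / (‖g (algebraMap (𝓞 L) L ρ)‖ ^ 2) ^ m : ℝ) : ℂ) := by
      rw [Complex.ofReal_div, eq_div_iff (by exact_mod_cast h2.ne'), ← h1, Complex.ofReal_pow]
    rw [h3]
    have := div_pos (hpos g _ hδL) h2
    exact_mod_cast this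
  obtain ⟨r, hr, w, hw⟩ := M_units S.pq hn hTT hb hab fM ⟨y, y', hyy, by rw [mul_comm, hyy]⟩ hTP
  have hw' : algebraMap (𝓞 M) M y = r * w ^ 2 := hw
  have hUw : algebraMap (𝓞 L) L U = r * (algebraMap M L w) ^ 2 := by
    rw [← hyL, hw']; simp
  refine ⟨r, algebraMap M L w, U, hr, hUw, ?_⟩
  intro g
  have h1 := congrArg g hUL
  have h4 : (algebraMap M L w) ^ 2 = algebraMap M L w * J (algebraMap M L w) := by
    rw [J.commutes, sq]
  rw [map_mul, map_pow, hconj, hconj, hUw, map_mul, map_natCast, h4, hconj, hρL] at h1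
  exact_mod_cast h1.symm

end H3

open IntermediateField NumberField
open scoped Pointwise
set_option linter.unusedSectionVars false

section H4
variable {p q n : ℕ} {L : Type*} [Field L] [NumberField L] {ζ s : L}

theorem coe_smul_intG (σ : Gal(L/ℚ)) (x : 𝓞 L) : algebraMap (𝓞 L) L (σ • x) = σ (algebraMap (𝓞 L) L x) := rfl

theorem five_pow (k : ℕ) : ∃ o, Odd o ∧ 5 ^ 2 ^ k = 1 + 2 ^ (k + 2) * o := by
  induction k with
  | zero => exact ⟨1, odd_one, by norm_num⟩
  | succ k ih =>
    obtain ⟨o, ho, h⟩ := ih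
    refine ⟨o + 2 * (2 ^ k * o ^ 2), ho.add_even (even_two_mul _), ?_⟩
    rw [pow_succ 2 k, pow_mul, h]
    ring

theorem two_pow_root (h : ∀ w : L, w ^ 2 ^ (n + 2) ≠ -1) (a : ℕ) (μ : L) (hμ : μ ^ 2 ^ a = 1) : μ ^ 2 ^ (n + 2) = 1 := by
  induction a with
  | zero =>
    rw [pow_zero, pow_one] at hμ
    rw [hμ, one_pow]
  | succ a ih =>
    rw [pow_succ 2 a, pow_mul] at hμ
    replace hμ : μ ^ 2 ^ a = 1 ∨ μ ^ 2 ^ a = -1 := by simpa using hμ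
    rcases hμ with hμ | hμ
    · exact ih hμ
    · by_cases ha : n + 2 ≤ a
      · exfalso
        apply h (μ ^ 2 ^ (a - (n + 2)))
        rw [← pow_mul, ← pow_add, Nat.sub_add_cancel ha, hμ]
      · have : n + 2 = (a + 1) + (n + 2 - (a + 1)) := by omega
        rw [this, pow_add 2, pow_mul, pow_succ 2 a, pow_mul, hμ]; simp

theorem Setup.autExt (S : Setup p q n ζ s) (g : Gal(L/ℚ)) (h1 : g ζ = ζ) (h2 : g s = s) : g = 1 := by
  ext x
  have hx : x ∈ IntermediateField.adjoin ℚ {ζ, s} := by rw [S.top]; trivial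
  induction hx using IntermediateField.adjoin_induction with
  | mem x hx =>
    rcases hx with rfl | hx
    · exact h1
    · rw [Set.mem_singleton_iff] at hx
      subst hx
      exact h2
  | algebraMap r => simp
  | add x y _ _ hx hy => simp_all
  | inv x _ hx => simp_all
  | mul x y _ _ hx hy => simp_all

theorem aut_pow (τ : Gal(L/ℚ)) (h1 : τ ζ = ζ ^ 5) (j : ℕ) : (τ ^ j) ζ = ζ ^ 5 ^ j := by
  induction j with
  | zero => simp
  | succ j ih =>
    rw [pow_succ', AlgEquiv.mul_apply, ih, map_pow, h1, ← pow_mul, pow_succ']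

theorem aut_pow_s (τ : Gal(L/ℚ)) (h1 : τ s = s) (j : ℕ) : (τ ^ j) s = s := by
  induction j with
  | zero => simp
  | succ j ih => rw [pow_succ', AlgEquiv.mul_apply, ih, h1]

theorem Setup.tau_pow (S : Setup p q n ζ s) (τ : Gal(L/ℚ)) (h1 : τ ζ = ζ ^ 5) (h2 : τ s = s) : τ ^ 2 ^ n = 1 := by
  apply S.autExt
  · rw [aut_pow τ h1]
    obtain ⟨o, -, ho⟩ := five_pow n
    rw [ho, pow_add, pow_mul, S.prim.pow_eq_one]; simp
  · exact aut_pow_s τ h2 _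

theorem Setup.tau_order (S : Setup p q n ζ s) (τ : Gal(L/ℚ)) (h1 : τ ζ = ζ ^ 5) (h2 : τ s = s) : orderOf τ = 2 ^ n := by
  obtain ⟨m, rfl⟩ : ∃ m, n = m + 1 := ⟨n - 1, by have := S.hn; omega⟩
  have : Fact (Nat.Prime 2) := ⟨Nat.prime_two⟩
  apply orderOf_eq_prime_pow
  · intro h
    have h3 := aut_pow τ h1 (2 ^ m)
    obtain ⟨o, hodd, ho⟩ := five_pow m
    rw [h, ho, pow_add, pow_mul, S.hζ, hodd.neg_one_pow, AlgEquiv.one_apply, pow_one] at h3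
    apply S.ζ0
    have h4 : (2 : L) * ζ = 0 := by linear_combination h3
    exact (mul_eq_zero.1 h4).resolve_left two_ne_zero
  · exact S.tau_pow τ h1 h2

theorem Setup.fixTau (S : Setup p q n ζ s) (τ : Gal(L/ℚ)) (h1 : τ ζ = ζ ^ 5) (h2 : τ s = s) (y : L) (hy : y ≠ 0) (k : ℕ)
    (hk : τ y = ζ ^ k * y) : ∃ (x : L) (l : ℕ), τ x = x ∧ x * ζ ^ l = y := by
  have hj : ∀ j : ℕ, ∃ t : ℕ, 4 * t + 1 = 5 ^ j ∧ (τ ^ j) y = ζ ^ (k * t) * y := by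
    intro j
    induction j with
    | zero => exact ⟨0, by simp⟩
    | succ j ih =>
      obtain ⟨t, ht1, ht2⟩ := ih
      refine ⟨5 * t + 1, by rw [pow_succ]; omega, ?_⟩
      rw [pow_succ', AlgEquiv.mul_apply, ht2, map_mul, map_pow, h1, hk]
      ring
  obtain ⟨t, ht1, ht2⟩ := hj (2 ^ n)
  rw [S.tau_pow τ h1 h2, AlgEquiv.one_apply] at ht2
  have h3 : ζ ^ (k * t) = 1 := by
    apply mul_right_cancel₀ hy
    rw [← ht2, one_mul]
  have h4 := S.prim.dvd_of_pow_eq_one _ h3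
  obtain ⟨o, hodd, ho⟩ := five_pow n
  have h5 : t = 2 ^ n * o := by
    have : 4 * t = 4 * (2 ^ n * o) := by
      have : 2 ^ (n + 2) * o = 4 * (2 ^ n * o) := by ring
      omega
    omega
  have h6 : 4 ∣ k := by
    rw [h5, pow_add, show k * (2 ^ n * o) = 2 ^ n * (k * o) by ring] at h4
    have h7 := Nat.dvd_of_mul_dvd_mul_left (by positivity) h4
    have h8 : Nat.Coprime (2 ^ 2) o := Nat.Coprime.pow_left 2 (Nat.coprime_two_left.2 hodd)
    exact h8.dvd_of_dvd_mul_right h7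
  obtain ⟨l, rfl⟩ := h6
  have hl : ζ ^ l ≠ 0 := pow_ne_zero _ S.ζ0
  refine ⟨y / ζ ^ l, l, ?_, div_mul_cancel₀ _ hl⟩
  rw [map_div₀, map_pow, h1, hk, div_eq_div_iff (pow_ne_zero _ (pow_ne_zero _ S.ζ0)) hl]
  ring

theorem step2 {Z W : 𝓞 L} {c : ℕ} (S : Setup p q n ζ s) (D : IData n ζ s Z W c) (δ : 𝓞 L) (m : ℕ)
    (hδ : PP Z W ^ (2 ^ n * m) = Ideal.span {δ}) (τ : Gal(L/ℚ)) (h1 : τ ζ = ζ ^ 5) (h2 : τ s = s) :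
    ∃ (r b l : ℕ) (w x : L) (u : (𝓞 L)ˣ), Odd r ∧ Odd b ∧ algebraMap (𝓞 L) L u = r * w ^ 2 ∧ x ≠ 0 ∧ τ x = x ∧
      x * ζ ^ l * ((1 + ζ ^ 2 ^ (n - 1)) ^ m * w) ^ b = algebraMap (𝓞 L) L δ ^ b := by
  obtain ⟨r, w, u, hr, hu, hg⟩ := step1 S D δ m hδ
  have hn := S.hn
  have hr0 : (r : L) ≠ 0 := by
    have : r ≠ 0 := by rintro rfl; simp at hr
    exact_mod_cast this
  have hu0 : algebraMap (𝓞 L) L u ≠ 0 := by simp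
  have hw0 : w ≠ 0 := by
    rintro rfl
    apply hu0; rw [hu]; simp
  have hδ0 : algebraMap (𝓞 L) L δ ≠ 0 := by
    intro h
    have h' : δ = 0 := by simpa using h
    have := pow_ne_zero (2 ^ n * m) (PP_ne_bot S D).1
    rw [hδ, h'] at this
    simp at this
  have hz8 : (Z ^ 2 ^ (n - 1)) ^ 4 = -1 := by
    rw [show 4 = 2 ^ 2 by norm_num, ← pow_mul, ← pow_add, show n - 1 + 2 = n + 1 by omega, D.hZ2]
  obtain ⟨e2, he2⟩ := assoc_one_add (k := 4) (by decide) hz8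
  obtain ⟨ρ, hρ⟩ : ∃ ρ, ρ = 1 + Z ^ 2 ^ (n - 1) := ⟨_, rfl⟩
  have hρL : algebraMap (𝓞 L) L ρ = 1 + ζ ^ 2 ^ (n - 1) := by rw [hρ]; simp [D.hZ]
  have hτZ : τ • Z = Z ^ 5 := by
    apply RingOfIntegers.coe_injective
    rw [coe_smul_intG, map_pow, D.hZ, h1]
  have hτρ : τ • ρ = ρ * e2 := by
    rw [hρ, he2, smul_add, smul_one, smul_pow', hτZ]
    rw [← pow_mul, mul_comm, pow_mul]
    linear_combination Z ^ 2 ^ (n - 1) * hz8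
  have hρ0 : algebraMap (𝓞 L) L ρ ≠ 0 := by
    intro h
    have h : ρ = 0 := by simpa using h
    rw [hρ] at h
    have : Z ^ 2 ^ (n - 1) = -1 := by linear_combination h
    rw [this] at hz8
    norm_num at hz8
  have hτW : τ • W = W := by
    apply RingOfIntegers.coe_injective
    rw [coe_smul_intG, D.hW]
    simp only [map_div₀, map_add, map_mul, map_pow, h1, h2, map_one, map_ofNat]
    rw [← pow_mul, mul_comm 5, pow_mul]
    congr 3
    linear_combination (ζ ^ 2 ^ n) ^ 3 * S.i2 - ζ ^ 2 ^ n * S.i2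
  have hτP : τ • PP Z W = PP Z W := by
    rw [smul_PP, hτW, hτZ, PP, PP, Ideal.span_insert, Ideal.span_insert]
    congr 1
    rw [Ideal.span_singleton_eq_span_singleton]
    apply associated_of_dvd_dvd
    · obtain ⟨o, ho, ho2⟩ := five_pow n
      have h5 : (Z ^ 5) ^ 5 ^ (2 ^ n - 1) = Z := by
        rw [← pow_mul, ← pow_succ', Nat.sub_add_cancel Nat.one_le_two_pow, ho2, pow_add, pow_mul, pow_succ 2, pow_mul, D.hZ2]
        simp
      have h6 := sub_one_dvd_pow_sub_one (Z ^ 5) (5 ^ (2 ^ n - 1))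
      rw [h5] at h6
      rw [← neg_dvd, ← dvd_neg]
      simpa using h6
    · have h6 := sub_one_dvd_pow_sub_one Z 5
      rw [← neg_dvd, ← dvd_neg]
      simpa using h6
  have hτδ : Associated δ (τ • δ) := by
    rw [← Ideal.span_singleton_eq_span_singleton, ← smul_span, ← hδ, smul_pow', hτP]
  obtain ⟨e1, he1⟩ := hτδ
  obtain ⟨y0, hy0⟩ : ∃ y0, y0 = algebraMap (𝓞 L) L δ / (algebraMap (𝓞 L) L ρ ^ m * w) := ⟨_, rfl⟩
  have hden : algebraMap (𝓞 L) L ρ ^ m * w ≠ 0 := mul_ne_zero (pow_ne_zero _ hρ0) hw0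
  have hy00 : y0 ≠ 0 := by rw [hy0]; exact div_ne_zero hδ0 hden
  have hy0n : ∀ g : L →+* ℂ, ‖g y0‖ ^ 2 = r := by
    intro g
    have h3 := hg g
    have h4 : g y0 * (g (algebraMap (𝓞 L) L ρ) ^ m * g w) = g (algebraMap (𝓞 L) L δ) := by
      rw [← map_pow, ← map_mul, ← map_mul, hy0, div_mul_cancel₀ _ hden]
    rw [← h4, norm_mul, norm_mul, norm_pow, ← hρL] at h3
    have h5 : ‖g (algebraMap (𝓞 L) L ρ)‖ ≠ 0 := by simpa using hρ0
    have h6 : ‖g w‖ ≠ 0 := by simpa using hw0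
    have h7 : (‖g (algebraMap (𝓞 L) L ρ)‖ ^ m * ‖g w‖) ^ 2 ≠ 0 := by positivity
    apply mul_right_cancel₀ h7
    rw [← mul_pow, h3]; ring
  obtain ⟨η, hη⟩ : ∃ η, η = τ y0 / y0 := ⟨_, rfl⟩
  have hηn : ∀ g : L →+* ℂ, ‖g η‖ = 1 := by
    intro g
    have h3 := hy0n g
    have h4 := hy0n (g.comp (τ : L →+* L))
    have h5 : ‖g (τ y0)‖ ^ 2 = r := h4
    have h6 : 0 < ‖g y0‖ := by
      have : g y0 ≠ 0 := by simpa using hy00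
      positivity
    rw [hη, map_div₀, norm_div, div_eq_one_iff_eq h6.ne']
    exact (sq_eq_sq₀ (norm_nonneg _) (norm_nonneg _)).1 (h5.trans h3.symm)
  have hηi : IsIntegral ℤ η := by
    refine IsIntegral.of_pow (n := 2) (by norm_num) ?_
    have hτu : τ (algebraMap (𝓞 L) L u) = r * (τ w) ^ 2 := by rw [hu]; simp
    have hτu0 : τ (algebraMap (𝓞 L) L u) ≠ 0 := by simp
    have hτw0 : τ w ≠ 0 := by simpa using hw0
    have hτu' : τ (algebraMap (𝓞 L) L u) * algebraMap (𝓞 L) L (τ • ((u⁻¹ : (𝓞 L)ˣ) : 𝓞 L)) = 1 := by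
      rw [← coe_smul_intG, ← map_mul, ← smul_mul', Units.mul_inv, smul_one, map_one]
    have hee : algebraMap (𝓞 L) L e2 * algebraMap (𝓞 L) L ((e2⁻¹ : (𝓞 L)ˣ) : 𝓞 L) = 1 := by
      rw [← map_mul, Units.mul_inv, map_one]
    have he20 : algebraMap (𝓞 L) L e2 ≠ 0 := left_ne_zero_of_mul_eq_one hee
    have key : η ^ 2 = algebraMap (𝓞 L) L ((e1 : 𝓞 L) ^ 2 * ((e2⁻¹ : (𝓞 L)ˣ) : 𝓞 L) ^ (2 * m) * u *
        (τ • ((u⁻¹ : (𝓞 L)ˣ) : 𝓞 L))) := by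
      have a1 : τ (algebraMap (𝓞 L) L δ) = algebraMap (𝓞 L) L δ * algebraMap (𝓞 L) L e1 := by
        rw [← coe_smul_intG, ← he1, map_mul]
      have a2 : τ (algebraMap (𝓞 L) L ρ) = algebraMap (𝓞 L) L ρ * algebraMap (𝓞 L) L e2 := by
        rw [← coe_smul_intG, hτρ, map_mul]
      have a3 : algebraMap (𝓞 L) L ((e2⁻¹ : (𝓞 L)ˣ) : 𝓞 L) = (algebraMap (𝓞 L) L e2)⁻¹ :=
        eq_inv_of_mul_eq_one_right hee
      have a4 : algebraMap (𝓞 L) L (τ • ((u⁻¹ : (𝓞 L)ˣ) : 𝓞 L)) = (τ (algebraMap (𝓞 L) L u))⁻¹ :=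
        eq_inv_of_mul_eq_one_right hτu'
      rw [map_mul, map_mul, map_mul, map_pow, map_pow, a3, a4, hτu, hu, hη, hy0, map_div₀, map_mul, map_pow, a1, a2]
      field_simp
      rw [mul_pow _ _ m, mul_pow, ← pow_mul (algebraMap (𝓞 L) L e2), mul_comm m 2, mul_assoc, one_div, inv_pow,
        mul_inv_cancel₀ (pow_ne_zero _ he20), mul_one]
    rw [key]; exact RingOfIntegers.isIntegral_coe _
  obtain ⟨N, hN, hηN⟩ := NumberField.Embeddings.pow_eq_one_of_norm_eq_one L ℂ hηi hηn
  obtain ⟨a, b, hb, rfl⟩ := Nat.exists_eq_two_pow_mul_odd hN.ne'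
  have hμ : (η ^ b) ^ 2 ^ a = 1 := by rw [← pow_mul, mul_comm, hηN]
  have hμ2 := two_pow_root S.no_root a _ hμ
  obtain ⟨k, -, hk⟩ := S.prim.eq_pow_of_pow_eq_one hμ2
  obtain ⟨x, l, hx, hxl⟩ := S.fixTau τ h1 h2 (y0 ^ b) (pow_ne_zero _ hy00) k (by
    rw [hk, hη, map_pow, div_pow, div_mul_cancel₀ _ (pow_ne_zero _ hy00)])
  refine ⟨r, b, l, w, x, u, hr, hb, hu, ?_, hx, ?_⟩
  · rintro rfl
    rw [zero_mul] at hxl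
    exact pow_ne_zero b hy00 hxl.symm
  · rw [hxl, hy0, hρL, ← mul_pow, div_mul_cancel₀]
    rw [← hρL]; exact hden

end H4

open IntermediateField NumberField
open scoped Pointwise
set_option linter.unusedSectionVars false

theorem pow_exp_le {R : Type*} [CommMonoidWithZero R] [IsCancelMulZero R] {P A B : R} (hP : P ≠ 0) (a b : ℕ)
    (h : P ^ a * A = P ^ b * B) (hA : ¬ P ∣ A) : b ≤ a := by
  by_contra! hlt
  obtain ⟨k, rfl⟩ : ∃ k, b = a + (k + 1) := ⟨b - a - 1, by omega⟩
  rw [pow_add, mul_assoc] at h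
  have h1 := mul_left_cancel₀ (pow_ne_zero a hP) h
  apply hA
  rw [h1, pow_succ', mul_assoc]
  exact Dvd.intro _ rfl

section H5
variable {p q n : ℕ} {L : Type*} [Field L] [NumberField L] {ζ s : L}

theorem val_fixed {Z W : 𝓞 L} {c : ℕ} (S : Setup p q n ζ s) (D : IData n ζ s Z W c) (τ : Gal(L/ℚ))
    (h1 : τ ζ = ζ ^ 5) (h2 : τ s = s) (x : L) (hx0 : x ≠ 0) (hx : τ x = x) :
    ∃ (A B : 𝓞 L) (e f : ℕ) (I J : Ideal (𝓞 L)), algebraMap (𝓞 L) L A = x * algebraMap (𝓞 L) L B ∧ B ≠ 0 ∧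
      Ideal.span {A} = PP Z W ^ (2 ^ n * e) * I ∧ Ideal.span {B} = PP Z W ^ (2 ^ n * f) * J ∧
      ¬ PP Z W ∣ I ∧ ¬ PP Z W ∣ J := by
  obtain ⟨F, hF⟩ : ∃ F, F = IntermediateField.fixedField (Subgroup.zpowers τ) := ⟨_, rfl⟩
  have hfin : Module.finrank F L = 2 ^ n := by
    rw [hF, IntermediateField.finrank_fixedField_eq_card, Nat.card_zpowers, S.tau_order τ h1 h2]
  have hmem : ∀ y : L, τ y = y → ∃ y' : F, algebraMap F L y' = y := by
    intro y hy
    have : y ∈ F := by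
      rw [hF, IntermediateField.mem_fixedField_iff]
      intro g hg
      have h3 : Subgroup.zpowers τ ≤ MulAction.stabilizer Gal(L/ℚ) y := by
        rw [Subgroup.zpowers_le, MulAction.mem_stabilizer_iff]; exact hy
      exact h3 hg
    exact ⟨⟨y, this⟩, rfl⟩
  have hintg : ∀ y : 𝓞 L, τ (algebraMap (𝓞 L) L y) = algebraMap (𝓞 L) L y → ∃ y' : 𝓞 F, algebraMap (𝓞 F) (𝓞 L) y' = y := by
    intro y hy
    obtain ⟨y', hy'⟩ := hmem _ hy
    refine ⟨⟨y', (isIntegral_algebraMap_iff (algebraMap F L).injective).1 (by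
      rw [hy']; exact RingOfIntegers.isIntegral_coe _)⟩, ?_⟩
    apply RingOfIntegers.coe_injective
    exact hy'
  have hi : τ (ζ ^ 2 ^ n) = ζ ^ 2 ^ n := by
    rw [map_pow, h1, ← pow_mul, mul_comm 5, pow_mul]
    linear_combination ((ζ ^ 2 ^ n) ^ 3 - ζ ^ 2 ^ n) * S.i2
  obtain ⟨I0, hI0⟩ := hintg (Z ^ 2 ^ n) (by rw [map_pow, D.hZ, hi])
  obtain ⟨W0, hW0⟩ := hintg W (by rw [D.hW, map_div₀, map_add, map_mul, hi, h2, map_one, map_ofNat])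
  obtain ⟨P0, hP0⟩ : ∃ P0 : Ideal (𝓞 F), P0 = Ideal.span {1 - I0, W0} := ⟨_, rfl⟩
  have hext : extI L P0 = PP Z W ^ 2 ^ n := by
    rw [D.pow2 n (by omega), hP0, extI, Ideal.map_span, Set.image_insert_eq, Set.image_singleton, map_sub, hI0, hW0, map_one]
  have hnorm : Ideal.absNorm P0 = 2 := by
    have h3 := Ideal.absNorm_algebraMap (𝓞 F) (S := 𝓞 L) P0
    have h4 : Ideal.absNorm (P0.map (algebraMap (𝓞 F) (𝓞 L))) = 2 ^ 2 ^ n := by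
      have := congrArg Ideal.absNorm hext
      rwa [map_pow, (norm_PP S D).1] at this
    rw [h4, ← IsFractionRing.finrank_eq (𝓞 F) F (𝓞 L) L, hfin] at h3
    exact (Nat.pow_left_injective (by positivity : 2 ^ n ≠ 0) h3).symm
  have hprime : P0.IsPrime := Ideal.isPrime_of_irreducible_absNorm (by rw [hnorm]; exact Nat.prime_two)
  have hbot : P0 ≠ ⊥ := by intro h; rw [h] at hnorm; simp at hnorm
  have hmax : P0.IsMaximal := hprime.isMaximal hbot
  have key : ∀ a : 𝓞 F, a ≠ 0 → ∃ e I, Ideal.span {algebraMap (𝓞 F) (𝓞 L) a} = PP Z W ^ (2 ^ n * e) * I ∧ ¬ PP Z W ∣ I := by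
    intro a ha
    have hfm : FiniteMultiplicity P0 (Ideal.span {a}) := by
      apply FiniteMultiplicity.of_not_isUnit
      · rw [Ideal.isUnit_iff]; exact hprime.ne_top
      · exact span_ne_bot ha
    obtain ⟨A, hA, hA2⟩ := hfm.exists_eq_pow_mul_and_not_dvd
    refine ⟨multiplicity P0 (Ideal.span {a}), extI L A, ?_, ?_⟩
    · rw [← extG_span, hA, extG_mul, extG_pow, hext, ← pow_mul]
      rw [← hA]
    · intro hd
      have hsup : P0 ⊔ A = ⊤ := by
        by_contra hne
        apply hA2
        rw [Ideal.dvd_iff_le]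
        have := hmax.eq_of_le hne le_sup_left
        rw [this]; exact le_sup_right
      have h3 := congrArg (extI L) hsup
      simp only [extI, Ideal.map_sup, Ideal.map_top] at h3
      have h4 : extI L P0 ≤ PP Z W := by rw [hext]; exact Ideal.pow_le_self (by positivity)
      have h5 : extI L A ≤ PP Z W := Ideal.dvd_iff_le.1 hd
      apply (PP_prime S D).1.ne_top
      rw [eq_top_iff, ← h3]
      exact sup_le h4 h5
  obtain ⟨x', hx'⟩ := hmem x hx
  obtain ⟨a, b, hb, hab⟩ := IsFractionRing.div_surjective (A := 𝓞 F) x'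
  have hb0 : b ≠ 0 := nonZeroDivisors.ne_zero hb
  have hb1 : algebraMap (𝓞 F) F b ≠ 0 := by simpa using hb0
  have ha0 : a ≠ 0 := by
    rintro rfl
    apply hx0
    rw [← hx', ← hab]; simp
  obtain ⟨e, I, hI, hI2⟩ := key a ha0
  obtain ⟨f, J, hJ, hJ2⟩ := key b hb0
  refine ⟨_, _, e, f, I, J, ?_, ?_, hI, hJ, hI2, hJ2⟩
  · have h3 : algebraMap (𝓞 F) F a = x' * algebraMap (𝓞 F) F b := by
      rw [← hab, div_mul_cancel₀ _ hb1]
    have h4 := congrArg (algebraMap F L) h3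
    rw [map_mul, hx'] at h4
    exact h4
  · intro h
    apply hb0
    apply FaithfulSMul.algebraMap_injective (𝓞 F) (𝓞 L)
    rw [h, map_zero]

theorem PP_lower {Z W : 𝓞 L} {c : ℕ} (S : Setup p q n ζ s) (D : IData n ζ s Z W c) (m : ℕ) (hm : Odd m) :
    cl (PP Z W) ^ (2 ^ n * m) ≠ 1 := by
  intro h
  have hP0 := (PP_ne_bot S D).1
  rw [← cl_pow hP0, cl_eq_one_iff (pow_ne_zero _ hP0)] at h
  obtain ⟨δ, hδ⟩ := h
  obtain ⟨τ, h1, h2⟩ := S.aut 5 (by decide)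
  obtain ⟨r, b, l, w, x, u, hr, hb, hu, hx0, hx, hrel⟩ := step2 S D δ m hδ τ h1 h2
  obtain ⟨A, B, e, f, I, J, hAB, hB, hA2, hB2, hI, hJ⟩ := val_fixed S D τ h1 h2 x hx0 hx
  have hprime : Prime (PP Z W) := Ideal.prime_of_isPrime hP0 (PP_prime S D).1
  obtain ⟨ρ, hρ⟩ : ∃ ρ, ρ = 1 + Z ^ 2 ^ (n - 1) := ⟨_, rfl⟩
  have hρL : algebraMap (𝓞 L) L ρ = 1 + ζ ^ 2 ^ (n - 1) := by rw [hρ]; simp [D.hZ]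
  have hspρ := span_rho S D
  rw [← hρ] at hspρ
  have hZu : IsUnit Z := by
    refine IsUnit.of_pow_eq_one (n := 2 ^ (n + 2)) ?_ (by positivity)
    rw [pow_succ 2, pow_mul, D.hZ2]; norm_num
  have heq : A ^ 2 * ρ ^ (2 * m * b) * (Z ^ (2 * l) * (u : 𝓞 L) ^ b) = (r : 𝓞 L) ^ b * δ ^ (2 * b) * B ^ 2 := by
    apply RingOfIntegers.coe_injective
    simp only [map_mul, map_pow, hAB, hρL, D.hZ, hu, map_natCast]
    have h3 := congrArg (fun y => y ^ 2) hrel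
    have h4 : (algebraMap (𝓞 L) L δ) ^ (2 * b) = (algebraMap (𝓞 L) L δ ^ b) ^ 2 := by rw [← pow_mul, mul_comm]
    rw [h4, ← h3]
    ring
  have hid : Ideal.span {A} ^ 2 * Ideal.span {ρ} ^ (2 * m * b) =
      Ideal.span {(r : 𝓞 L)} ^ b * Ideal.span {δ} ^ (2 * b) * Ideal.span {B} ^ 2 := by
    simp only [Ideal.span_singleton_pow, Ideal.span_singleton_mul_span_singleton]
    rw [← heq, Ideal.span_singleton_eq_span_singleton]
    exact (associated_mul_unit_right _ _ ((hZu.pow _).mul (u.isUnit.pow _)))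
  rw [hA2, hB2, hspρ, ← hδ] at hid
  have hr2 : ¬ PP Z W ∣ Ideal.span {(r : 𝓞 L)} := by
    intro hd
    rw [Ideal.dvd_iff_le, Ideal.span_singleton_le_iff_mem] at hd
    have h3 := Ideal.absNorm_mem (PP Z W)
    rw [(norm_PP S D).1] at h3
    obtain ⟨k, hk⟩ := hr
    apply (PP_prime S D).1.ne_top
    rw [Ideal.eq_top_iff_one]
    have h4 := Ideal.sub_mem _ hd (Ideal.mul_mem_right (k : 𝓞 L) _ h3)
    rw [hk] at h4
    convert h4 using 1
    push_cast; ring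
  have hPP' : ¬ PP Z W ∣ PP Z (1 - W) := by
    intro hd
    rw [Ideal.dvd_iff_le] at hd
    have h3 := Ideal.isCoprime_iff_sup_eq.1 (IData.coprime (Z := Z) (W := W))
    rw [sup_eq_left.2 hd] at h3
    exact (PP_prime S D).1.ne_top h3
  generalize PP Z (1 - W) = P' at *
  generalize PP Z W = P at *
  obtain ⟨k, rfl⟩ : ∃ k, n = k + 1 := ⟨n - 1, by have := S.hn; omega⟩
  simp only [Nat.add_sub_cancel] at hid
  have hid2 : P ^ (2 ^ k * (2 * (2 * e) + 2 * m * b)) * (I ^ 2 * P' ^ (2 ^ k * (2 * m * b))) =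
      P ^ (2 ^ k * (2 * m * (2 * b) + 2 * (2 * f))) * (Ideal.span {(r : 𝓞 L)} ^ b * J ^ 2) := by
    calc _ = (P ^ (2 ^ (k + 1) * e) * I) ^ 2 * ((P * P') ^ 2 ^ k) ^ (2 * m * b) := by ring
      _ = _ := hid
      _ = _ := by ring
  have hn1 : ¬ P ∣ I ^ 2 * P' ^ (2 ^ k * (2 * m * b)) := by
    intro hd
    rcases hprime.dvd_or_dvd hd with h | h
    · exact hI (hprime.dvd_of_dvd_pow h)
    · exact hPP' (hprime.dvd_of_dvd_pow h)
  have hn2 : ¬ P ∣ Ideal.span {(r : 𝓞 L)} ^ b * J ^ 2 := by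
    intro hd
    rcases hprime.dvd_or_dvd hd with h | h
    · exact hr2 (hprime.dvd_of_dvd_pow h)
    · exact hJ (hprime.dvd_of_dvd_pow h)
  have h5 := le_antisymm (pow_exp_le hP0 _ _ hid2.symm hn2) (pow_exp_le hP0 _ _ hid2 hn1)
  have h6 := Nat.eq_of_mul_eq_mul_left (by positivity) h5
  have h7 : Odd (m * b) := hm.mul hb
  have h8 : 2 * e + m * b = 2 * (m * b) + 2 * f := by
    have : 2 * (2 * e + m * b) = 2 * (2 * (m * b) + 2 * f) := by
      calc _ = 2 * (2 * e) + 2 * m * b := by ring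
        _ = _ := h6
        _ = _ := by ring
    omega
  obtain ⟨o, ho⟩ := h7
  omega

theorem Setup.main (S : Setup p q n ζ s) :
    Nonempty (CommGroup.primaryComponent (ClassGroup (𝓞 L)) 2 ≃* Multiplicative (ZMod (2 ^ (n + 1)))) := by
  obtain ⟨Z, W, c, D⟩ := S.idata
  obtain ⟨h, hodd, hup⟩ := PP_upper S D
  exact group_lemma n S.tors (cl (PP Z W)) (PP_nonsq S D) h hodd hup (PP_lower S D)

end H5

theorem gen_top2C (E : IntermediateField ℚ ℂ) (a b : ℂ)
    (hE : E = IntermediateField.adjoin ℚ {a, b}) :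
    ∃ x y : E, algebraMap E ℂ x = a ∧ algebraMap E ℂ y = b ∧ IntermediateField.adjoin ℚ {x, y} = ⊤ := by
  have ha : a ∈ E := by rw [hE]; exact IntermediateField.subset_adjoin _ _ (by simp)
  have hb : b ∈ E := by rw [hE]; exact IntermediateField.subset_adjoin _ _ (by simp)
  refine ⟨⟨a, ha⟩, ⟨b, hb⟩, rfl, rfl, ?_⟩
  have key : ∀ A : Algebra ℚ E, A = E.algebra' →
      @IntermediateField.adjoin ℚ _ E _ A {⟨a, ha⟩, ⟨b, hb⟩} = ⊤ := by
    rintro A rfl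
    apply IntermediateField.map_injective E.val
    rw [IntermediateField.adjoin_map, ← AlgHom.fieldRange_eq_map]
    simp [Set.image_insert_eq, hE]
  exact key _ (Subsingleton.elim _ _)

theorem Lfield_gen (n : ℕ) (d : ℤ) : ∃ a b : ℂ, a ^ 2 ^ (n + 1) = -1 ∧ b ^ 2 = d ∧
    Lfield n d = IntermediateField.adjoin ℚ {a, b} := by
  have hprim := Complex.isPrimitiveRoot_exp (2 ^ (n + 2)) (by positivity)
  set a := Complex.exp (2 * Real.pi * Complex.I / ((2 ^ (n + 2) : ℕ) : ℂ)) with hadef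
  obtain ⟨b, hb⟩ := IsAlgClosed.exists_pow_nat_eq (d : ℂ) (n := 2) (by norm_num)
  have ha : a ^ 2 ^ (n + 1) = -1 := by
    have h2 : IsPrimitiveRoot (a ^ 2 ^ (n + 1)) 2 :=
      hprim.pow (by positivity) (by ring)
    exact h2.eq_neg_one_of_two_right
  refine ⟨a, b, ha, hb, ?_⟩
  apply le_antisymm
  · rw [Lfield, IntermediateField.adjoin_le_iff]
    have haM : a ∈ IntermediateField.adjoin ℚ {a, b} := IntermediateField.subset_adjoin _ _ (by simp)
    have hbM : b ∈ IntermediateField.adjoin ℚ {a, b} := IntermediateField.subset_adjoin _ _ (by simp)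
    rintro z (hz | hz)
    · obtain ⟨i, -, rfl⟩ := hprim.eq_pow_of_pow_eq_one hz
      exact pow_mem haM i
    · have : z ^ 2 = b ^ 2 := by rw [hb]; exact hz
      rcases sq_eq_sq_iff_eq_or_eq_neg.1 this with h | h
      · rw [h]; exact hbM
      · rw [h]; exact neg_mem hbM
  · rw [IntermediateField.adjoin_le_iff]
    rintro z (rfl | rfl)
    · exact IntermediateField.subset_adjoin _ _ (Or.inl hprim.pow_eq_one)
    · exact IntermediateField.subset_adjoin _ _ (Or.inr hb)

theorem final_aux (E : IntermediateField ℚ ℂ) (p q n : ℕ) (a b : ℂ) (hpq : PQ p q) (hn : 1 ≤ n)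
    (ha : a ^ 2 ^ (n + 1) = -1) (hb : b ^ 2 = (p : ℂ) * q)
    (hE : E = IntermediateField.adjoin ℚ {a, b}) :
    Nonempty (CommGroup.primaryComponent (ClassGroup (𝓞 E)) 2 ≃* Multiplicative (ZMod (2 ^ (n + 1)))) := by
  have hfd : FiniteDimensional ℚ E := by
    rw [hE]
    apply IntermediateField.finiteDimensional_adjoin
    rintro z (rfl | rfl)
    · refine IsIntegral.of_pow (n := 2 ^ (n + 1)) (by positivity) ?_
      rw [ha]; exact isIntegral_one.neg
    · refine IsIntegral.of_pow (n := 2) (by positivity) ?_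
      rw [hb]; exact_mod_cast (isIntegral_algebraMap (R := ℚ) (x := ((p * q : ℕ) : ℚ)))
  have : NumberField E := { to_charZero := inferInstance, to_finiteDimensional := by convert hfd }
  obtain ⟨x, y, hx, hy, htop⟩ := gen_top2C E a b hE
  have S : Setup p q n x y :=
    { pq := hpq, hn := hn
      hζ := by
        apply (algebraMap E ℂ).injective
        rw [map_pow, hx, ha, map_neg, map_one]
      hs := by
        apply (algebraMap E ℂ).injective
        rw [map_pow, hy, hb, map_mul, map_natCast, map_natCast]
      top := htop }
  exact S.main

/-- for primes `p ≡ 5 (mod 8)` and `q ≡ 3 (mod 8)` with `(p/q) = -1`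
and `d = pq`, the 2-class group of `L_{n,d}` is `ℤ/2^{n+1}ℤ` for all `n ≥ 1`. -/
theorem twoClassGroup_Lfield_pq_neg_legendre
    (p q : ℕ) (hp : p.Prime) (hq : q.Prime)
    (hp8 : p % 8 = 5) (hq8 : q % 8 = 3)
    (hleg : jacobiSym (p : ℤ) q = -1)
    (n : ℕ) (hn : 1 ≤ n) :
    Nonempty ((twoClassGroup (Lfield n ((p : ℤ) * q))) ≃*
      Multiplicative (ZMod (2 ^ (n + 1)))) := by
  obtain ⟨a, b, ha, hb, hE⟩ := Lfield_gen n ((p : ℤ) * q)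
  exact final_aux _ p q n a b ⟨hp, hq, hp8, hq8, hleg⟩ hn ha (by rw [hb]; push_cast; rfl) hE
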